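/- arXiv:1605.05536 — 12 statements merged into one kernel-verified Lean document; each statement's English description precedes it below -/
import Mathlib

section
/- Let n ≥ 2, m ≥ 1, a ≥ 0 be integers with (a, m) ≠ (0, 1). Then the partition zeta function ζ_{𝒫_{a+mℕ}}(n), i.e. the sum of n_λ^{−n} over all partitions λ whose parts all lie in the arithmetic progression {a+m, a+2m, a+3m, …}, converges, and ζ_{𝒫_{a+mℕ}}(n) = ∏_{j=1}^{∞} (a+mj)^n / ((a+mj)^n − 1) = Γ(1 + a/m)^{−n} · ∏_{r=0}^{n−1} Γ(1 + (a − e(r/n))/m). -/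
/-- `e(x) := e^{2πix}`. -/
noncomputable def eFn (x : ℂ) : ℂ := Complex.exp (2 * Real.pi * Complex.I * x)

open Filter Topology

lemma eFn_natCast_div (r n : ℕ) :
    eFn ((r : ℂ) / (n : ℂ)) = Complex.exp (2 * Real.pi * Complex.I / n) ^ r := by
  rw [eFn, ← Complex.exp_nat_mul]
  congr 1
  ring

lemma sum_eFn_eq_zero {n : ℕ} (hn : 2 ≤ n) :
    ∑ r ∈ Finset.range n, eFn ((r : ℂ) / (n : ℂ)) = 0 := by
  simp_rw [eFn_natCast_div]
  exact (Complex.isPrimitiveRoot_exp n (by omega)).geom_sum_eq_zero (by omega)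

lemma prod_sub_eFn {n : ℕ} (hn : 0 < n) (z : ℂ) :
    ∏ r ∈ Finset.range n, (z - eFn ((r : ℂ) / (n : ℂ))) = z ^ n - 1 := by
  simp_rw [eFn_natCast_div]
  have h := congrArg (Polynomial.eval z)
    (X_pow_sub_C_eq_prod (Complex.isPrimitiveRoot_exp n hn.ne') hn (one_pow n))
  simpa [Polynomial.eval_prod] using h.symm

/-- Splitting off one possible part `i` from a multiset. -/
def multisetInsertEquiv {ι : Type*} [DecidableEq ι] {i : ι} {s : Finset ι} (hi : i ∉ s) :
    {μ : Multiset ι // ∀ x ∈ μ, x ∈ insert i s} ≃ ℕ × {μ : Multiset ι // ∀ x ∈ μ, x ∈ s} where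
  toFun μ := (μ.1.count i, ⟨μ.1.filter (· ≠ i), fun x hx => by
    have h := Multiset.mem_filter.mp hx
    exact (Finset.mem_insert.mp (μ.2 x h.1)).resolve_left h.2⟩)
  invFun p := ⟨Multiset.replicate p.1 i + p.2.1, fun x hx => by
    rcases Multiset.mem_add.mp hx with h | h
    · exact Finset.mem_insert.mpr (Or.inl (Multiset.eq_of_mem_replicate h))
    · exact Finset.mem_insert_of_mem (p.2.2 x h)⟩
  left_inv μ := by
    ext1
    change Multiset.replicate (μ.1.count i) i + μ.1.filter (· ≠ i) = μ.1
    rw [← Multiset.filter_eq', Multiset.filter_add_not]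
  right_inv p := by
    obtain ⟨k, ν, hν⟩ := p
    have hiν : i ∉ ν := fun h => hi (hν i h)
    ext1
    · simp [Multiset.count_eq_zero_of_notMem hiν]
    · ext1
      change (Multiset.replicate k i + ν).filter (· ≠ i) = ν
      rw [Multiset.filter_add, Multiset.filter_eq_self.mpr (fun x hx => ne_of_mem_of_not_mem hx hiν),
        Multiset.filter_eq_nil.mpr (fun x hx h => h (Multiset.eq_of_mem_replicate hx)), zero_add]

lemma multiset_prod_map_nonneg {ι : Type*} {f : ι → ℝ} (h0 : ∀ i, 0 ≤ f i) (μ : Multiset ι) :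
    0 ≤ (μ.map f).prod :=
  Multiset.prod_nonneg fun y hy => by
    obtain ⟨x, -, rfl⟩ := Multiset.mem_map.mp hy
    exact h0 x

lemma hasSum_multiset_prod_of_finset {ι : Type*} {f : ι → ℝ} (h0 : ∀ i, 0 ≤ f i)
    (h1 : ∀ i, f i < 1) (s : Finset ι) :
    HasSum (fun μ : {μ : Multiset ι // ∀ x ∈ μ, x ∈ s} => (μ.1.map f).prod)
      (∏ i ∈ s, (1 - f i)⁻¹) := by
  classical
  induction s using Finset.induction_on with
  | empty =>
    let _ : Unique {μ : Multiset ι // ∀ x ∈ μ, x ∈ (∅ : Finset ι)} :=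
      { default := ⟨0, by simp⟩
        uniq := fun μ => Subtype.ext (Multiset.eq_zero_of_forall_notMem
          fun x hx => Finset.notMem_empty x (μ.2 x hx)) }
    convert hasSum_unique (fun μ : {μ : Multiset ι // ∀ x ∈ μ, x ∈ (∅ : Finset ι)} =>
      (μ.1.map f).prod) using 1
    change _ = (Multiset.map f 0).prod
    simp
  | insert i s hi ih =>
    rw [Finset.prod_insert hi, ← (multisetInsertEquiv hi).symm.hasSum_iff]
    have hg := hasSum_geometric_of_lt_one (h0 i) (h1 i)
    have hfg := hg.summable.mul_of_nonneg ih.summable (fun k => pow_nonneg (h0 i) k)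
      (fun μ => multiset_prod_map_nonneg h0 μ.1)
    have hcongr : (fun μ : {μ : Multiset ι // ∀ x ∈ μ, x ∈ insert i s} => (μ.1.map f).prod) ∘
        (multisetInsertEquiv hi).symm = fun p => f i ^ p.1 * (p.2.1.map f).prod := by
      funext p
      change ((Multiset.replicate p.1 i + p.2.1).map f).prod = _
      simp
    rw [hcongr]
    exact hg.mul ih hfg

lemma hasSum_multiset_prod {ι : Type*} {f : ι → ℝ} (h0 : ∀ i, 0 ≤ f i) (h1 : ∀ i, f i < 1)
    {P : ℝ} (hP : HasProd (fun i => (1 - f i)⁻¹) P) :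
    HasSum (fun μ : Multiset ι => (μ.map f).prod) P := by
  classical
  have hnn := multiset_prod_map_nonneg h0
  have hone : ∀ i, 1 ≤ (1 - f i)⁻¹ := fun i =>
    (one_le_inv₀ (by linarith [h1 i])).mpr (by linarith [h0 i])
  have hmono : Monotone fun s : Finset ι => ∏ i ∈ s, (1 - f i)⁻¹ := fun s t hst =>
    Finset.prod_le_prod_of_subset_of_one_le hst (fun i _ => zero_le_one.trans (hone i))
      fun i _ _ => hone i
  refine hasSum_of_isLUB_of_nonneg _ hnn ⟨?_, fun b hb => ?_⟩
  · rintro _ ⟨T, rfl⟩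
    let s : Finset ι := T.biUnion Multiset.toFinset
    have hs : ∀ μ ∈ T, ∀ x ∈ μ, x ∈ s := fun μ hμ x hx =>
      Finset.mem_biUnion.mpr ⟨μ, hμ, Multiset.mem_toFinset.mpr hx⟩
    refine le_trans ?_ (hmono.ge_of_tendsto hP s)
    change ∑ μ ∈ T, (μ.map f).prod ≤ _
    rw [← Finset.sum_subtype_of_mem (fun μ : Multiset ι => (μ.map f).prod) hs]
    exact sum_le_hasSum _ (fun μ _ => hnn μ.1) (hasSum_multiset_prod_of_finset h0 h1 s)
  · refine le_of_tendsto hP (Eventually.of_forall fun s => ?_)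
    refine hasSum_le_of_sum_le (hasSum_multiset_prod_of_finset h0 h1 s) fun T => ?_
    refine le_trans (le_of_eq ?_) (hb ⟨T.map (Function.Embedding.subtype _), rfl⟩)
    simp

/-- Multisets on `ι` correspond to multisets in the image of an injection. -/
noncomputable def multisetMapEquiv {ι κ : Type*} (g : ι → κ) (hg : Function.Injective g)
    (p : κ → Prop) (hp : ∀ k, p k ↔ ∃ i, g i = k) :
    Multiset ι ≃ {μ : Multiset κ // ∀ x ∈ μ, p x} :=
  Equiv.ofBijective
    (fun μ => ⟨μ.map g, fun x hx => (hp x).mpr <| by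
      obtain ⟨i, -, rfl⟩ := Multiset.mem_map.mp hx
      exact ⟨i, rfl⟩⟩)
    ⟨fun μ ν h => Multiset.map_injective hg (congrArg Subtype.val h), by
      rintro ⟨μ, hμ⟩
      simp only [Subtype.mk.injEq]
      induction μ using Multiset.induction_on with
      | empty => exact ⟨0, rfl⟩
      | cons k μ ih =>
        obtain ⟨ν, hν⟩ := ih fun x hx => hμ x (Multiset.mem_cons_of_mem hx)
        obtain ⟨i, hi⟩ := (hp k).mp (hμ k (Multiset.mem_cons_self k μ))
        exact ⟨i ::ₘ ν, by simp [hi, hν]⟩⟩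

lemma summable_inv_arithmeticProgression_pow {n m : ℕ} (a : ℕ) (hn : 2 ≤ n) (hm : 1 ≤ m) :
    Summable fun j : ℕ => (((a + m * (j + 1) : ℕ) : ℝ) ^ n)⁻¹ := by
  have h := (summable_nat_add_iff 1).mpr (Real.summable_nat_pow_inv.mpr hn)
  refine h.of_nonneg_of_le (fun j => by positivity) fun j => ?_
  have hj : j + 1 ≤ a + m * (j + 1) :=
    (Nat.le_mul_of_pos_left (j + 1) hm).trans (Nat.le_add_left _ a)
  exact inv_anti₀ (by positivity) (pow_le_pow_left₀ (by positivity) (Nat.cast_le.mpr hj) n)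

lemma prod_GammaSeq_div {n m : ℕ} (a : ℕ) (hn : 2 ≤ n) (hm : 1 ≤ m) {N : ℕ} (hN : N ≠ 0) :
    (∏ r ∈ Finset.range n,
        Complex.GammaSeq (1 + ((a : ℂ) - eFn ((r : ℂ) / (n : ℂ))) / (m : ℂ)) N) /
      Complex.GammaSeq (1 + (a : ℂ) / (m : ℂ)) N ^ n =
    ∏ j ∈ Finset.range (N + 1),
      (((a + m * (j + 1) : ℕ) : ℂ) ^ n) / (((a + m * (j + 1) : ℕ) : ℂ) ^ n - 1) := by
  have hm0 : (m : ℂ) ≠ 0 := by exact_mod_cast (by omega : m ≠ 0)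
  have hN0 : (N : ℂ) ≠ 0 := by exact_mod_cast hN
  have hfac : ((N.factorial : ℕ) : ℂ) ≠ 0 := by exact_mod_cast N.factorial_ne_zero
  have hpow : ∏ r ∈ Finset.range n,
      (N : ℂ) ^ (1 + ((a : ℂ) - eFn ((r : ℂ) / (n : ℂ))) / (m : ℂ)) =
      ((N : ℂ) ^ (1 + (a : ℂ) / (m : ℂ))) ^ n := by
    have hsum : ∑ r ∈ Finset.range n, (1 + ((a : ℂ) - eFn ((r : ℂ) / (n : ℂ))) / (m : ℂ)) =
        n * (1 + (a : ℂ) / (m : ℂ)) := by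
      rw [Finset.sum_add_distrib, ← Finset.sum_div, Finset.sum_sub_distrib, sum_eFn_eq_zero hn]
      simp
      ring
    simp_rw [Complex.cpow_def_of_ne_zero hN0]
    rw [← Complex.exp_sum, ← Finset.mul_sum, hsum, ← Complex.exp_nat_mul]
    ring_nf
  have hden : ∏ r ∈ Finset.range n, ∏ j ∈ Finset.range (N + 1),
      (1 + ((a : ℂ) - eFn ((r : ℂ) / (n : ℂ))) / (m : ℂ) + j) =
      ∏ j ∈ Finset.range (N + 1), ((((a + m * (j + 1) : ℕ) : ℂ) ^ n - 1) / (m : ℂ) ^ n) := by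
    rw [Finset.prod_comm]
    refine Finset.prod_congr rfl fun j _ => ?_
    rw [← prod_sub_eFn (by omega)]
    have : (m : ℂ) ^ n = ∏ r ∈ Finset.range n, (m : ℂ) := by simp
    rw [this, ← Finset.prod_div_distrib]
    refine Finset.prod_congr rfl fun r _ => ?_
    push_cast
    field_simp
    ring
  have hnum : (∏ j ∈ Finset.range (N + 1), (1 + (a : ℂ) / (m : ℂ) + j)) ^ n =
      ∏ j ∈ Finset.range (N + 1), (((a + m * (j + 1) : ℕ) : ℂ) ^ n / (m : ℂ) ^ n) := by
    rw [← Finset.prod_pow]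
    refine Finset.prod_congr rfl fun j _ => ?_
    rw [← div_pow]
    congr 1
    push_cast
    field_simp
    ring
  simp only [Complex.GammaSeq]
  rw [Finset.prod_div_distrib, Finset.prod_mul_distrib, hpow, hden, div_pow, mul_pow, hnum,
    Finset.prod_const, Finset.card_range, div_div_div_cancel_left', ← Finset.prod_div_distrib]
  · refine Finset.prod_congr rfl fun j _ => ?_
    rw [div_div_div_cancel_right₀ (pow_ne_zero _ hm0)]
  · exact mul_ne_zero (pow_ne_zero _ (by simp [Complex.cpow_eq_zero_iff, hN0]))
      (pow_ne_zero _ hfac)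

/-- for integers `n ≥ 2`, `m ≥ 1`, `a ≥ 0` with `(a,m) ≠ (0,1)`, the partition
zeta function over partitions with parts in `{a + mj : j ≥ 1}` converges and equals both the
Euler product `∏_{j≥1} (a+mj)^n/((a+mj)^n - 1)` and the Gamma-quotient expression. -/
theorem partitionZeta_arithmeticProgression (n m a : ℕ) (hn : 2 ≤ n) (hm : 1 ≤ m)
    (hma : ¬(a = 0 ∧ m = 1)) :
    Summable (fun μ : {μ : Multiset ℕ // ∀ x ∈ μ, ∃ j : ℕ, 1 ≤ j ∧ x = a + m * j} =>
        (((μ.1.prod : ℂ)) ^ n)⁻¹) ∧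
    Multipliable (fun j : ℕ =>
        (((a + m * (j + 1) : ℕ) : ℂ) ^ n) / (((a + m * (j + 1) : ℕ) : ℂ) ^ n - 1)) ∧
    (∑' μ : {μ : Multiset ℕ // ∀ x ∈ μ, ∃ j : ℕ, 1 ≤ j ∧ x = a + m * j},
        (((μ.1.prod : ℂ)) ^ n)⁻¹ =
      ∏' j : ℕ, (((a + m * (j + 1) : ℕ) : ℂ) ^ n) / (((a + m * (j + 1) : ℕ) : ℂ) ^ n - 1)) ∧
    (∏' j : ℕ, (((a + m * (j + 1) : ℕ) : ℂ) ^ n) / (((a + m * (j + 1) : ℕ) : ℂ) ^ n - 1) =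
      (Complex.Gamma (1 + (a : ℂ) / (m : ℂ))) ^ (-(n : ℤ)) *
        ∏ r ∈ Finset.range n,
          Complex.Gamma (1 + ((a : ℂ) - eFn ((r : ℂ) / (n : ℂ))) / (m : ℂ))) := by
  have hge : ∀ j : ℕ, 2 ≤ a + m * (j + 1) := fun j => by
    rcases Nat.eq_zero_or_pos a with rfl | ha
    · have : m ≠ 1 := fun h => hma ⟨rfl, h⟩
      nlinarith [show 2 ≤ m by omega]
    · nlinarith
  have hy : ∀ j : ℕ, (2 : ℝ) ≤ ((a + m * (j + 1) : ℕ) : ℝ) ^ n := fun j => by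
    exact_mod_cast (hge j).trans (Nat.le_self_pow (by omega) _)
  set f : ℕ → ℝ := fun j => (((a + m * (j + 1) : ℕ) : ℝ) ^ n)⁻¹ with hf
  have hf0 : ∀ j, 0 ≤ f j := fun j => by positivity
  have hf2 : ∀ j, f j ≤ 2⁻¹ := fun j => inv_anti₀ two_pos (hy j)
  have hfs : Summable f := summable_inv_arithmeticProgression_pow a hn hm
  have hmul : Multipliable fun j => (1 - f j)⁻¹ := by
    have h : Summable fun j => (1 - f j)⁻¹ - 1 := by
      refine (hfs.mul_left 2).of_nonneg_of_le (fun j => ?_) fun j => ?_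
      · rw [sub_nonneg, one_le_inv₀ (by linarith [hf2 j])]
        linarith [hf0 j]
      · have h1 : 0 < 1 - f j := by linarith [hf2 j]
        rw [sub_le_iff_le_add, inv_le_iff_one_le_mul₀ h1]
        nlinarith [hf0 j, hf2 j]
    simpa using Real.multipliable_one_add_of_summable h
  obtain ⟨P, hP⟩ := hmul
  have hterm : ∀ j, (((1 - f j)⁻¹ : ℝ) : ℂ) =
      (((a + m * (j + 1) : ℕ) : ℂ) ^ n) / (((a + m * (j + 1) : ℕ) : ℂ) ^ n - 1) := fun j => by
    have h1 : ((a + m * (j + 1) : ℕ) : ℝ) ^ n ≠ 0 := by linarith [hy j]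
    have h2 : ((a + m * (j + 1) : ℕ) : ℝ) ^ n - 1 ≠ 0 := by linarith [hy j]
    have : (1 - f j)⁻¹ = ((a + m * (j + 1) : ℕ) : ℝ) ^ n /
        (((a + m * (j + 1) : ℕ) : ℝ) ^ n - 1) := by
      rw [hf, ← inv_div]
      congr 1
      rw [sub_div, div_self h1, one_div]
    rw [this]
    push_cast
    rfl
  have hPC : HasProd (fun j : ℕ =>
      (((a + m * (j + 1) : ℕ) : ℂ) ^ n) / (((a + m * (j + 1) : ℕ) : ℂ) ^ n - 1)) (P : ℂ) := by
    have h := hP.map Complex.ofRealHom Complex.continuous_ofReal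
    rwa [show Complex.ofRealHom ∘ (fun j => (1 - f j)⁻¹) = _ from funext hterm] at h
  have hS : HasSum (fun μ : {μ : Multiset ℕ // ∀ x ∈ μ, ∃ j : ℕ, 1 ≤ j ∧ x = a + m * j} =>
      (((μ.1.prod : ℂ)) ^ n)⁻¹) (P : ℂ) := by
    have hinj : Function.Injective fun j : ℕ => a + m * (j + 1) := fun i j h => by
      have := Nat.eq_of_mul_eq_mul_left hm (Nat.add_left_cancel h)
      omega
    have hiff : ∀ x : ℕ, (∃ j : ℕ, 1 ≤ j ∧ x = a + m * j) ↔ ∃ j : ℕ, a + m * (j + 1) = x :=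
      fun x => ⟨fun ⟨j, hj, hx⟩ => ⟨j - 1, by rw [Nat.sub_add_cancel hj, hx]⟩,
        fun ⟨j, hj⟩ => ⟨j + 1, by omega, hj.symm⟩⟩
    rw [← (multisetMapEquiv _ hinj _ hiff).hasSum_iff]
    have h := Complex.hasSum_ofReal.mpr
      (hasSum_multiset_prod hf0 (fun j => by linarith [hf2 j]) hP)
    convert h using 1
    ext μ
    change (((μ.map fun j : ℕ => a + m * (j + 1)).prod : ℂ) ^ n)⁻¹ = _
    induction μ using Multiset.induction_on with
    | empty => simp
    | cons j μ ih =>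
      simp only [Multiset.map_cons, Multiset.prod_cons, Nat.cast_mul, mul_pow, mul_inv, ih,
        Complex.ofReal_mul]
      simp [hf]
  refine ⟨hS.summable, hPC.multipliable, hS.tsum_eq.trans hPC.tprod_eq.symm, ?_⟩
  rw [hPC.tprod_eq]
  have hG : Complex.Gamma (1 + (a : ℂ) / (m : ℂ)) ≠ 0 := by
    apply Complex.Gamma_ne_zero_of_re_pos
    have : (1 + (a : ℂ) / (m : ℂ)) = ((1 + (a : ℝ) / (m : ℝ) : ℝ) : ℂ) := by push_cast; rfl
    rw [this, Complex.ofReal_re]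
    positivity
  have hlim := (tendsto_finsetProd (Finset.range n) fun r _ =>
      Complex.GammaSeq_tendsto_Gamma
        (1 + ((a : ℂ) - eFn ((r : ℂ) / (n : ℂ))) / (m : ℂ))).div
    ((Complex.GammaSeq_tendsto_Gamma (1 + (a : ℂ) / (m : ℂ))).pow n) (pow_ne_zero n hG)
  have hlim' := (hPC.tendsto_prod_nat.comp (tendsto_add_atTop_nat 1)).congr'
    (f₂ := fun N => (∏ r ∈ Finset.range n,
        Complex.GammaSeq (1 + ((a : ℂ) - eFn ((r : ℂ) / (n : ℂ))) / (m : ℂ)) N) /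
      Complex.GammaSeq (1 + (a : ℂ) / (m : ℂ)) N ^ n)
    ((eventually_ne_atTop 0).mono fun N hN => (prod_GammaSeq_div a hn hm hN).symm)
  rw [tendsto_nhds_unique hlim' hlim, zpow_neg, zpow_natCast, div_eq_inv_mul]
end

section
/- For all integers m, n ≥ 2, log(ζ_{𝒫_{mℕ}}(n)) = n · Σ_{k ≥ 2, n | k} ζ(k)/(k·m^k), where the sum runs over all integers k ≥ 2 divisible by n, and ζ denotes the Riemann zeta function. -/
/-- The terms of the Taylor expansions of `-log (1 - x j)` form a summable double family. -/
theorem summable_prod_pow_div_of_nonneg {x : ℕ → ℝ} (hx0 : ∀ j, 0 ≤ x j)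
    (hx1 : ∀ j, x j < 1) (hx : Summable x) :
    Summable fun p : ℕ × ℕ => x p.1 ^ (p.2 + 1) / ((p.2 : ℝ) + 1) := by
  have hrow (j : ℕ) := Real.hasSum_pow_div_log_of_abs_lt_one (x := x j)
    (by rw [abs_of_nonneg (hx0 j)]; exact hx1 j)
  rw [summable_prod_of_nonneg fun p => div_nonneg (pow_nonneg (hx0 p.1) _) (by positivity)]
  refine ⟨fun j => (hrow j).summable, ?_⟩
  simp only [fun j => (hrow j).tsum_eq]
  simpa only [← sub_eq_add_neg] using (Real.summable_log_one_add_of_summable hx.neg).neg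

/-- The logarithm of an Euler-type product `∏ (1 - x j)⁻¹`, expanded in power sums. -/
theorem Complex.log_tprod_one_sub_inv {x : ℕ → ℝ} (hx0 : ∀ j, 0 ≤ x j)
    (hx1 : ∀ j, x j < 1) (hx : Summable x) :
    Complex.log (∏' j, (1 - (x j : ℂ))⁻¹) =
      ∑' i : ℕ, (∑' j, (x j : ℂ) ^ (i + 1)) / ((i : ℂ) + 1) := by
  have hF := summable_prod_pow_div_of_nonneg hx0 hx1 hx
  have hrow (j : ℕ) := Real.hasSum_pow_div_log_of_abs_lt_one (x := x j)
    (by rw [abs_of_nonneg (hx0 j)]; exact hx1 j)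
  have hsum := hF.hasSum.prod_fiberwise hrow
  have hpos (j : ℕ) : 0 < (1 - x j)⁻¹ := inv_pos.mpr (sub_pos.mpr (hx1 j))
  simp only [← Real.log_inv] at hsum
  have hprod := (Real.hasProd_of_hasSum_log hpos hsum).map Complex.ofRealHom
    Complex.continuous_ofReal
  have hcast : (∏' j, (1 - (x j : ℂ))⁻¹) =
      ((Real.exp (∑' p : ℕ × ℕ, x p.1 ^ (p.2 + 1) / ((p.2 : ℝ) + 1)) : ℝ) : ℂ) := by
    rw [← Complex.ofRealHom_eq_coe, ← hprod.tprod_eq]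
    refine tprod_congr fun j => ?_
    simp only [Function.comp_apply, Complex.ofRealHom_eq_coe]
    push_cast
    rfl
  have hcomm := hF.tsum_prod.trans
    (Summable.tsum_comm (f := fun j i : ℕ => x j ^ (i + 1) / ((i : ℝ) + 1)) hF).symm
  rw [hcast, ← Complex.ofReal_log (Real.exp_pos _).le, Real.log_exp, hcomm,
    Complex.ofReal_tsum]
  refine tsum_congr fun i => ?_
  rw [tsum_div_const]
  push_cast
  rfl

/-- Positive multiples of `n`, among the integers that are at least `2`. -/
def equivTwoLeDvd (n : ℕ) (hn : 2 ≤ n) : ℕ ≃ {k : ℕ // 2 ≤ k ∧ n ∣ k} where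
  toFun i := ⟨n * (i + 1), hn.trans (Nat.le_mul_of_pos_right n i.succ_pos), Nat.dvd_mul_right n _⟩
  invFun k := k.1 / n - 1
  left_inv i := by
    simp [Nat.mul_div_cancel_left (i + 1) (by omega : 0 < n)]
  right_inv k := by
    obtain ⟨k, hk, c, rfl⟩ := k
    have hc : 0 < c := Nat.pos_of_ne_zero (by rintro rfl; simp at hk)
    ext
    simp [Nat.mul_div_cancel_left c (by omega : 0 < n), Nat.sub_add_cancel hc]

/-- The power sum over the positive multiples of `m` in terms of the Riemann zeta function. -/
theorem tsum_inv_multiples_pow (m : ℕ) {k : ℕ} (hk : 2 ≤ k) :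
    ∑' j : ℕ, (((m * (j + 1) : ℕ) : ℂ) ^ k)⁻¹ = riemannZeta k / (m : ℂ) ^ k := by
  have h := zeta_eq_tsum_one_div_nat_add_one_cpow (s := (k : ℂ))
    (by simpa using (by omega : 1 < k))
  rw [h, ← tsum_div_const]
  refine tsum_congr fun j => ?_
  rw [Complex.cpow_natCast]
  push_cast
  rw [mul_pow, mul_inv, one_div, div_eq_mul_inv, mul_comm]

/-- for integers `m, n ≥ 2`,
`log ζ_{𝒫_{mℕ}}(n) = n · Σ_{k ≥ 2, n ∣ k} ζ(k)/(k m^k)`, where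
`ζ_{𝒫_{mℕ}}(n) = ∏_{j=1}^∞ (1 - (mj)^{-n})⁻¹`. -/
theorem log_partitionZeta_multiples (m n : ℕ) (hm : 2 ≤ m) (hn : 2 ≤ n) :
    Complex.log (∏' j : ℕ, (1 - (((m * (j + 1) : ℕ) : ℂ) ^ n)⁻¹)⁻¹) =
      (n : ℂ) * ∑' k : {k : ℕ // 2 ≤ k ∧ n ∣ k},
        riemannZeta (k.1 : ℂ) / ((k.1 : ℂ) * (m : ℂ) ^ (k.1 : ℕ)) := by
  have hbase (j : ℕ) : (1 : ℝ) < (m * (j + 1) : ℕ) := by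
    exact_mod_cast (show 1 < m * (j + 1) by nlinarith)
  have hsum : Summable fun j : ℕ => (((m * (j + 1) : ℕ) : ℝ) ^ n)⁻¹ := by
    have h := ((summable_nat_add_iff 1).mpr (Real.summable_nat_pow_inv.mpr
      (by omega : 1 < n))).mul_left (((m : ℝ) ^ n)⁻¹)
    refine h.congr fun j => ?_
    push_cast
    rw [mul_pow, mul_inv]
  have key := Complex.log_tprod_one_sub_inv
    (x := fun j : ℕ => (((m * (j + 1) : ℕ) : ℝ) ^ n)⁻¹)
    (fun j => by positivity)
    (fun j => inv_lt_one_of_one_lt₀ (one_lt_pow₀ (hbase j) (by omega))) hsum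
  simp only [Complex.ofReal_inv, Complex.ofReal_pow, Complex.ofReal_natCast] at key
  rw [key, ← tsum_mul_left, ← (equivTwoLeDvd n hn).tsum_eq]
  refine tsum_congr fun i => ?_
  have hk := tsum_inv_multiples_pow m (k := n * (i + 1))
    (hn.trans (Nat.le_mul_of_pos_right n i.succ_pos))
  simp only [inv_pow, ← pow_mul, hk, equivTwoLeDvd, Equiv.coe_fn_mk]
  have hn0 : (n : ℂ) ≠ 0 := by exact_mod_cast (by omega : n ≠ 0)
  have hi0 : (i : ℂ) + 1 ≠ 0 := by exact_mod_cast i.succ_ne_zero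
  have hm0 : (m : ℂ) ≠ 0 := by exact_mod_cast (by omega : m ≠ 0)
  push_cast
  field_simp
end

section
/- Let m ≥ 2 be an integer and let s ∈ ℂ satisfy Re(s) > 0 and s ≠ 1/k for every positive integer k. Then the series Σ_{k=1}^{∞} ζ(ks)/(k·(m^s)^k) converges (is summable), where ζ denotes the analytically continued Riemann zeta function and m^s := exp(s·log m). (This series provides the meromorphic extension of log ζ_{𝒫_{mℕ}}(s) to the right half-plane Re(s) > 0 away from the points 1/ℕ.) -/
/-- On the half-plane `Re z ≥ σ` with `σ > 1`, the norm of `ζ` is bounded by its Dirichlet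
series at `σ`. -/
theorem norm_riemannZeta_le_tsum {σ : ℝ} (hσ : 1 < σ) {z : ℂ} (hz : σ ≤ z.re) :
    ‖riemannZeta z‖ ≤ ∑' n : ℕ, 1 / ((n : ℝ) + 1) ^ σ := by
  have hsum : Summable fun n : ℕ => 1 / ((n : ℝ) + 1) ^ σ := by
    simpa using (summable_nat_add_iff 1).2 (Real.summable_one_div_nat_rpow.2 hσ)
  rw [zeta_eq_tsum_one_div_nat_add_one_cpow (hσ.trans_le hz)]
  refine tsum_of_norm_bounded hsum.hasSum fun n => ?_
  have hnorm : ‖((n : ℂ) + 1) ^ z‖ = ((n : ℝ) + 1) ^ z.re := by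
    have h := Complex.norm_natCast_cpow_of_pos n.succ_pos z
    push_cast at h
    exact h
  rw [norm_div, norm_one, hnorm]
  gcongr
  simp

/-- for an integer `m ≥ 2` and `s ∈ ℂ` with `Re(s) > 0` and `s ≠ 1/k` for every
positive integer `k`, the series `Σ_{k≥1} ζ(ks)/(k·(m^s)^k)` is summable (here `m^s` is the
complex power `exp(s log m)` and `ζ` is the analytically continued Riemann zeta function). -/
theorem summable_log_partitionZeta_extension (m : ℕ) (hm : 2 ≤ m) (s : ℂ)
    (hs : 0 < s.re) (hsk : ∀ k : ℕ, 0 < k → s ≠ 1 / (k : ℂ)) :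
    Summable (fun k : ℕ =>
      riemannZeta (((k : ℂ) + 1) * s) / (((k : ℂ) + 1) * ((m : ℂ) ^ s) ^ (k + 1))) := by
  have hr : 1 < ‖(m : ℂ) ^ s‖ := by
    rw [Complex.norm_natCast_cpow_of_pos (by lia)]
    exact Real.one_lt_rpow (by exact_mod_cast hm) hs
  have hgeom : Summable fun k : ℕ => (‖(m : ℂ) ^ s‖⁻¹) ^ (k + 1) :=
    (summable_nat_add_iff 1).2
      (summable_geometric_of_lt_one (by positivity) (inv_lt_one_of_one_lt₀ hr))
  refine Summable.of_norm_bounded_eventually_nat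
    (hgeom.mul_left (∑' n : ℕ, 1 / ((n : ℝ) + 1) ^ (2 : ℝ))) ?_
  obtain ⟨N, hN⟩ := exists_nat_ge (2 / s.re)
  filter_upwards [Filter.eventually_ge_atTop N] with k hk
  have hkN : (N : ℝ) ≤ k := by exact_mod_cast hk
  have hre : 2 ≤ (((k : ℂ) + 1) * s).re := by
    have h : 2 ≤ (N : ℝ) * s.re := (div_le_iff₀ hs).1 hN
    simp only [Complex.mul_re, Complex.add_re, Complex.natCast_re, Complex.one_re,
      Complex.add_im, Complex.natCast_im, Complex.one_im, add_zero, zero_mul, sub_zero]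
    nlinarith
  have hk1 : 1 ≤ ‖(k : ℂ) + 1‖ := by
    rw [← Nat.cast_add_one, Complex.norm_natCast]
    exact_mod_cast k.succ_pos
  rw [norm_div, norm_mul, norm_pow, inv_pow, ← div_eq_mul_inv]
  gcongr
  · exact norm_riemannZeta_le_tsum one_lt_two hre
  · exact le_mul_of_one_le_left (by positivity) hk1
end

section
/- For all integers m, n ≥ 2, ζ(n) = m^n · Σ_{k=1}^{∞} (μ(k)/k) · Σ_{r=0}^{nk−1} Log Γ(1 − e(r/(nk))/m), where the outer series converges; here μ is the Möbius function and Log denotes the principal branch of the complex logarithm. Equivalently, ζ(n) = m^n · Σ_{k=1}^{∞} (μ(k)/k) · log(ζ_{𝒫_{mℕ}}(nk)). -/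
/-- The `j`-th term of the logarithm of Euler's product for `Γ (1 - z)`. -/
noncomputable def eulerLogTerm (z : ℂ) (j : ℕ) : ℂ :=
  -z * ((Real.log (j + 2) - Real.log (j + 1) : ℝ) : ℂ) - Complex.log (1 - z / (j + 1))

lemma abs_log_succ_sub_log_le (j : ℕ) :
    |(Real.log (j + 2) - Real.log (j + 1)) - 1 / ((j : ℝ) + 1)| ≤ 1 / ((j : ℝ) + 1) ^ 2 := by
  have h1 : (0 : ℝ) < j + 1 := by positivity
  have h2 : (0 : ℝ) < j + 2 := by positivity
  rw [← Real.log_div h2.ne' h1.ne']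
  have hu := Real.log_le_sub_one_of_pos (div_pos h2 h1)
  have hl := Real.one_sub_inv_le_log_of_pos (div_pos h2 h1)
  have e1 : ((j : ℝ) + 2) / (j + 1) - 1 = 1 / (j + 1) := by field_simp; ring
  have e2 : 1 - (((j : ℝ) + 2) / (j + 1))⁻¹ = 1 / (j + 2) := by field_simp; ring
  have e3 : 1 / ((j : ℝ) + 1) - 1 / (j + 2) ≤ 1 / ((j : ℝ) + 1) ^ 2 := by
    rw [div_sub_div _ _ h1.ne' h2.ne', div_le_div_iff₀ (by positivity) (by positivity)]
    nlinarith
  rw [e1] at hu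
  rw [e2] at hl
  have : 0 ≤ 1 / ((j : ℝ) + 1) ^ 2 := by positivity
  rw [abs_le]
  constructor <;> linarith

lemma norm_div_natCast_succ_le {z : ℂ} (hz : ‖z‖ ≤ 1 / 2) (j : ℕ) :
    ‖z / ((j : ℂ) + 1)‖ ≤ 1 / 2 * (1 / ((j : ℝ) + 1)) := by
  have h : ‖((j : ℂ) + 1)‖ = (j : ℝ) + 1 := by
    rw [← Nat.cast_succ, Complex.norm_natCast, Nat.cast_succ]
  rw [norm_div, h, div_eq_mul_one_div]
  gcongr

lemma one_div_natCast_succ_le_one (j : ℕ) : 1 / ((j : ℝ) + 1) ≤ 1 := by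
  rw [div_le_one (by positivity)]
  linarith [j.cast_nonneg (α := ℝ)]

lemma norm_eulerLogTerm_le {z : ℂ} (hz : ‖z‖ ≤ 1 / 2) (j : ℕ) :
    ‖eulerLogTerm z j‖ ≤ 3 / 4 * (1 / ((j : ℝ) + 1) ^ 2) := by
  set w : ℂ := z / ((j : ℂ) + 1) with hw
  have hwn : ‖w‖ ≤ 1 / 2 * (1 / ((j : ℝ) + 1)) := norm_div_natCast_succ_le hz j
  have hw2 : ‖w‖ ≤ 1 / 2 := by linarith [one_div_natCast_succ_le_one j]
  have hlog : ‖Complex.log (1 - w) + w‖ ≤ ‖w‖ ^ 2 := by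
    have h := Complex.norm_log_one_add_sub_self_le (z := -w) (by rw [norm_neg]; linarith)
    rw [norm_neg, sub_neg_eq_add, ← sub_eq_add_neg] at h
    have h3 : (1 - ‖w‖)⁻¹ ≤ 2 := by
      rw [inv_le_comm₀ (by linarith) (by norm_num)]; linarith
    nlinarith [sq_nonneg ‖w‖]
  have hwsq : ‖w‖ ^ 2 ≤ 1 / 4 * (1 / ((j : ℝ) + 1) ^ 2) := by
    calc ‖w‖ ^ 2 ≤ (1 / 2 * (1 / ((j : ℝ) + 1))) ^ 2 := by gcongr
      _ = _ := by rw [mul_pow, one_div_pow ((j : ℝ) + 1)]; norm_num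
  have hdecomp : eulerLogTerm z j =
      -z * (((Real.log (j + 2) - Real.log (j + 1)) - 1 / ((j : ℝ) + 1) : ℝ) : ℂ)
        - (Complex.log (1 - w) + w) := by
    rw [eulerLogTerm, ← hw]
    push_cast
    rw [hw]
    ring
  rw [hdecomp]
  refine (norm_sub_le _ _).trans ?_
  rw [norm_mul, norm_neg, Complex.norm_real, Real.norm_eq_abs]
  have := mul_le_mul hz (abs_log_succ_sub_log_le j) (abs_nonneg _) (by norm_num)
  linarith

lemma hasSum_one_div_natCast_succ_sq :
    HasSum (fun j : ℕ => 1 / ((j : ℝ) + 1) ^ 2) (Real.pi ^ 2 / 6) := by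
  have h := (hasSum_nat_add_iff' 1).mpr hasSum_zeta_two
  simpa using h

lemma exp_sum_eulerLogTerm {z : ℂ} (hz : ‖z‖ ≤ 1 / 2) (hz0 : z ≠ 0) (n : ℕ) :
    Complex.exp (∑ j ∈ Finset.range n, eulerLogTerm z j) =
      -z * Complex.GammaSeq (-z) (n + 1) * (1 + -z / ((n + 1 : ℕ) : ℂ)) := by
  have hne : ∀ j : ℕ, 1 - z / ((j : ℂ) + 1) ≠ 0 := fun j h => by
    have h1 := norm_div_natCast_succ_le hz j
    rw [← sub_eq_zero.mp h, norm_one] at h1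
    linarith [one_div_natCast_succ_le_one j]
  have hj : ∀ j : ℕ, ((j : ℂ) + 1) ≠ 0 := fun j => Nat.cast_add_one_ne_zero j
  have hne' : ∀ j : ℕ, -z + ((j : ℂ) + 1) ≠ 0 := fun j h => hne j <| by
    rw [sub_eq_zero, eq_div_iff (hj j)]; linear_combination h
  have htel : ∑ j ∈ Finset.range n, (Real.log ((j : ℝ) + 2) - Real.log (j + 1)) =
      Real.log (n + 1) := by
    have := Finset.sum_range_sub (fun j : ℕ => Real.log ((j : ℝ) + 1)) n
    simp only [Nat.cast_add, Nat.cast_one, Nat.cast_zero, zero_add, Real.log_one, sub_zero] at this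
    rw [← this]
    refine Finset.sum_congr rfl fun j _ => ?_
    ring_nf
  have hprod : ∏ j ∈ Finset.range n, (1 - z / ((j : ℂ) + 1)) =
      (∏ j ∈ Finset.range n, (-z + ((j : ℂ) + 1))) / (n.factorial : ℂ) := by
    rw [← Finset.prod_range_add_one_eq_factorial, Nat.cast_prod, ← Finset.prod_div_distrib]
    refine Finset.prod_congr rfl fun j _ => ?_
    have := hj j
    push_cast
    field_simp
    ring
  simp only [eulerLogTerm]
  rw [Finset.sum_sub_distrib, ← Finset.mul_sum, ← Complex.ofReal_sum, htel, Complex.exp_sub,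
    Complex.exp_sum,
    Finset.prod_congr rfl fun j _ => Complex.exp_log (hne j), hprod, Complex.GammaSeq,
    Finset.prod_range_succ', Finset.prod_range_succ, Nat.factorial_succ,
    Complex.cpow_def_of_ne_zero (Nat.cast_ne_zero.mpr n.succ_ne_zero)]
  have hlog : ((Real.log ((n : ℝ) + 1) : ℝ) : ℂ) = Complex.log ((n + 1 : ℕ) : ℂ) := by
    rw [← Nat.cast_succ, Complex.natCast_log]
  rw [hlog, mul_comm (-z) (Complex.log _)]
  push_cast
  rw [add_zero]
  have h1 := hj n
  have h2 := hne' n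
  have h3 : (n.factorial : ℂ) ≠ 0 := Nat.cast_ne_zero.mpr n.factorial_ne_zero
  field_simp
  ring

open Filter Topology in
/-- The principal logarithm of `Γ (1 - z)` is the sum of the logarithms of Euler's product. -/
lemma hasSum_eulerLogTerm {z : ℂ} (hz : ‖z‖ ≤ 1 / 2) (hz0 : z ≠ 0) :
    HasSum (eulerLogTerm z) (Complex.log (Complex.Gamma (1 - z))) := by
  have hb := hasSum_one_div_natCast_succ_sq.mul_left (3 / 4)
  have hs : Summable (eulerLogTerm z) := Summable.of_norm_bounded hb.summable
    (norm_eulerLogTerm_le hz)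
  have hnorm : ‖∑' j, eulerLogTerm z j‖ ≤ 3 / 4 * (Real.pi ^ 2 / 6) :=
    tsum_of_norm_bounded hb (norm_eulerLogTerm_le hz)
  have hexp : Complex.exp (∑' j, eulerLogTerm z j) = Complex.Gamma (1 - z) := by
    have h1 := (Complex.continuous_exp.tendsto _).comp hs.hasSum.tendsto_sum_nat
    have h2 : Tendsto (fun n : ℕ => -z * Complex.GammaSeq (-z) (n + 1) *
        (1 + -z / ((n + 1 : ℕ) : ℂ))) atTop (𝓝 (-z * Complex.Gamma (-z) * (1 + 0))) := by
      refine ((((Complex.GammaSeq_tendsto_Gamma (-z)).comp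
        (tendsto_add_atTop_nat 1)).const_mul (-z)).mul (tendsto_const_nhds.add ?_))
      exact (tendsto_const_div_atTop_nhds_zero_nat (-z)).comp (tendsto_add_atTop_nat 1)
    have h3 := tendsto_nhds_unique h1
      (h2.congr fun n => (exp_sum_eulerLogTerm hz hz0 n).symm)
    rw [h3, add_zero, mul_one, ← Complex.Gamma_add_one _ (neg_ne_zero.mpr hz0)]
    ring_nf
  have him : |(∑' j, eulerLogTerm z j).im| < Real.pi := by
    refine (Complex.abs_im_le_norm _).trans_lt (hnorm.trans_lt ?_)
    nlinarith [Real.pi_pos, Real.pi_lt_four]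
  rw [← hexp, Complex.log_exp (abs_lt.mp him).1 (abs_lt.mp him).2.le]
  exact hs.hasSum

lemma IsPrimitiveRoot.sum_pow_pow {ω : ℂ} {N : ℕ} (hω : IsPrimitiveRoot ω N) (l : ℕ) :
    ∑ r ∈ Finset.range N, (ω ^ r) ^ l = if N ∣ l then (N : ℂ) else 0 := by
  simp_rw [← pow_mul, mul_comm _ l, pow_mul]
  split_ifs with h
  · simp [(hω.pow_eq_one_iff_dvd l).mpr h]
  · have h1 : ω ^ l ≠ 1 := mt (hω.pow_eq_one_iff_dvd l).mp h
    rw [geom_sum_eq h1, ← pow_mul, mul_comm, pow_mul, hω.pow_eq_one, one_pow, sub_self, zero_div]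

/-- `∑ Log (1 - ω w) = Log (1 - w ^ N)`, the sum running over the `N`-th roots of unity `ω`. -/
lemma IsPrimitiveRoot.sum_neg_log_one_sub {ω : ℂ} {N : ℕ} (hω : IsPrimitiveRoot ω N) (hN : N ≠ 0)
    {w : ℂ} (hw : ‖w‖ < 1) :
    ∑ r ∈ Finset.range N, -Complex.log (1 - ω ^ r * w) = -Complex.log (1 - w ^ N) := by
  have h1 : HasSum (fun l : ℕ => ∑ r ∈ Finset.range N, (ω ^ r * w) ^ l / (l : ℂ))
      (∑ r ∈ Finset.range N, -Complex.log (1 - ω ^ r * w)) := by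
    refine hasSum_sum fun r _ => Complex.hasSum_taylorSeries_neg_log ?_
    rwa [norm_mul, norm_pow, hω.norm'_eq_one hN, one_pow, one_mul]
  have h2 : HasSum (fun l : ℕ => (w ^ N) ^ l / (l : ℂ)) (-Complex.log (1 - w ^ N)) := by
    refine Complex.hasSum_taylorSeries_neg_log ?_
    rw [norm_pow]
    exact pow_lt_one₀ (norm_nonneg _) hw hN
  have hterm : ∀ l : ℕ, ∑ r ∈ Finset.range N, (ω ^ r * w) ^ l / (l : ℂ) =
      (if N ∣ l then (N : ℂ) else 0) * (w ^ l / l) := fun l => by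
    rw [← hω.sum_pow_pow, Finset.sum_mul]
    exact Finset.sum_congr rfl fun r _ => by rw [mul_pow, mul_div_assoc]
  simp_rw [hterm] at h1
  rw [← (mul_right_injective₀ hN).hasSum_iff fun l hl => ?_] at h1
  · refine h1.unique (h2.congr_fun fun l => ?_)
    have hN' : (N : ℂ) ≠ 0 := Nat.cast_ne_zero.mpr hN
    simp only [Function.comp_apply, dvd_mul_right, if_true, pow_mul, Nat.cast_mul]
    field_simp
  · rw [if_neg fun ⟨c, hc⟩ => hl ⟨c, hc.symm⟩, zero_mul]

/-- `∑ Log Γ (1 - ω / m)`, over the `N`-th roots of unity `ω`, is the logarithm of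
`∏ (1 - (m j) ^ (-N))⁻¹`. -/
lemma hasSum_neg_log_one_sub_pow {m N : ℕ} (hm : 2 ≤ m) (hN : 2 ≤ N) :
    HasSum (fun j : ℕ => -Complex.log (1 - (1 / ((m : ℂ) * (j + 1))) ^ N))
      (∑ r ∈ Finset.range N,
        Complex.log (Complex.Gamma (1 - eFn ((r : ℂ) / (N : ℂ)) / (m : ℂ)))) := by
  have hN0 : N ≠ 0 := by lia
  have hm0 : (m : ℂ) ≠ 0 := Nat.cast_ne_zero.mpr (by lia)
  have hω := Complex.isPrimitiveRoot_exp N hN0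
  set ω := Complex.exp (2 * Real.pi * Complex.I / N) with hωdef
  have he : ∀ r : ℕ, eFn ((r : ℂ) / (N : ℂ)) = ω ^ r := fun r => by
    rw [eFn, hωdef, ← Complex.exp_nat_mul]
    ring_nf
  have hωn : ‖ω‖ = 1 := hω.norm'_eq_one hN0
  have hmn : 1 / (m : ℝ) ≤ 1 / 2 :=
    one_div_le_one_div_of_le (by norm_num) (by exact_mod_cast hm)
  have hnorm : ∀ r : ℕ, ‖ω ^ r / (m : ℂ)‖ ≤ 1 / 2 := fun r => by
    rwa [norm_div, norm_pow, hωn, one_pow, Complex.norm_natCast]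
  have h := hasSum_sum fun r (_ : r ∈ Finset.range N) =>
    hasSum_eulerLogTerm (hnorm r) (div_ne_zero (pow_ne_zero r (hω.ne_zero hN0)) hm0)
  simp_rw [he]
  refine h.congr_fun fun j => ?_
  have hj : ((j : ℂ) + 1) ≠ 0 := Nat.cast_add_one_ne_zero j
  have hw : ‖1 / ((m : ℂ) * (j + 1))‖ < 1 := by
    have h1 := norm_div_natCast_succ_le (hnorm 0) j
    rw [pow_zero, div_div] at h1
    linarith [one_div_natCast_succ_le_one j]
  have hsum : ∑ r ∈ Finset.range N, ω ^ r = 0 := hω.geom_sum_eq_zero (by lia)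
  rw [← hω.sum_neg_log_one_sub hN0 hw]
  simp only [eulerLogTerm, Finset.sum_sub_distrib, ← Finset.sum_mul, Finset.sum_neg_distrib,
    ← Finset.sum_div, hsum, zero_div, neg_zero, zero_mul, zero_sub]
  congr 1
  refine Finset.sum_congr rfl fun r _ => ?_
  congr 2
  field_simp

open ArithmeticFunction in
/-- Möbius inversion of the logarithm: `∑ μ k / k * (-Log (1 - x ^ k)) = x`. -/
lemma tsum_moebius_div_mul_neg_log {x : ℂ} (hx : ‖x‖ < 1) :
    ∑' k : ℕ, ((moebius (k + 1) : ℤ) : ℂ) / ((k : ℂ) + 1) *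
      (-Complex.log (1 - x ^ (k + 1))) = x := by
  let f : ℕ+ × ℕ+ → ℂ := fun c =>
    ((moebius (c.1 : ℕ) : ℤ) : ℂ) / ((c.1 : ℕ) : ℂ) * ((x ^ (c.1 : ℕ)) ^ (c.2 : ℕ) / ((c.2 : ℕ) : ℂ))
  have hf : Summable f := by
    refine Summable.of_norm_bounded (summable_prod_mul_pow 0 hx).norm fun c => ?_
    have hμ : ‖((moebius (c.1 : ℕ) : ℤ) : ℂ)‖ ≤ 1 := by
      rw [Complex.norm_intCast]
      exact_mod_cast abs_moebius_le_one
    have h1 : (1 : ℝ) ≤ ((c.1 : ℕ) : ℝ) := by exact_mod_cast c.1.pos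
    have h2 : (1 : ℝ) ≤ ((c.2 : ℕ) : ℝ) := by exact_mod_cast c.2.pos
    simp only [f, norm_mul, norm_div, Complex.norm_natCast, ← pow_mul, pow_zero, one_mul]
    have h3 := div_le_one_of_le₀ (hμ.trans h1) (by positivity)
    have h4 := div_le_self (norm_nonneg (x ^ ((c.1 : ℕ) * (c.2 : ℕ)))) h2
    simpa using mul_le_mul h3 h4 (by positivity) zero_le_one
  have hlog : ∀ k : ℕ+, ∑' l : ℕ+, f (k, l) =
      ((moebius (k : ℕ) : ℤ) : ℂ) / ((k : ℕ) : ℂ) * (-Complex.log (1 - x ^ (k : ℕ))) := fun k => by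
    have hxk : ‖x ^ (k : ℕ)‖ < 1 := by
      rw [norm_pow]
      exact pow_lt_one₀ (norm_nonneg _) hx k.ne_zero
    simp only [f]
    rw [tsum_mul_left, tsum_pnat_eq_tsum_succ (f := fun l : ℕ => (x ^ (k : ℕ)) ^ l / (l : ℂ)),
      ← (Complex.hasSum_taylorSeries_neg_log' hxk).tsum_eq]
    push_cast
    rfl
  have hsigma := (sigmaAntidiagonalEquivProd.summable_iff (f := f)).mpr hf
  have hinner : ∀ n : ℕ+, ∑' c : Nat.divisorsAntidiagonal n,
      f (sigmaAntidiagonalEquivProd ⟨n, c⟩) = if n = 1 then x else 0 := fun n => by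
    have hterm : ∀ c : Nat.divisorsAntidiagonal n, f (sigmaAntidiagonalEquivProd ⟨n, c⟩) =
        ((moebius c.1.1 : ℤ) : ℂ) * (x ^ (n : ℕ) / ((n : ℕ) : ℂ)) := fun c => by
      have hc := (Nat.mem_divisorsAntidiagonal.mp c.2).1
      change ((moebius c.1.1 : ℤ) : ℂ) / (c.1.1 : ℂ) * ((x ^ c.1.1) ^ c.1.2 / (c.1.2 : ℂ)) = _
      rw [← pow_mul, hc, div_mul_div_comm, ← Nat.cast_mul, hc, mul_div_assoc]
    rw [tsum_congr hterm, tsum_mul_right, tsum_fintype,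
      Finset.sum_coe_sort (Nat.divisorsAntidiagonal n) fun c => ((moebius c.1 : ℤ) : ℂ),
      Nat.sum_divisorsAntidiagonal (f := fun a _ => ((moebius a : ℤ) : ℂ)), ← Int.cast_sum,
      ← coe_mul_zeta_apply, moebius_mul_coe_zeta, one_apply]
    by_cases h : n = 1
    · simp [h]
    · have : (n : ℕ) ≠ 1 := fun h' => h (PNat.coe_eq_one_iff.mp h')
      simp [h, this]
  calc _ = ∑' k : ℕ+, ((moebius (k : ℕ) : ℤ) : ℂ) / ((k : ℕ) : ℂ) *
        (-Complex.log (1 - x ^ (k : ℕ))) := by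
        rw [tsum_pnat_eq_tsum_succ (f := fun k : ℕ => ((moebius k : ℤ) : ℂ) / (k : ℂ) *
          (-Complex.log (1 - x ^ k)))]
        push_cast
        rfl
    _ = ∑' c, f c := by rw [hf.tsum_prod]; exact tsum_congr fun k => (hlog k).symm
    _ = ∑' n : ℕ+, if n = 1 then x else 0 := by
        rw [← sigmaAntidiagonalEquivProd.tsum_eq f]
        exact (Summable.tsum_sigma hsigma).trans (tsum_congr hinner)
    _ = x := by rw [tsum_ite_eq]

open ArithmeticFunction in
lemma norm_moebius_div_mul_log_le {x : ℂ} (hx : ‖x‖ ≤ 1 / 4) (k : ℕ) :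
    ‖((moebius (k + 1) : ℤ) : ℂ) / ((k : ℂ) + 1) * (-Complex.log (1 - x ^ (k + 1)))‖ ≤
      ‖x‖ * (3 / 2 * (1 / 4) ^ k) := by
  have hμ : ‖((moebius (k + 1) : ℤ) : ℂ)‖ ≤ 1 := by
    rw [Complex.norm_intCast]
    exact_mod_cast abs_moebius_le_one
  have hk : ‖((k : ℂ) + 1)‖ = (k : ℝ) + 1 := by
    rw [← Nat.cast_succ, Complex.norm_natCast, Nat.cast_succ]
  have hxk : ‖x ^ (k + 1)‖ ≤ ‖x‖ * (1 / 4) ^ k := by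
    rw [norm_pow, pow_succ']
    gcongr
  have hpow : ((1 : ℝ) / 4) ^ k ≤ 1 := pow_le_one₀ (by norm_num) (by norm_num)
  have hlog := Complex.norm_log_one_add_half_le_self (z := -x ^ (k + 1)) (by
    rw [norm_neg]
    nlinarith [norm_nonneg x])
  rw [norm_neg, ← sub_eq_add_neg] at hlog
  have h1 : ‖((moebius (k + 1) : ℤ) : ℂ) / ((k : ℂ) + 1)‖ ≤ 1 := by
    rw [norm_div, hk]
    exact div_le_one_of_le₀ (by linarith [k.cast_nonneg (α := ℝ)]) (by positivity)
  rw [norm_mul, norm_neg]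
  have := mul_le_mul h1 hlog (norm_nonneg _) zero_le_one
  linarith

/-- for all integers `m, n ≥ 2`,
`ζ(n) = m^n · Σ_{k≥1} (μ(k)/k) · Σ_{r=0}^{nk-1} Log Γ(1 - e(r/(nk))/m)`,
the outer series converging; `μ` is the Möbius function and `Log` the principal logarithm. -/
theorem riemannZeta_eq_moebius_logGamma_sum (m n : ℕ) (hm : 2 ≤ m) (hn : 2 ≤ n) :
    Summable (fun k : ℕ =>
      ((ArithmeticFunction.moebius (k + 1) : ℤ) : ℂ) / ((k : ℂ) + 1) *
        ∑ r ∈ Finset.range (n * (k + 1)),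
          Complex.log (Complex.Gamma
            (1 - eFn ((r : ℂ) / ((n * (k + 1) : ℕ) : ℂ)) / (m : ℂ)))) ∧
    riemannZeta (n : ℂ) = (m : ℂ) ^ n *
      ∑' k : ℕ, ((ArithmeticFunction.moebius (k + 1) : ℤ) : ℂ) / ((k : ℂ) + 1) *
        ∑ r ∈ Finset.range (n * (k + 1)),
          Complex.log (Complex.Gamma
            (1 - eFn ((r : ℂ) / ((n * (k + 1) : ℕ) : ℂ)) / (m : ℂ))) := by
  let F : ℕ → ℕ → ℂ := fun k j =>
    ((ArithmeticFunction.moebius (k + 1) : ℤ) : ℂ) / ((k : ℂ) + 1) *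
      (-Complex.log (1 - ((1 / ((m : ℂ) * (j + 1))) ^ n) ^ (k + 1)))
  have hm0 : (m : ℂ) ≠ 0 := Nat.cast_ne_zero.mpr (by lia)
  have hrow : ∀ k : ℕ, HasSum (F k)
      (((ArithmeticFunction.moebius (k + 1) : ℤ) : ℂ) / ((k : ℂ) + 1) *
        ∑ r ∈ Finset.range (n * (k + 1)),
          Complex.log (Complex.Gamma
            (1 - eFn ((r : ℂ) / ((n * (k + 1) : ℕ) : ℂ)) / (m : ℂ)))) := fun k => by
    have h := (hasSum_neg_log_one_sub_pow hm (N := n * (k + 1)) (by nlinarith)).mul_left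
      (((ArithmeticFunction.moebius (k + 1) : ℤ) : ℂ) / ((k : ℂ) + 1))
    simpa only [F, pow_mul] using h
  have hbase : ∀ j : ℕ, ‖1 / ((m : ℂ) * (j + 1))‖ ≤ 1 / 2 * (1 / ((j : ℝ) + 1)) := fun j => by
    rw [← div_div]
    refine norm_div_natCast_succ_le ?_ j
    rw [norm_div, norm_one, Complex.norm_natCast]
    exact one_div_le_one_div_of_le (by norm_num) (by exact_mod_cast hm)
  have hx : ∀ j : ℕ, ‖(1 / ((m : ℂ) * (j + 1))) ^ n‖ ≤ 1 / 4 * (1 / ((j : ℝ) + 1) ^ 2) :=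
    fun j => by
    rw [norm_pow]
    calc _ ≤ ‖1 / ((m : ℂ) * (j + 1))‖ ^ 2 := pow_le_pow_of_le_one (norm_nonneg _)
          (by linarith [hbase j, one_div_natCast_succ_le_one j]) hn
      _ ≤ (1 / 2 * (1 / ((j : ℝ) + 1))) ^ 2 := by gcongr; exact hbase j
      _ = _ := by rw [mul_pow, one_div_pow ((j : ℝ) + 1)]; norm_num
  have hx4 : ∀ j : ℕ, ‖(1 / ((m : ℂ) * (j + 1))) ^ n‖ ≤ 1 / 4 := fun j => by
    have h1 : 1 / ((j : ℝ) + 1) ^ 2 ≤ 1 := by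
      rw [← one_div_pow]
      exact pow_le_one₀ (by positivity) (one_div_natCast_succ_le_one j)
    linarith [hx j]
  have hsum : Summable fun p : ℕ × ℕ => F p.1 p.2 := by
    have hgeom : Summable fun k : ℕ => (3 / 2 : ℝ) * (1 / 4) ^ k :=
      (summable_geometric_of_lt_one (by norm_num) (by norm_num)).mul_left _
    have hsq := hasSum_one_div_natCast_succ_sq.summable.mul_left (1 / 4)
    refine Summable.of_norm_bounded
      (hgeom.mul_of_nonneg hsq (fun k => by positivity) (fun j => by positivity)) fun p => ?_
    refine (norm_moebius_div_mul_log_le (hx4 p.2) p.1).trans ?_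
    rw [mul_comm]
    exact mul_le_mul_of_nonneg_left (hx p.2) (by positivity)
  refine ⟨hsum.prod.congr fun k => (hrow k).tsum_eq, ?_⟩
  have hinner : ∀ j : ℕ, ∑' k : ℕ, F k j = (1 / ((m : ℂ) * (j + 1))) ^ n := fun j =>
    tsum_moebius_div_mul_neg_log ((hx4 j).trans_lt (by norm_num))
  have hcomm : ∑' k, ∑' j, F k j = ∑' j, ∑' k, F k j :=
    (Summable.tsum_comm hsum).symm
  rw [tsum_congr hinner, tsum_congr fun k => (hrow k).tsum_eq] at hcomm
  rw [hcomm, ← tsum_mul_left, zeta_eq_tsum_one_div_nat_add_one_cpow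
    (by simpa using (by lia : 1 < n))]
  refine tsum_congr fun j => ?_
  rw [Complex.cpow_natCast, one_div_pow, mul_pow, mul_one_div, div_mul_cancel_left₀
    (pow_ne_zero n hm0), one_div]
end

section
/- Let n ≥ 2 be an integer and define F : ℂ → ℂ by F(z) := ∏_{j=0}^{n−1} Γ(1 − z·e(j/n)). Then the n-th derivative of F, evaluated at real z > 0, tends to n!·ζ(n) as z → 0⁺; that is, ζ(n) = (1/n!) · lim_{z→0⁺} (dⁿ/dzⁿ) ∏_{j=0}^{n−1} Γ(1 − z·e(j/n)). -/
open Filter Topology Asymptotics Finset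

/-- The product of `1 + f i` agrees with its first-order expansion up to `exp S - 1 - S`, where
`S` is the sum of the norms of the `f i`. -/
theorem Finset.norm_prod_one_add_sub_one_sub_sum_le {ι R : Type*} [NormedCommRing R]
    [NormOneClass R] (t : Finset ι) (f : ι → R) :
    ‖∏ i ∈ t, (1 + f i) - 1 - ∑ i ∈ t, f i‖ ≤
      Real.exp (∑ i ∈ t, ‖f i‖) - 1 - ∑ i ∈ t, ‖f i‖ := by
  classical
  induction t using Finset.induction_on with
  | empty => simp
  | insert x t hx IH =>
    rw [Finset.prod_insert hx, Finset.sum_insert hx, Finset.sum_insert hx, Real.exp_add,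
      show (1 + f x) * ∏ i ∈ t, (1 + f i) - 1 - (f x + ∑ i ∈ t, f i) =
        (∏ i ∈ t, (1 + f i) - 1 - ∑ i ∈ t, f i) + f x * (∏ i ∈ t, (1 + f i) - 1) by ring]
    refine (norm_add_le_of_le IH ((norm_mul_le _ _).trans
      (mul_le_mul_of_nonneg_left (t.norm_prod_one_add_sub_one_le f) (norm_nonneg _)))).trans ?_
    nlinarith [Real.add_one_le_exp ‖f x‖, Real.exp_pos (∑ i ∈ t, ‖f i‖)]

/-- An analytic function that is `O(z ^ (n + 1))` at the origin has vanishing `n`-th derivative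
there. -/
theorem AnalyticAt.iteratedDeriv_eq_zero_of_isBigO {f : ℂ → ℂ} {n : ℕ} (hf : AnalyticAt ℂ f 0)
    (hO : f =O[𝓝 0] fun z => z ^ (n + 1)) : iteratedDeriv n f 0 = 0 := by
  refine (natCast_le_analyticOrderAt_iff_iteratedDeriv_eq_zero hf (n := n + 1)).1 ?_ n n.lt_succ_self
  by_contra! hlt
  obtain ⟨k, hk⟩ := ENat.ne_top_iff_exists.1 hlt.ne_top
  rw [← hk, Nat.cast_lt] at hlt
  obtain ⟨g, hg, hg0, hfg⟩ := (hf.analyticOrderAt_eq_natCast).1 hk.symm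
  apply hg0
  have hgO : g =O[𝓝[≠] 0] fun z => z ^ (n + 1 - k) := by
    obtain ⟨C, hC⟩ := hO.bound
    refine IsBigO.of_bound C ?_
    filter_upwards [hC.filter_mono nhdsWithin_le_nhds, hfg.filter_mono nhdsWithin_le_nhds,
      self_mem_nhdsWithin] with z h1 h2 hz
    have hz' : 0 < ‖z‖ ^ k := pow_pos (norm_pos_iff.2 hz) k
    rw [h2, sub_zero, smul_eq_mul, norm_mul, norm_pow, norm_pow,
      show n + 1 = k + (n + 1 - k) by omega, pow_add, mul_left_comm] at h1
    simpa using le_of_mul_le_mul_left h1 hz'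
  have h0 : Tendsto (fun z : ℂ => z ^ (n + 1 - k)) (𝓝[≠] 0) (𝓝 0) := by
    have : Tendsto (fun z : ℂ => z ^ (n + 1 - k)) (𝓝 0) (𝓝 (0 ^ (n + 1 - k))) :=
      (continuous_pow _).tendsto 0
    rw [zero_pow (by omega)] at this
    exact this.mono_left nhdsWithin_le_nhds
  exact tendsto_nhds_unique (hg.continuousAt.tendsto.mono_left nhdsWithin_le_nhds)
    (hgO.trans_tendsto h0)

theorem eFn_natCast_div_s5 (j n : ℕ) : eFn (j / n) = eFn (1 / n) ^ j := by
  rw [eFn, eFn, ← Complex.exp_nat_mul]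
  congr 1
  ring

theorem isPrimitiveRoot_eFn {n : ℕ} (hn : n ≠ 0) : IsPrimitiveRoot (eFn (1 / n)) n := by
  convert! Complex.isPrimitiveRoot_exp n hn using 1
  rw [eFn]
  congr 1
  ring

theorem IsPrimitiveRoot.prod_range_sub_mul_pow {ζ : ℂ} {n : ℕ} (hn : 0 < n)
    (h : IsPrimitiveRoot ζ n) (x y : ℂ) : ∏ j ∈ range n, (x - y * ζ ^ j) = x ^ n - y ^ n := by
  rw [h.pow_sub_pow_eq_prod_sub_mul x y hn]
  have : NeZero n := ⟨hn.ne'⟩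
  refine Finset.prod_nbij (fun j => ζ ^ j) (fun j _ => ?_) (fun i hi j hj hij => ?_)
    (fun z hz => ?_) (fun j _ => by ring)
  · rw [Polynomial.mem_nthRootsFinset hn, ← pow_mul, mul_comm, pow_mul, h.pow_eq_one, one_pow]
  · exact h.pow_inj (by simpa using hi) (by simpa using hj) hij
  · obtain ⟨i, hi, rfl⟩ := h.eq_pow_of_pow_eq_one ((Polynomial.mem_nthRootsFinset hn _).1 hz)
    exact ⟨i, by simpa using hi, rfl⟩

theorem IsPrimitiveRoot.re_one_sub_mul_pow_pos {ζ : ℂ} {n : ℕ} (hn : n ≠ 0)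
    (h : IsPrimitiveRoot ζ n) {w : ℂ} (hw : ‖w‖ < 1) (j : ℕ) : 0 < (1 - w * ζ ^ j).re := by
  have : (w * ζ ^ j).re ≤ ‖w‖ := (Complex.re_le_norm _).trans (by simp [h.norm'_eq_one hn])
  simp only [Complex.sub_re, Complex.one_re]
  linarith

theorem IsPrimitiveRoot.prod_GammaSeq_one_sub {ζ : ℂ} {n : ℕ} (hn : 2 ≤ n)
    (h : IsPrimitiveRoot ζ n) {w : ℂ} (hw : ‖w‖ < 1) {m : ℕ} (hm : m ≠ 0) :
    (∏ j ∈ range n, Complex.GammaSeq (1 - w * ζ ^ j) m) *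
      ∏ k ∈ range (m + 1), (1 + -(w ^ n / ((k : ℂ) + 1) ^ n)) = ((m : ℂ) / (m + 1)) ^ n := by
  have hm' : (m : ℂ) ≠ 0 := Nat.cast_ne_zero.2 hm
  have hk (k : ℕ) : (k : ℂ) + 1 ≠ 0 := Nat.cast_add_one_ne_zero k
  have hsum : ∑ j ∈ range n, (1 - w * ζ ^ j) = n := by
    rw [sum_sub_distrib, ← mul_sum, h.geom_sum_eq_zero (by omega)]
    simp
  have hpow : ∏ j ∈ range n, (m : ℂ) ^ (1 - w * ζ ^ j) = (m : ℂ) ^ n := by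
    simp_rw [Complex.cpow_def_of_ne_zero hm']
    rw [← Complex.exp_sum, ← mul_sum, hsum, mul_comm, Complex.exp_nat_mul, Complex.exp_log hm']
  have hden (k : ℕ) : ∏ j ∈ range n, (1 - w * ζ ^ j + k) = ((k : ℂ) + 1) ^ n - w ^ n := by
    rw [← h.prod_range_sub_mul_pow (by omega)]
    exact prod_congr rfl fun j _ => by ring
  have hne (k : ℕ) : ((k : ℂ) + 1) ^ n - w ^ n ≠ 0 := by
    rw [← hden, prod_ne_zero_iff]
    intro j _ h0
    have := h.re_one_sub_mul_pow_pos (by omega) hw j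
    have h1 := congrArg Complex.re h0
    simp only [Complex.add_re, Complex.natCast_re, Complex.zero_re] at h1
    linarith [(Nat.cast_nonneg k : (0 : ℝ) ≤ k)]
  have hP : ∏ k ∈ range (m + 1), (1 + -(w ^ n / ((k : ℂ) + 1) ^ n)) =
      (∏ k ∈ range (m + 1), (((k : ℂ) + 1) ^ n - w ^ n)) / (((m + 1).factorial : ℂ)) ^ n := by
    rw [← prod_range_add_one_eq_factorial, Nat.cast_prod, ← prod_pow, ← prod_div_distrib]
    refine prod_congr rfl fun k _ => ?_
    have := pow_ne_zero n (hk k)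
    push_cast
    field_simp
    ring
  simp_rw [Complex.GammaSeq]
  rw [prod_div_distrib, prod_mul_distrib, hpow, Finset.prod_comm, hP, prod_congr rfl fun k _ => hden k,
    prod_const, card_range, Nat.factorial_succ]
  have h1 := prod_ne_zero_iff.2 fun k (_ : k ∈ range (m + 1)) => hne k
  have h2 : (m.factorial : ℂ) ≠ 0 := Nat.cast_ne_zero.2 m.factorial_ne_zero
  have h3 := hk m
  push_cast
  rw [mul_pow, div_pow]
  field_simp

theorem IsPrimitiveRoot.tendsto_prod_one_sub_pow_div {ζ : ℂ} {n : ℕ} (hn : 2 ≤ n)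
    (h : IsPrimitiveRoot ζ n) {w : ℂ} (hw : ‖w‖ < 1) :
    Tendsto (fun m : ℕ => ∏ k ∈ range (m + 1), (1 + -(w ^ n / ((k : ℂ) + 1) ^ n))) atTop
      (𝓝 (∏ j ∈ range n, Complex.Gamma (1 - w * ζ ^ j))⁻¹) := by
  have hF : ∏ j ∈ range n, Complex.Gamma (1 - w * ζ ^ j) ≠ 0 := prod_ne_zero_iff.2 fun j _ =>
    Complex.Gamma_ne_zero_of_re_pos (h.re_one_sub_mul_pow_pos (by omega) hw j)
  have hA : Tendsto (fun m => ∏ j ∈ range n, Complex.GammaSeq (1 - w * ζ ^ j) m) atTop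
      (𝓝 (∏ j ∈ range n, Complex.Gamma (1 - w * ζ ^ j))) :=
    tendsto_finsetProd _ fun j _ => Complex.GammaSeq_tendsto_Gamma _
  have hB : Tendsto (fun m : ℕ => ((m : ℂ) / (m + 1)) ^ n) atTop (𝓝 1) := by
    simpa using (tendsto_natCast_div_add_atTop (1 : ℂ)).pow n
  rw [← one_div]
  refine (hB.div hA hF).congr' ?_
  filter_upwards [eventually_ne_atTop 0, hA.eventually_ne hF] with m hm hAm
  rw [Pi.div_apply, ← h.prod_GammaSeq_one_sub hn hw hm, mul_div_cancel_left₀ _ hAm]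

theorem hasSum_riemannZeta_nat {n : ℕ} (hn : 2 ≤ n) :
    HasSum (fun k : ℕ => 1 / ((k : ℂ) + 1) ^ n) (riemannZeta n) := by
  have hs : Summable fun k : ℕ => 1 / (k : ℂ) ^ n :=
    .of_norm (by simpa using Real.summable_one_div_nat_pow.2 (show 1 < n by omega))
  rw [zeta_nat_eq_tsum_of_gt_one (by omega)]
  have := (hasSum_nat_add_iff' 1).2 hs.hasSum
  simpa [zero_pow (show n ≠ 0 by omega)] using this

theorem IsPrimitiveRoot.inv_prod_Gamma_isBigO {ζ : ℂ} {n : ℕ} (hn : 2 ≤ n)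
    (h : IsPrimitiveRoot ζ n) :
    (fun w => (∏ j ∈ range n, Complex.Gamma (1 - w * ζ ^ j))⁻¹ - 1 + riemannZeta n * w ^ n)
      =O[𝓝 0] fun w => w ^ (2 * n) := by
  have hz := hasSum_riemannZeta_nat hn
  have hT : Summable fun k : ℕ => ‖1 / ((k : ℂ) + 1) ^ n‖ := hz.summable.norm
  set T := ∑' k : ℕ, ‖1 / ((k : ℂ) + 1) ^ n‖
  have hsmall : ∀ᶠ w : ℂ in 𝓝 0, ‖w‖ ^ n * T < 1 := by
    have : Tendsto (fun w : ℂ => ‖w‖ ^ n * T) (𝓝 0) (𝓝 (‖(0 : ℂ)‖ ^ n * T)) :=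
      Continuous.tendsto (by fun_prop) 0
    refine this.eventually_lt_const ?_
    simp [zero_pow (show n ≠ 0 by omega)]
  have hball : ∀ᶠ w : ℂ in 𝓝 0, ‖w‖ < 1 := by
    filter_upwards [Metric.ball_mem_nhds (0 : ℂ) one_pos] with w hw using by simpa using hw
  refine IsBigO.of_bound (T ^ 2) ?_
  filter_upwards [hsmall, hball] with w hw1 hw
  have hlim : Tendsto (fun m : ℕ => ∏ k ∈ range (m + 1), (1 + -(w ^ n / ((k : ℂ) + 1) ^ n)) - 1 -
      ∑ k ∈ range (m + 1), -(w ^ n / ((k : ℂ) + 1) ^ n)) atTop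
      (𝓝 ((∏ j ∈ range n, Complex.Gamma (1 - w * ζ ^ j))⁻¹ - 1 + riemannZeta n * w ^ n)) := by
    have h1 := (h.tendsto_prod_one_sub_pow_div hn hw).sub_const 1
    have h2 := ((hz.mul_right (w ^ n)).tendsto_sum_nat.comp (tendsto_add_atTop_nat 1))
    refine (h1.add h2).congr fun m => ?_
    simp only [Function.comp_apply, sum_neg_distrib, sub_neg_eq_add]
    congr 1
    exact sum_congr rfl fun k _ => by ring
  refine le_of_tendsto hlim.norm (Eventually.of_forall fun m => ?_)
  refine (Finset.norm_prod_one_add_sub_one_sub_sum_le _ _).trans ?_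
  have hS : ∑ k ∈ range (m + 1), ‖-(w ^ n / ((k : ℂ) + 1) ^ n)‖ ≤ ‖w‖ ^ n * T := by
    have : ∀ k : ℕ, ‖-(w ^ n / ((k : ℂ) + 1) ^ n)‖ = ‖w‖ ^ n * ‖1 / ((k : ℂ) + 1) ^ n‖ := by
      intro k
      rw [norm_neg, div_eq_mul_one_div, norm_mul, norm_pow]
    simp_rw [this]
    rw [← mul_sum]
    exact mul_le_mul_of_nonneg_left (hT.sum_le_tsum _ fun _ _ => norm_nonneg _) (by positivity)
  set S := ∑ k ∈ range (m + 1), ‖-(w ^ n / ((k : ℂ) + 1) ^ n)‖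
  have hS0 : 0 ≤ S := sum_nonneg fun _ _ => norm_nonneg _
  calc Real.exp S - 1 - S ≤ S ^ 2 :=
        (le_abs_self _).trans (Real.abs_exp_sub_one_sub_id_le (by rw [abs_of_nonneg hS0]; linarith))
    _ ≤ (‖w‖ ^ n * T) ^ 2 := by gcongr
    _ = T ^ 2 * ‖w ^ (2 * n)‖ := by rw [norm_pow]; ring

theorem IsPrimitiveRoot.analyticAt_prod_Gamma {ζ : ℂ} {n : ℕ} (hn : n ≠ 0)
    (h : IsPrimitiveRoot ζ n) :
    AnalyticAt ℂ (fun w => ∏ j ∈ range n, Complex.Gamma (1 - w * ζ ^ j)) 0 := by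
  refine DifferentiableOn.analyticAt (s := Metric.ball 0 1) (fun w hw => ?_)
    (Metric.ball_mem_nhds _ one_pos)
  refine DifferentiableAt.differentiableWithinAt (DifferentiableAt.fun_finsetProd fun j _ => ?_)
  refine DifferentiableAt.comp (g := Complex.Gamma) w
    (Complex.differentiableAt_Gamma _ fun m hm => ?_) (by fun_prop)
  have h1 := h.re_one_sub_mul_pow_pos hn (by simpa using hw) j
  rw [hm] at h1
  simp only [Complex.neg_re, Complex.natCast_re] at h1
  linarith [(Nat.cast_nonneg m : (0 : ℝ) ≤ m)]

theorem IsPrimitiveRoot.prod_Gamma_isBigO {ζ : ℂ} {n : ℕ} (hn : 2 ≤ n)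
    (h : IsPrimitiveRoot ζ n) :
    (fun w => ∏ j ∈ range n, Complex.Gamma (1 - w * ζ ^ j) - (1 + riemannZeta n * w ^ n))
      =O[𝓝 0] fun w => w ^ (n + 1) := by
  set F := fun w => ∏ j ∈ range n, Complex.Gamma (1 - w * ζ ^ j) with hFdef
  have hFc : ContinuousAt F 0 := (h.analyticAt_prod_Gamma (by omega)).continuousAt
  have hF0 : F 0 ≠ 0 := by simp [hFdef]
  have hle : (fun w : ℂ => w ^ (2 * n)) =O[𝓝 0] fun w => w ^ (n + 1) :=
    (isLittleO_pow_pow (by omega)).isBigO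
  have hb : (fun w : ℂ => 1 + riemannZeta n * w ^ n) =O[𝓝 0] fun _ => (1 : ℂ) :=
    (Continuous.tendsto (by fun_prop) 0).isBigO_one ℂ
  have hE := hb.mul (h.inv_prod_Gamma_isBigO hn)
  have hq : (fun w : ℂ => riemannZeta n ^ 2 * w ^ (2 * n)) =O[𝓝 0] fun w => 1 * w ^ (2 * n) := by
    simpa using (isBigO_refl (fun w : ℂ => w ^ (2 * n)) (𝓝 0)).const_mul_left (riemannZeta n ^ 2)
  have hmain := (hFc.tendsto.isBigO_one ℂ).mul (hq.sub hE)
  simp only [one_mul] at hmain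
  refine (hmain.congr' ?_ EventuallyEq.rfl).trans hle
  filter_upwards [hFc.eventually_ne hF0] with w hw
  change F w * (_ - _ * ((F w)⁻¹ - 1 + _)) = F w - _
  field_simp
  ring

theorem IsPrimitiveRoot.iteratedDeriv_prod_Gamma {ζ : ℂ} {n : ℕ} (hn : 2 ≤ n)
    (h : IsPrimitiveRoot ζ n) :
    iteratedDeriv n (fun w => ∏ j ∈ range n, Complex.Gamma (1 - w * ζ ^ j)) 0 =
      n.factorial * riemannZeta n := by
  have hF := h.analyticAt_prod_Gamma (by omega : n ≠ 0)
  have hp : AnalyticAt ℂ (fun w : ℂ => 1 + riemannZeta n * w ^ n) 0 := by fun_prop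
  have h0 := (hF.sub hp).iteratedDeriv_eq_zero_of_isBigO (h.prod_Gamma_isBigO hn)
  rw [iteratedDeriv_sub hF.contDiffAt hp.contDiffAt, sub_eq_zero] at h0
  rw [h0, iteratedDeriv_const_add (by omega), iteratedDeriv_const_mul_field, iteratedDeriv_pow]
  simp [Nat.descFactorial_self, mul_comm]

/-- for an integer `n ≥ 2`, with `F(z) := ∏_{j=0}^{n-1} Γ(1 - z·e(j/n))`, the
`n`-th derivative of `F` at real `z > 0` tends to `n!·ζ(n)` as `z → 0⁺`; i.e.
`ζ(n) = (1/n!) · lim_{z→0⁺} (dⁿ/dzⁿ) ∏_{j=0}^{n-1} Γ(1 - z e(j/n))`. -/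
theorem riemannZeta_eq_limit_iteratedDeriv_gammaProd (n : ℕ) (hn : 2 ≤ n) :
    Filter.Tendsto
      (fun z : ℝ => iteratedDeriv n
        (fun w : ℂ => ∏ j ∈ Finset.range n, Complex.Gamma (1 - w * eFn ((j : ℂ) / (n : ℂ))))
        (z : ℂ))
      (nhdsWithin 0 (Set.Ioi 0))
      (nhds ((n.factorial : ℂ) * riemannZeta (n : ℂ))) := by
  have h := isPrimitiveRoot_eFn (show n ≠ 0 by omega)
  simp_rw [eFn_natCast_div_s5]
  rw [← h.iteratedDeriv_prod_Gamma hn]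
  have hc := ((h.analyticAt_prod_Gamma (by omega)).iterated_deriv n).continuousAt.tendsto
  rw [← iteratedDeriv_eq_iterate] at hc
  refine hc.comp (Tendsto.mono_left ?_ nhdsWithin_le_nhds)
  simpa using Complex.continuous_ofReal.tendsto 0
end

section
/- For every even integer m ≥ 2 and every integer k ≥ 0, the value ζ_𝒫({m}^k) is a rational multiple of π^{mk}; that is, there exists q ∈ ℚ with ζ_𝒫({m}^k) = q · π^{mk}. -/
/-- `ζ_𝒫({m}^k) = Σ_{n₁ ≥ ⋯ ≥ n_k ≥ 1} (n₁⋯n_k)^{-m}`: the sum of `n_λ^{-m}` over all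
partitions `λ` with exactly `k` parts (encoded as multisets of positive integers
of cardinality `k`). -/
noncomputable def partitionZeta (m k : ℕ) : ℂ :=
  ∑' μ : {μ : Multiset ℕ // Multiset.card μ = k ∧ ∀ x ∈ μ, 0 < x},
    ((μ.1.prod : ℂ) ^ m)⁻¹

/-- The complete homogeneous symmetric function `h_k` in the family of values `f a`, as an
unconditional sum over multisets of cardinality `k`. -/
noncomputable def completeHomogeneousSum {α : Type*} (f : α → ENNReal) (k : ℕ) : ENNReal :=
  ∑' μ : Multiset α, if Multiset.card μ = k then (μ.map f).prod else 0

theorem completeHomogeneousSum_zero {α : Type*} (f : α → ENNReal) :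
    completeHomogeneousSum f 0 = 1 := by
  rw [completeHomogeneousSum, tsum_eq_single 0 (fun μ hμ => by simp [hμ])]
  simp

/-- The cardinality of a multiset is the sum of its multiplicities, each written as a sum of
indicators. -/
theorem card_eq_tsum_sum_range_le_count {α : Type*} [DecidableEq α] (μ : Multiset α) :
    (Multiset.card μ : ENNReal) =
      ∑' a, ∑ j ∈ Finset.range (Multiset.card μ), if j + 1 ≤ μ.count a then 1 else 0 := by
  have h (a : α) : (∑ j ∈ Finset.range (Multiset.card μ),
      if j + 1 ≤ μ.count a then (1 : ENNReal) else 0) = μ.count a := by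
    rw [Finset.sum_boole]
    congr 1
    have : (Finset.range (Multiset.card μ)).filter (fun j => j + 1 ≤ μ.count a) =
        Finset.range (μ.count a) := by
      ext j
      have := Multiset.count_le_card a μ
      simp only [Finset.mem_filter, Finset.mem_range]
      omega
    rw [this, Finset.card_range]
  simp_rw [h]
  rw [tsum_eq_sum (s := μ.toFinset) (fun a ha => by simpa using ha)]
  exact_mod_cast (Multiset.toFinset_sum_count_eq μ).symm

theorem tsum_le_count_eq_pow_mul {α : Type*} [DecidableEq α] (f : α → ENNReal) (a : α)
    {n j : ℕ} (hj : j ≤ n) :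
    (∑' μ : Multiset α, if Multiset.card μ = n ∧ j ≤ μ.count a then (μ.map f).prod else 0) =
      f a ^ j * completeHomogeneousSum f (n - j) := by
  have hinj : Function.Injective (fun ν : Multiset α => Multiset.replicate j a + ν) :=
    add_right_injective _
  rw [← hinj.tsum_eq, completeHomogeneousSum, ← ENNReal.tsum_mul_left]
  · refine tsum_congr fun ν => ?_
    have : j + Multiset.card ν = n ↔ Multiset.card ν = n - j := by omega
    simp [this]
  · intro μ hμ
    have h : Multiset.card μ = n ∧ j ≤ μ.count a := by
      by_contra h
      simp [h] at hμ
    exact ⟨μ - Multiset.replicate j a,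
      add_tsub_cancel_of_le (Multiset.le_count_iff_replicate_le.mp h.2)⟩

/-- Newton's identity relating complete homogeneous sums to power sums. -/
theorem mul_completeHomogeneousSum {α : Type*} (f : α → ENNReal) (n : ℕ) :
    n * completeHomogeneousSum f n =
      ∑ j ∈ Finset.range n, (∑' a, f a ^ (j + 1)) * completeHomogeneousSum f (n - (j + 1)) := by
  classical
  have key (μ : Multiset α) :
      (n : ENNReal) * (if Multiset.card μ = n then (μ.map f).prod else 0) =
        ∑' a, ∑ j ∈ Finset.range n,
          if Multiset.card μ = n ∧ j + 1 ≤ μ.count a then (μ.map f).prod else 0 := by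
    by_cases h : Multiset.card μ = n
    · subst h
      rw [if_pos rfl, card_eq_tsum_sum_range_le_count μ, ← ENNReal.tsum_mul_right]
      refine tsum_congr fun a => ?_
      rw [Finset.sum_mul]
      simp
    · simp [h]
  rw [completeHomogeneousSum, ← ENNReal.tsum_mul_left]
  simp_rw [key]
  rw [ENNReal.tsum_comm]
  simp_rw [Summable.tsum_finsetSum fun _ _ => ENNReal.summable]
  refine Finset.sum_congr rfl fun j hj => ?_
  rw [← ENNReal.tsum_mul_right]
  exact tsum_congr fun a => tsum_le_count_eq_pow_mul f a (Finset.mem_range.mp hj)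

/-- If the power sums are rational multiples of powers of `x`, so are the complete homogeneous
sums. -/
theorem exists_rat_completeHomogeneousSum {α : Type*} (f : α → ENNReal) {x : ℝ} (hx : 0 ≤ x)
    (hp : ∀ j : ℕ, ∃ q : ℚ, 0 ≤ q ∧ ∑' a, f a ^ (j + 1) = ENNReal.ofReal (q * x ^ (j + 1)))
    (n : ℕ) : ∃ q : ℚ, 0 ≤ q ∧ completeHomogeneousSum f n = ENNReal.ofReal (q * x ^ n) := by
  choose p hp0 hp using hp
  induction n using Nat.strong_induction_on with
  | _ n ih =>
    rcases Nat.eq_zero_or_pos n with rfl | hn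
    · exact ⟨1, zero_le_one, by simp [completeHomogeneousSum_zero]⟩
    have ih' (j : ℕ) : ∃ q : ℚ, 0 ≤ q ∧ (j < n → completeHomogeneousSum f (n - (j + 1)) =
        ENNReal.ofReal (q * x ^ (n - (j + 1)))) := by
      by_cases hj : j < n
      · obtain ⟨q, hq, h⟩ := ih (n - (j + 1)) (by omega)
        exact ⟨q, hq, fun _ => h⟩
      · exact ⟨0, le_rfl, fun h => absurd h hj⟩
    choose q hq0 hq using ih'
    have hsum : 0 ≤ ∑ j ∈ Finset.range n, p j * q j :=
      Finset.sum_nonneg fun j _ => mul_nonneg (hp0 j) (hq0 j)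
    refine ⟨(∑ j ∈ Finset.range n, p j * q j) / n, by positivity, ?_⟩
    have hn0 : (n : ENNReal) ≠ 0 := by exact_mod_cast hn.ne'
    rw [← ENNReal.mul_right_inj hn0 (ENNReal.natCast_ne_top n), mul_completeHomogeneousSum,
      ← ENNReal.ofReal_natCast n, ← ENNReal.ofReal_mul (Nat.cast_nonneg n)]
    have hnR : (n : ℝ) ≠ 0 := by exact_mod_cast hn.ne'
    have hreal : (n : ℝ) * (((∑ j ∈ Finset.range n, p j * q j) / n : ℚ) * x ^ n) =
        ∑ j ∈ Finset.range n, ((p j : ℝ) * x ^ (j + 1)) * (q j * x ^ (n - (j + 1))) := by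
      push_cast
      rw [← mul_assoc, mul_div_cancel₀ _ hnR, Finset.sum_mul]
      refine Finset.sum_congr rfl fun j hj => ?_
      have hj' : j + 1 ≤ n := Finset.mem_range.mp hj
      rw [← pow_mul_pow_sub x hj']
      ring
    have hpR (j : ℕ) : 0 ≤ (p j : ℝ) * x ^ (j + 1) :=
      mul_nonneg (by exact_mod_cast hp0 j) (pow_nonneg hx _)
    have hqR (j : ℕ) : 0 ≤ (q j : ℝ) * x ^ (n - (j + 1)) :=
      mul_nonneg (by exact_mod_cast hq0 j) (pow_nonneg hx _)
    rw [hreal, ENNReal.ofReal_sum_of_nonneg fun j _ => mul_nonneg (hpR j) (hqR j)]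
    refine Finset.sum_congr rfl fun j hj => ?_
    rw [hp, hq j (Finset.mem_range.mp hj), ENNReal.ofReal_mul (hpR j)]

/-- Even zeta values are nonnegative rational multiples of powers of `π`. -/
theorem exists_rat_tsum_inv_pow_even {k : ℕ} (hk : k ≠ 0) :
    ∃ q : ℚ, 0 ≤ q ∧ ∑' n : ℕ, ENNReal.ofReal (((n : ℝ) ^ (2 * k))⁻¹) =
      ENNReal.ofReal (q * Real.pi ^ (2 * k)) := by
  have h := hasSum_zeta_nat hk
  simp only [one_div] at h
  have hnonneg (n : ℕ) : 0 ≤ ((n : ℝ) ^ (2 * k))⁻¹ := by positivity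
  let q : ℚ := (-1) ^ (k + 1) * 2 ^ (2 * k - 1) * bernoulli (2 * k) / (2 * k).factorial
  have hq : (-1 : ℝ) ^ (k + 1) * 2 ^ (2 * k - 1) * Real.pi ^ (2 * k) * bernoulli (2 * k) /
      (2 * k).factorial = q * Real.pi ^ (2 * k) := by
    simp only [q]
    push_cast
    ring
  rw [hq] at h
  refine ⟨q, ?_, ?_⟩
  · have h0 : 0 ≤ (q : ℝ) * Real.pi ^ (2 * k) := h.nonneg hnonneg
    exact_mod_cast nonneg_of_mul_nonneg_left h0 (by positivity)
  · rw [← ENNReal.ofReal_tsum_of_nonneg hnonneg h.summable, h.tsum_eq]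

theorem partitionZeta_eq_completeHomogeneousSum {m : ℕ} (hm : m ≠ 0) (k : ℕ) :
    partitionZeta m k =
      ((completeHomogeneousSum (fun n : ℕ => ENNReal.ofReal (((n : ℝ) ^ m)⁻¹)) k).toReal : ℂ) := by
  have hmap (μ : Multiset ℕ) : (μ.map fun n : ℕ => ENNReal.ofReal (((n : ℝ) ^ m)⁻¹)).prod =
      ENNReal.ofReal (((μ.prod : ℝ) ^ m)⁻¹) := by
    induction μ using Multiset.induction_on with
    | empty => simp
    | cons a μ ih =>
      rw [Multiset.map_cons, Multiset.prod_cons, ih, ← ENNReal.ofReal_mul (by positivity)]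
      simp [mul_pow, mul_comm]
  have hsub : completeHomogeneousSum (fun n : ℕ => ENNReal.ofReal (((n : ℝ) ^ m)⁻¹)) k =
      ∑' μ : {μ : Multiset ℕ // Multiset.card μ = k ∧ ∀ x ∈ μ, 0 < x},
        ENNReal.ofReal (((μ.1.prod : ℝ) ^ m)⁻¹) := by
    have := tsum_subtype {μ : Multiset ℕ | Multiset.card μ = k ∧ ∀ x ∈ μ, 0 < x}
      (fun μ => ENNReal.ofReal (((μ.prod : ℝ) ^ m)⁻¹))
    refine Eq.trans ?_ this.symm
    refine tsum_congr fun μ => ?_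
    rw [hmap, Set.indicator_apply]
    by_cases h0 : 0 ∈ μ
    · have hprod : μ.prod = 0 := Multiset.prod_eq_zero h0
      simp [hprod, hm]
    · have hpos : ∀ x ∈ μ, 0 < x := fun x hx => Nat.pos_of_ne_zero fun h => h0 (h ▸ hx)
      exact if_congr (and_iff_left hpos).symm rfl rfl
  rw [hsub, ENNReal.tsum_toReal_eq fun _ => ENNReal.ofReal_ne_top, Complex.ofReal_tsum,
    partitionZeta]
  refine tsum_congr fun μ => ?_
  rw [ENNReal.toReal_ofReal (by positivity), Complex.ofReal_inv, Complex.ofReal_pow,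
    Complex.ofReal_natCast]

/-- for every even integer `m ≥ 2` and every integer `k ≥ 0`, the value
`ζ_𝒫({m}^k)` is a rational multiple of `π^{mk}`. -/
theorem partitionZeta_even_rational_multiple_pi_pow (m k : ℕ) (hm : 2 ≤ m) (hme : Even m) :
    ∃ q : ℚ, partitionZeta m k = (q : ℂ) * (Real.pi : ℂ) ^ (m * k) := by
  obtain ⟨q, hq0, hq⟩ := exists_rat_completeHomogeneousSum
    (fun n : ℕ => ENNReal.ofReal (((n : ℝ) ^ m)⁻¹)) (x := Real.pi ^ m) (by positivity)
    (fun j => by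
      obtain ⟨r, hr⟩ := hme.two_dvd
      obtain ⟨q, hq0, hq⟩ := exists_rat_tsum_inv_pow_even (k := r * (j + 1))
        (Nat.mul_ne_zero (by omega) (by omega))
      refine ⟨q, hq0, ?_⟩
      rw [← pow_mul, hr, mul_assoc, ← hq]
      refine tsum_congr fun n => ?_
      rw [← ENNReal.ofReal_pow (by positivity), inv_pow, ← pow_mul, mul_assoc]) k
  refine ⟨q, ?_⟩
  have hqR : 0 ≤ (q : ℝ) := by exact_mod_cast hq0
  rw [partitionZeta_eq_completeHomogeneousSum (by omega), hq,
    ENNReal.toReal_ofReal (by positivity), ← pow_mul]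
  push_cast
  rfl
end

section
/- Let m ≥ 2 and k ≥ 1 be integers. For 1 ≤ i ≤ j ≤ k set α_{i,j} := ζ(m(j−i+1)) · (k−i)! / (π^{m(j−i+1)} · (k−j)!). Let A be the k×k matrix with entries A_{i,j} = α_{i,j} for j ≥ i, A_{i,j} = −1 when j = i−1, and A_{i,j} = 0 when j < i−1. Then ζ_𝒫({m}^k) = (π^{mk}/k!) · det(A). -/
/-- The complete homogeneous symmetric function of degree `n` in the (possibly infinite) family
`f`. -/
noncomputable def hsymmSeries {ι R : Type*} [NormedField R] (f : ι → R) (n : ℕ) : R :=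
  ∑' μ : Sym ι n, ((μ : Multiset ι).map f).prod

theorem summable_norm_hsymmSeries {ι R : Type*} [NormedField R] {f : ι → R}
    (hf : Summable fun x => ‖f x‖) (n : ℕ) :
    Summable fun μ : Sym ι n => ‖((μ : Multiset ι).map f).prod‖ := by
  classical
  induction n with
  | zero => exact Summable.of_finite
  | succ n ih =>
    have hsurj : Function.Surjective fun p : ι × Sym ι n => p.1 ::ₛ p.2 := fun μ => by
      obtain ⟨a, s, rfl⟩ := μ.exists_eq_cons_of_succ
      exact ⟨(a, s), rfl⟩
    have hprod : Summable fun p : ι × Sym ι n =>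
        ‖(((p.1 ::ₛ p.2 : Sym ι (n + 1)) : Multiset ι).map f).prod‖ := by
      simpa only [Sym.coe_cons, Multiset.map_cons, Multiset.prod_cons, norm_mul] using
        hf.mul_of_nonneg ih (fun _ => norm_nonneg _) (fun _ => norm_nonneg _)
    refine (hprod.comp_injective (Function.injective_surjInv hsurj)).congr fun μ => ?_
    have h := Function.surjInv_eq hsurj μ
    simp only [Function.comp_apply] at h ⊢
    rw [h]

theorem summable_norm_pow {ι R : Type*} [NormedField R] {f : ι → R}
    (hf : Summable fun x => ‖f x‖) {j : ℕ} (hj : j ≠ 0) : Summable fun x => ‖f x ^ j‖ := by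
  refine Summable.of_norm_bounded_eventually hf ?_
  filter_upwards [hf.tendsto_cofinite_zero.eventually_le_const one_pos] with x hx
  rw [norm_norm, norm_pow]
  exact pow_le_of_le_one (norm_nonneg _) hx hj

theorem hasSum_ite_le_count {ι R : Type*} [DecidableEq ι] [NormedField R] [CompleteSpace R]
    {f : ι → R} (hf : Summable fun x => ‖f x‖) {j n : ℕ} (hj : j ≠ 0) (hjn : j ≤ n) :
    HasSum (fun p : Sym ι n × ι =>
        if j ≤ (p.1 : Multiset ι).count p.2 then ((p.1 : Multiset ι).map f).prod else 0)
      ((∑' x, f x ^ j) * hsymmSeries f (n - j)) := by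
  have h1 := summable_norm_pow hf hj
  have h2 := summable_norm_hsymmSeries hf (n - j)
  have h : HasSum (fun p : ι × Sym ι (n - j) => f p.1 ^ j * ((p.2 : Multiset ι).map f).prod)
      ((∑' x, f x ^ j) * hsymmSeries f (n - j)) := by
    have hs := summable_mul_of_summable_norm h1 h2
    rw [hsymmSeries, tsum_mul_tsum_of_summable_norm h1 h2]
    exact hs.hasSum
  let φ : ι × Sym ι (n - j) → Sym ι n × ι := fun p =>
    (⟨(p.2 : Multiset ι) + Multiset.replicate j p.1, by simp [hjn]⟩, p.1)
  have hφ : Function.Injective φ := by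
    rintro ⟨x, μ⟩ ⟨y, ν⟩ hxy
    obtain rfl : x = y := congrArg Prod.snd hxy
    have hμν : (μ : Multiset ι) + Multiset.replicate j x = ν + Multiset.replicate j x :=
      congrArg (fun p : Sym ι n × ι => (p.1 : Multiset ι)) hxy
    exact Prod.ext rfl (Subtype.ext (add_right_cancel hμν))
  rw [← hφ.hasSum_iff]
  · convert h using 1
    ext ⟨x, μ⟩
    simp [φ, mul_comm]
  · rintro ⟨μ, x⟩ hp
    refine if_neg fun hle => hp ?_
    have hrep : Multiset.replicate j x ≤ (μ : Multiset ι) :=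
      Multiset.le_count_iff_replicate_le.1 hle
    refine ⟨(x, ⟨(μ : Multiset ι) - Multiset.replicate j x, by
      rw [Multiset.card_sub hrep]; simp⟩), ?_⟩
    exact Prod.ext (Subtype.ext (tsub_add_cancel_of_le hrep)) rfl

/-- Newton's identity relating complete homogeneous symmetric functions and power sums of an
absolutely summable family. -/
theorem natCast_mul_hsymmSeries {ι R : Type*} [NormedField R] [CompleteSpace R] {f : ι → R}
    (hf : Summable fun x => ‖f x‖) (n : ℕ) :
    (n : R) * hsymmSeries f n =
      ∑ j ∈ Finset.range n, (∑' x, f x ^ (j + 1)) * hsymmSeries f (n - (j + 1)) := by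
  classical
  have h := hasSum_sum fun j (hj : j ∈ Finset.range n) =>
    hasSum_ite_le_count hf j.succ_ne_zero (Finset.mem_range.1 hj)
  have hfib (μ : Sym ι n) : HasSum (fun x => ∑ j ∈ Finset.range n,
      if j.succ ≤ (μ : Multiset ι).count x then ((μ : Multiset ι).map f).prod else 0)
      ((n : R) * ((μ : Multiset ι).map f).prod) := by
    have hcount (x : ι) : (∑ j ∈ Finset.range n,
        if j.succ ≤ (μ : Multiset ι).count x then ((μ : Multiset ι).map f).prod else 0) =
        ((μ : Multiset ι).count x : R) * ((μ : Multiset ι).map f).prod := by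
      have hle : (μ : Multiset ι).count x ≤ n := by
        simpa using Multiset.count_le_card x (μ : Multiset ι)
      have hfilter : (Finset.range n).filter (fun j => j.succ ≤ (μ : Multiset ι).count x) =
          Finset.range ((μ : Multiset ι).count x) := by
        ext j
        simp only [Finset.mem_filter, Finset.mem_range]
        omega
      rw [← Finset.sum_filter, hfilter, Finset.sum_const, Finset.card_range, nsmul_eq_mul]
    simp only [hcount]
    have hs : (n : R) = ∑ x ∈ (μ : Multiset ι).toFinset, ((μ : Multiset ι).count x : R) := by
      rw [← Nat.cast_sum, Multiset.toFinset_sum_count_eq]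
      simp
    rw [hs, Finset.sum_mul]
    refine hasSum_sum_of_ne_finset_zero fun x hx => ?_
    rw [Multiset.mem_toFinset] at hx
    simp [Multiset.count_eq_zero_of_notMem hx]
  have hsum := (h.prod_fiberwise hfib).tsum_eq
  rw [tsum_mul_left] at hsum
  exact hsum

/-- Cramer's rule for an upper Hessenberg matrix with subdiagonal entries `-1` and a right-hand
side supported on the first row. -/
theorem det_mul_last_of_mulVec_eq_single {R : Type*} [CommRing R] {n : ℕ}
    {A : Matrix (Fin (n + 1)) (Fin (n + 1)) R} {v : Fin (n + 1) → R} {c : R}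
    (hsub : ∀ i j : Fin (n + 1), (j : ℕ) + 1 = i → A i j = -1)
    (hlow : ∀ i j : Fin (n + 1), (j : ℕ) + 1 < i → A i j = 0)
    (hv : A.mulVec v = Pi.single 0 c) :
    A.det * v (Fin.last n) = c := by
  have h : A.cramer (A.mulVec v) (Fin.last n) = A.det * v (Fin.last n) := by
    rw [Matrix.cramer_eq_adjugate_mulVec, Matrix.mulVec_mulVec, Matrix.adjugate_mul,
      Matrix.smul_mulVec, Matrix.one_mulVec, Pi.smul_apply, smul_eq_mul]
  have htri : (A.submatrix (Fin.succAbove 0) (Fin.last n).succAbove).det = (-1) ^ n := by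
    rw [Matrix.det_of_isUpperTriangular]
    · have hdiag (i : Fin n) :
          A.submatrix (Fin.succAbove 0) (Fin.last n).succAbove i i = -1 :=
        hsub _ _ (by simp)
      simp only [hdiag, Finset.prod_const, Finset.card_univ, Fintype.card_fin]
    · intro i j hij
      refine hlow _ _ ?_
      simpa using hij
  rw [← h, hv, Matrix.cramer_apply, Matrix.det_succ_column _ (Fin.last n),
    Finset.sum_eq_single 0]
  · rw [Matrix.submatrix_updateCol_succAbove, htri]
    simp [mul_right_comm _ c, ← mul_pow]
  · intro i _ hi
    simp [hi]
  · simp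

theorem det_hessenberg_eq_factorial_mul {K : Type*} [Field K] [CharZero K] {q h : ℕ → K}
    (h0 : h 0 = 1)
    (hN : ∀ n : ℕ, (n : K) * h n = ∑ j ∈ Finset.range n, q (j + 1) * h (n - (j + 1))) (n : ℕ) :
    Matrix.det (Matrix.of fun i j : Fin (n + 1) =>
      if (i : ℕ) ≤ (j : ℕ) then
        q ((j : ℕ) - (i : ℕ) + 1) * ((n - (i : ℕ)).factorial : K) / ((n - (j : ℕ)).factorial : K)
      else if (j : ℕ) + 1 = (i : ℕ) then -1 else 0) = ((n + 1).factorial : K) * h (n + 1) := by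
  have key := det_mul_last_of_mulVec_eq_single (n := n)
    (A := Matrix.of fun i j : Fin (n + 1) =>
      if (i : ℕ) ≤ (j : ℕ) then
        q ((j : ℕ) - (i : ℕ) + 1) * ((n - (i : ℕ)).factorial : K) / ((n - (j : ℕ)).factorial : K)
      else if (j : ℕ) + 1 = (i : ℕ) then -1 else 0)
    (v := fun j => ((n - (j : ℕ)).factorial : K) * h (n - j))
    (c := ((n + 1).factorial : K) * h (n + 1)) ?_ ?_ ?_
  · simpa [h0] using key
  · intro i j hij
    rw [Matrix.of_apply, if_neg (by omega), if_pos hij]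
  · intro i j hij
    rw [Matrix.of_apply, if_neg (by omega), if_neg (by omega)]
  · ext ⟨i, hi⟩
    simp only [Matrix.mulVec, dotProduct, Matrix.of_apply]
    rw [Fin.sum_univ_eq_sum_range (fun j => (if i ≤ j then
        q (j - i + 1) * ((n - i).factorial : K) / ((n - j).factorial : K)
      else if j + 1 = i then -1 else 0) * (((n - j).factorial : K) * h (n - j))) (n + 1),
      ← Finset.sum_range_add_sum_Ico _ hi.le]
    have hupper : ∑ j ∈ Finset.Ico i (n + 1), (if i ≤ j then
        q (j - i + 1) * ((n - i).factorial : K) / ((n - j).factorial : K)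
      else if j + 1 = i then -1 else 0) * (((n - j).factorial : K) * h (n - j)) =
        ((n + 1 - i).factorial : K) * h (n + 1 - i) := by
      have hfac : n + 1 - i = (n - i) + 1 := by omega
      rw [Finset.sum_Ico_eq_sum_range, hfac, Nat.factorial_succ, Nat.cast_mul,
        mul_comm ((n - i + 1 : ℕ) : K), mul_assoc, hN, Finset.mul_sum]
      refine Finset.sum_congr rfl fun j hj => ?_
      have hne : ((n - (i + j)).factorial : K) ≠ 0 := Nat.cast_ne_zero.2 (Nat.factorial_ne_zero _)
      rw [if_pos (by omega), show i + j - i + 1 = j + 1 by omega,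
        show n - i + 1 - (j + 1) = n - (i + j) by omega]
      field_simp
    rw [hupper]
    cases i with
    | zero => simp
    | succ i =>
      rw [Finset.sum_range_succ, Finset.sum_eq_zero, if_neg (by omega), if_pos rfl,
        show n + 1 - (i + 1) = n - i by omega, Pi.single_eq_of_ne (by simp [Fin.ext_iff])]
      · ring
      · intro j hj
        have := Finset.mem_range.1 hj
        rw [if_neg (by omega), if_neg (by omega), zero_mul]

theorem partitionZeta_eq_hsymmSeries {m : ℕ} (hm : m ≠ 0) (k : ℕ) :
    partitionZeta m k = hsymmSeries (fun x : ℕ => ((x : ℂ) ^ m)⁻¹) k := by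
  let φ : {μ : Multiset ℕ // Multiset.card μ = k ∧ ∀ x ∈ μ, 0 < x} → Sym ℕ k :=
    fun μ => ⟨μ.1, μ.2.1⟩
  have hφ : Function.Injective φ := fun μ ν h => Subtype.ext (Subtype.mk.inj h)
  have hprod (μ : Multiset ℕ) :
      (μ.map fun x : ℕ => ((x : ℂ) ^ m)⁻¹).prod = ((μ.prod : ℂ) ^ m)⁻¹ := by
    induction μ using Multiset.induction_on with
    | empty => simp
    | cons a s ih => simp [ih, mul_pow, mul_comm]
  unfold partitionZeta hsymmSeries
  rw [← hφ.tsum_eq]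
  · exact tsum_congr fun μ => (hprod _).symm
  · intro μ hμ
    refine ⟨⟨μ, μ.2, fun x hx => Nat.pos_of_ne_zero ?_⟩, rfl⟩
    rintro rfl
    refine hμ ?_
    change (Multiset.map _ (μ : Multiset ℕ)).prod = 0
    rw [hprod, Multiset.prod_eq_zero hx]
    simp [hm]

/-- for integers `m ≥ 2`, `k ≥ 1`, with
`α_{i,j} = ζ(m(j-i+1))·(k-i)!/(π^{m(j-i+1)}·(k-j)!)` for `1 ≤ i ≤ j ≤ k`, entries `-1` on the
subdiagonal and `0` below it, we have `ζ_𝒫({m}^k) = (π^{mk}/k!)·det A`.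
(Indices `i, j : Fin k` here correspond to the 1-based `i+1, j+1`.) -/
theorem partitionZeta_det_formula (m k : ℕ) (hm : 2 ≤ m) (hk : 1 ≤ k) :
    partitionZeta m k = (Real.pi : ℂ) ^ (m * k) / (k.factorial : ℂ) *
      Matrix.det (Matrix.of fun i j : Fin k =>
        if (i : ℕ) ≤ (j : ℕ) then
          riemannZeta ((m * ((j : ℕ) - (i : ℕ) + 1) : ℕ) : ℂ) *
              ((k - 1 - (i : ℕ)).factorial : ℂ) /
            ((Real.pi : ℂ) ^ (m * ((j : ℕ) - (i : ℕ) + 1)) *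
              ((k - 1 - (j : ℕ)).factorial : ℂ))
        else if (j : ℕ) + 1 = (i : ℕ) then -1 else 0) := by
  obtain ⟨n, rfl⟩ : ∃ n, k = n + 1 := ⟨k - 1, by omega⟩
  set f : ℕ → ℂ := fun x => ((x : ℂ) ^ m)⁻¹ with hf_def
  have hf : Summable fun x => ‖f x‖ := by
    simpa [hf_def] using Real.summable_nat_pow_inv.2 (by omega : 1 < m)
  have hzeta (j : ℕ) : ∑' x, f x ^ (j + 1) = riemannZeta ((m * (j + 1) : ℕ) : ℂ) := by
    rw [zeta_nat_eq_tsum_of_gt_one (by nlinarith)]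
    simp [hf_def, pow_mul]
  have hpi : (Real.pi : ℂ) ≠ 0 := Complex.ofReal_ne_zero.2 Real.pi_ne_zero
  have hdet := det_hessenberg_eq_factorial_mul
    (q := fun d => riemannZeta ((m * d : ℕ) : ℂ) / (Real.pi : ℂ) ^ (m * d))
    (h := fun d => hsymmSeries f d / (Real.pi : ℂ) ^ (m * d)) ?_ ?_ n
  · have hfact : ((n + 1).factorial : ℂ) ≠ 0 := Nat.cast_ne_zero.2 (Nat.factorial_ne_zero _)
    rw [partitionZeta_eq_hsymmSeries (by omega)]
    simp only [Nat.add_sub_cancel]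
    calc hsymmSeries f (n + 1) = (Real.pi : ℂ) ^ (m * (n + 1)) / ((n + 1).factorial : ℂ) *
          (((n + 1).factorial : ℂ) *
            (hsymmSeries f (n + 1) / (Real.pi : ℂ) ^ (m * (n + 1)))) := by
          field_simp
      _ = _ := by
          rw [← hdet]
          congr 3
          ext i j
          split_ifs
          · rw [div_mul_eq_mul_div, div_div]
          all_goals rfl
  · have hnil (μ : Sym ℕ 0) : (μ : Multiset ℕ) = 0 := Multiset.card_eq_zero.1 μ.2
    simp only [hsymmSeries, hnil]
    simp
  · intro d
    rw [← mul_div_assoc, natCast_mul_hsymmSeries hf, Finset.sum_div]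
    refine Finset.sum_congr rfl fun j hj => ?_
    have hd : m * d = m * (j + 1) + m * (d - (j + 1)) := by
      rw [← mul_add, Nat.add_sub_cancel' (Finset.mem_range.1 hj)]
    rw [hzeta, hd, pow_add, div_mul_div_comm]
end

section
/- For integers m ≥ 2 and k ≥ 1, ζ_𝒫({m}^k) = Σ_{(a₁,…,a_j)} ζ(a₁m, a₂m, …, a_jm), where the sum runs over all compositions (a₁,…,a_j) of k, i.e., all finite ordered tuples of positive integers with a₁+⋯+a_j = k. -/
/-- The multiple zeta value `ζ(m₁,…,m_j) = Σ_{n₁ > n₂ > ⋯ > n_j ≥ 1} n₁^{-m₁}⋯n_j^{-m_j}`,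
with exponents given by the list `ms`. -/
noncomputable def mzv (ms : List ℕ) : ℂ :=
  ∑' f : {f : Fin ms.length → ℕ // StrictAnti f ∧ ∀ i, 0 < f i},
    ∏ i : Fin ms.length, ((f.1 i : ℂ) ^ ms.get i)⁻¹

theorem mzv_eq_tsum_of_length_eq (ms : List ℕ) {n : ℕ} (h : n = ms.length) :
    mzv ms = ∑' f : {f : Fin n → ℕ // StrictAnti f ∧ ∀ i, 0 < f i},
      ∏ i : Fin n, ((f.1 i : ℂ) ^ ms[i])⁻¹ := by
  subst h
  rfl

/-- If each `g i` is nonnegative and summable, then so is `f ↦ ∏ i, g i (f i)`. -/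
theorem summable_prod_apply_of_nonneg {α : Type*} {n : ℕ} (g : Fin n → α → ℝ)
    (hg0 : ∀ i x, 0 ≤ g i x) (hg : ∀ i, Summable (g i)) :
    Summable fun f : Fin n → α => ∏ i, g i (f i) := by
  induction n with
  | zero => exact Summable.of_finite
  | succ n ih =>
    have h := (hg 0).mul_of_nonneg (ih (fun i => g i.succ) (fun i => hg0 i.succ)
      fun i => hg i.succ) (hg0 0) fun f => Finset.prod_nonneg fun i _ => hg0 _ _
    rw [← (Fin.consEquiv fun _ : Fin (n + 1) => α).summable_iff]
    refine h.congr fun p => ?_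
    simp [Fin.prod_univ_succ, Fin.consEquiv]

/-- The multiset in which the value `f i` is repeated `a[i]` times. -/
def multisetOfMultiplicities (a : List ℕ) (f : Fin a.length → ℕ) : Multiset ℕ :=
  ∑ i, Multiset.replicate (a.get i) (f i)

namespace multisetOfMultiplicities

variable (a : List ℕ) (f : Fin a.length → ℕ)

theorem card_eq : Multiset.card (multisetOfMultiplicities a f) = a.sum := by
  simp only [multisetOfMultiplicities, Multiset.card_sum, Multiset.card_replicate]
  exact Fin.sum_univ_getElem a

theorem prod_eq : (multisetOfMultiplicities a f).prod = ∏ i, f i ^ a.get i := by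
  simp [multisetOfMultiplicities, Multiset.prod_sum]

theorem mem_iff {a : List ℕ} {f : Fin a.length → ℕ} {x : ℕ} :
    x ∈ multisetOfMultiplicities a f ↔ ∃ i, a.get i ≠ 0 ∧ x = f i := by
  simp [multisetOfMultiplicities, Multiset.mem_sum, Multiset.mem_replicate]

theorem count_eq {a : List ℕ} {f : Fin a.length → ℕ} (hf : Function.Injective f)
    (i : Fin a.length) : (multisetOfMultiplicities a f).count (f i) = a.get i := by
  simp [multisetOfMultiplicities, Multiset.count_sum', Multiset.count_replicate, hf.eq_iff]

theorem sort_toFinset_eq {a : List ℕ} {f : Fin a.length → ℕ} (hf : StrictAnti f)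
    (ha : ∀ x ∈ a, 0 < x) :
    (multisetOfMultiplicities a f).toFinset.sort (· ≥ ·) = List.ofFn f := by
  have hset : (multisetOfMultiplicities a f).toFinset = (List.ofFn f).toFinset := by
    ext x
    simp only [Multiset.mem_toFinset, mem_iff, List.mem_toFinset, List.mem_ofFn]
    exact ⟨fun ⟨i, _, h⟩ => ⟨i, h.symm⟩, fun ⟨i, h⟩ => ⟨i, (ha _ (a.get_mem i)).ne', h.symm⟩⟩
  rw [hset, List.toFinset_sort _ (List.nodup_ofFn.2 hf.injective), List.pairwise_ofFn]
  exact fun i j hij => (hf hij).le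

theorem map_count_eq {a : List ℕ} {f : Fin a.length → ℕ} (hf : StrictAnti f)
    (ha : ∀ x ∈ a, 0 < x) :
    ((multisetOfMultiplicities a f).toFinset.sort (· ≥ ·)).map
      (fun x => (multisetOfMultiplicities a f).count x) = a := by
  rw [sort_toFinset_eq hf ha, List.map_ofFn]
  conv_rhs => rw [← List.ofFn_get a]
  congr 1
  funext i
  exact count_eq hf.injective i

theorem exists_eq (μ : Multiset ℕ) : ∃ (a : List ℕ) (f : Fin a.length → ℕ),
    (∀ x ∈ a, 0 < x) ∧ StrictAnti f ∧ (∀ i, f i ∈ μ) ∧ multisetOfMultiplicities a f = μ := by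
  set l := μ.toFinset.sort (· ≥ ·) with hl
  have hlen : (l.map (μ.count ·)).length = l.length := List.length_map _
  have hsorted : StrictAnti l.get :=
    (μ.toFinset.pairwise_sort (· ≥ ·)).sortedGE.antitone_get.strictAnti_of_injective
      (List.nodup_iff_injective_get.1 (μ.toFinset.sort_nodup _))
  refine ⟨l.map (μ.count ·), fun i => l.get (i.cast hlen), ?_, ?_, ?_, ?_⟩
  · simp [hl, Multiset.count_pos]
  · exact fun i j hij => hsorted hij
  · intro i
    exact Multiset.mem_toFinset.1 ((Finset.mem_sort _).1 (l.get_mem (i.cast hlen)))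
  · calc multisetOfMultiplicities (l.map (μ.count ·)) (fun i => l.get (i.cast hlen))
        = ∑ i : Fin l.length, Multiset.replicate (μ.count (l.get i)) (l.get i) := by
          refine Fintype.sum_equiv (finCongr hlen) _ _ fun i => ?_
          simp
      _ = (l.map fun x => Multiset.replicate (μ.count x) x).sum :=
          Fin.sum_univ_fun_getElem l fun x => Multiset.replicate (μ.count x) x
      _ = ∑ x ∈ μ.toFinset, Multiset.replicate (μ.count x) x := by
          rw [← List.sum_toFinset _ (μ.toFinset.sort_nodup _), Finset.sort_toFinset]
      _ = μ := by
          simpa [Multiset.nsmul_singleton] using μ.toFinset_sum_count_nsmul_eq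

end multisetOfMultiplicities

open multisetOfMultiplicities in
/-- A multiset of `k` positive integers is the same as a composition of `k` (the multiplicities)
with a strictly decreasing sequence of positive integers (the distinct values). -/
noncomputable def compositionSigmaEquivMultiset (k : ℕ) :
    (Σ c : Composition k, {f : Fin c.blocks.length → ℕ // StrictAnti f ∧ ∀ i, 0 < f i}) ≃
      {μ : Multiset ℕ // Multiset.card μ = k ∧ ∀ x ∈ μ, 0 < x} :=
  Equiv.ofBijective
    (fun p => ⟨multisetOfMultiplicities p.1.blocks p.2.1,
      (card_eq _ _).trans p.1.blocks_sum, fun x hx => by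
        obtain ⟨i, -, rfl⟩ := mem_iff.1 hx
        exact p.2.2.2 i⟩) <| by
    constructor
    · rintro ⟨c, f, hf, hf0⟩ ⟨d, g, hg, hg0⟩ h
      have h' : multisetOfMultiplicities c.blocks f = multisetOfMultiplicities d.blocks g :=
        congrArg Subtype.val h
      have hcd : c = d := Composition.ext <| by
        rw [← map_count_eq hf fun _ => c.blocks_pos, h', map_count_eq hg fun _ => d.blocks_pos]
      subst hcd
      have hfg : f = g := List.ofFn_injective <| by
        rw [← sort_toFinset_eq hf fun _ => c.blocks_pos, h',
          sort_toFinset_eq hg fun _ => c.blocks_pos]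
      subst hfg
      rfl
    · rintro ⟨μ, hcard, hpos⟩
      obtain ⟨a, f, ha, hf, hfμ, rfl⟩ := exists_eq μ
      exact ⟨⟨⟨a, fun {i} hi => ha i hi, (card_eq a f).symm.trans hcard⟩,
        ⟨f, hf, fun i => hpos _ (hfμ i)⟩⟩, rfl⟩

theorem summable_prod_inv_pow {n : ℕ} (e : Fin n → ℕ) (he : ∀ i, 1 < e i) :
    Summable fun f : Fin n → ℕ => ‖∏ i, ((f i : ℂ) ^ e i)⁻¹‖ := by
  simpa using summable_prod_apply_of_nonneg (fun i (x : ℕ) => ((x : ℝ) ^ e i)⁻¹)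
    (fun i x => by positivity) fun i => Real.summable_nat_pow_inv.2 (he i)

/-- for integers `m ≥ 2`, `k ≥ 1`,
`ζ_𝒫({m}^k) = Σ_{(a₁,…,a_j) comp. of k} ζ(a₁m, …, a_jm)`, summing over all compositions
of `k`. -/
theorem partitionZeta_eq_sum_mzv_compositions (m k : ℕ) (hm : 2 ≤ m) (hk : 1 ≤ k) :
    partitionZeta m k =
      ∑ c : Composition k, mzv (c.blocks.map (fun a => a * m)) := by
  have hterm (p : Σ c : Composition k,
      {f : Fin c.blocks.length → ℕ // StrictAnti f ∧ ∀ i, 0 < f i}) :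
      (((compositionSigmaEquivMultiset k p).1.prod : ℂ) ^ m)⁻¹ =
        ∏ i, ((p.2.1 i : ℂ) ^ (p.1.blocks.get i * m))⁻¹ := by
    change (((multisetOfMultiplicities p.1.blocks p.2.1).prod : ℂ) ^ m)⁻¹ = _
    rw [multisetOfMultiplicities.prod_eq]
    push_cast
    simp_rw [← Finset.prod_pow, ← Finset.prod_inv_distrib, pow_mul]
  have hsummable : Summable fun p : Σ c : Composition k,
      {f : Fin c.blocks.length → ℕ // StrictAnti f ∧ ∀ i, 0 < f i} =>
        ∏ i, ((p.2.1 i : ℂ) ^ (p.1.blocks.get i * m))⁻¹ := by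
    refine Summable.of_norm ((summable_sigma_of_nonneg fun _ => norm_nonneg _).2
      ⟨fun c => ?_, Summable.of_finite⟩)
    refine (summable_prod_inv_pow (fun i => c.blocks.get i * m) fun i => ?_).subtype _
    exact hm.trans (Nat.le_mul_of_pos_left m (c.blocks_pos (c.blocks.get_mem i)))
  rw [partitionZeta, ← (compositionSigmaEquivMultiset k).tsum_eq, tsum_congr hterm,
    hsummable.tsum_sigma, tsum_fintype]
  refine Finset.sum_congr rfl fun c _ => ?_
  rw [mzv_eq_tsum_of_length_eq _ (List.length_map (as := c.blocks) _).symm]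
  simp
end

section
/- Let n ≥ 2 and k ≥ 1 be integers. For 1 ≤ i ≤ j ≤ k set β_{i,j} := −ζ(n(j−i+1)) · (k−i)!/(k−j)!. Let B be the k×k matrix with entries B_{i,j} = β_{i,j} for j ≥ i, B_{i,j} = −1 when j = i−1, and B_{i,j} = 0 when j < i−1. Then ζ({n}^k) = ((−1)^k/k!) · det(B). -/
open Finset in
/-- Newton's identity for the values of a function on a finite set. -/
theorem Finset.succ_mul_sum_powersetCard_prod {ι R : Type*} [CommRing R] (s : Finset ι)
    (f : ι → R) (m : ℕ) :
    ((m : R) + 1) * ∑ t ∈ s.powersetCard (m + 1), ∏ i ∈ t, f i =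
      ∑ j ∈ range (m + 1), (-1) ^ j * (∑ i ∈ s, f i ^ (j + 1)) *
        ∑ t ∈ s.powersetCard (m - j), ∏ i ∈ t, f i := by
  have hval : (univ : Finset s).val.map (fun i : s => f i) = s.val.map f :=
    Multiset.attach_map_val' s.val f
  have hE (k : ℕ) : MvPolynomial.aeval (fun i : s => f i) (MvPolynomial.esymm s R k) =
      ∑ t ∈ s.powersetCard k, ∏ i ∈ t, f i := by
    rw [MvPolynomial.aeval_esymm_eq_multiset_esymm, hval, esymm_map_val]
  have hP (k : ℕ) : MvPolynomial.aeval (fun i : s => f i) (MvPolynomial.psum s R k) =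
      ∑ i ∈ s, f i ^ k := by
    rw [← sum_coe_sort s]
    simp [MvPolynomial.psum]
  have h := congrArg (MvPolynomial.aeval (fun i : s => f i))
    (MvPolynomial.mul_esymm_eq_sum s R (m + 1))
  simp only [map_mul, map_sum, map_pow, map_neg, map_one, map_natCast, hE, hP] at h
  rw [sum_filter, Nat.sum_antidiagonal_eq_sum_range_succ_mk, sum_range_succ, if_neg (by simp),
    add_zero, ← sum_range_reflect] at h
  push_cast at h
  rw [h, mul_sum]
  refine sum_congr rfl fun j hj => ?_
  have hj' : j ≤ m := by simpa [Nat.lt_succ_iff] using hj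
  obtain ⟨d, rfl⟩ := Nat.exists_eq_add_of_le hj'
  have hsub : j + d + 1 - d = j + 1 := by omega
  rw [Nat.add_sub_cancel_left, hsub, if_pos (by omega)]
  have hsign : (-1 : R) ^ (j + d + 1 + 1) * (-1) ^ d = (-1) ^ j := by
    rw [← pow_add, show j + d + 1 + 1 + d = j + 2 * (d + 1) by ring, pow_add, pow_mul]
    simp
  rw [← hsign]
  ring

/-- The elementary symmetric function of degree `k` in the values of `f`. -/
noncomputable def esymmTsum (f : ℕ → ℂ) (k : ℕ) : ℂ :=
  ∑' s : Finset ℕ, if s.card = k then ∏ i ∈ s, f i else 0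

open Filter Topology in
theorem tendsto_sum_powersetCard_prod {f : ℕ → ℂ} (hf : Summable fun i => ‖f i‖) (k : ℕ) :
    Tendsto (fun s : Finset ℕ => ∑ t ∈ s.powersetCard k, ∏ i ∈ t, f i) atTop
      (𝓝 (esymmTsum f k)) := by
  have hs : Summable fun s : Finset ℕ => if s.card = k then ∏ i ∈ s, f i else 0 := by
    refine Summable.of_norm_bounded
      (summable_finsetProd_of_summable_nonneg (fun i => norm_nonneg (f i)) hf) fun s => ?_
    split_ifs
    · exact (norm_prod s f).le
    · simpa using Finset.prod_nonneg fun i _ => norm_nonneg (f i)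
  refine (hs.hasSum.comp tendsto_finset_powerset_atTop_atTop).congr fun s => ?_
  simp only [Function.comp_apply]
  rw [← Finset.sum_filter, Finset.powersetCard_eq_filter]

theorem esymmTsum_zero (f : ℕ → ℂ) : esymmTsum f 0 = 1 := by
  rw [esymmTsum, tsum_eq_single ∅]
  · simp
  · intro s hs
    simp [hs]

open Filter in
/-- Newton's identity for an absolutely summable sequence. -/
theorem succ_mul_esymmTsum {f : ℕ → ℂ} (hf : Summable fun i => ‖f i‖) (m : ℕ) :
    ((m : ℂ) + 1) * esymmTsum f (m + 1) =
      ∑ j ∈ Finset.range (m + 1), (-1) ^ j * (∑' i, f i ^ (j + 1)) * esymmTsum f (m - j) := by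
  have hp (j : ℕ) : Summable fun i => f i ^ (j + 1) := by
    refine Summable.of_norm_bounded_eventually hf ?_
    filter_upwards [hf.tendsto_cofinite_zero.eventually_le_const one_pos] with i hi
    rw [norm_pow, pow_succ]
    exact mul_le_of_le_one_left (norm_nonneg _) (pow_le_one₀ (norm_nonneg _) hi)
  refine tendsto_nhds_unique ((tendsto_sum_powersetCard_prod hf (m + 1)).const_mul _) ?_
  simp only [Finset.succ_mul_sum_powersetCard_prod]
  exact tendsto_finsetSum _ fun j _ =>
    ((hp j).hasSum.const_mul _).mul (tendsto_sum_powersetCard_prod hf (m - j))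

theorem tsum_strictAnti_prod_eq_esymmTsum {f : ℕ → ℂ} (hf : f 0 = 0) (k : ℕ) :
    ∑' a : {a : Fin k → ℕ // StrictAnti a ∧ ∀ i, 0 < a i}, ∏ i, f (a.1 i) = esymmTsum f k := by
  let g : {a : Fin k → ℕ // StrictAnti a ∧ ∀ i, 0 < a i} → Finset ℕ :=
    fun a => Finset.univ.image a.1
  have hg : Function.Injective g := by
    intro a b hab
    refine Subtype.ext ((a.2.1.range_inj b.2.1).1 ?_)
    simpa [g] using congrArg (fun s : Finset ℕ => (s : Set ℕ)) hab
  rw [esymmTsum, ← hg.tsum_eq]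
  · refine tsum_congr fun a => ?_
    rw [if_pos, Finset.prod_image fun i _ j _ h => a.2.1.injective h]
    simp [g, Finset.card_image_of_injective _ a.2.1.injective]
  · intro s hs
    rw [Function.mem_support, ne_eq, ite_eq_right_iff, Classical.not_imp] at hs
    obtain ⟨hk, hs⟩ := hs
    have hmem (i : Fin k) : s.orderEmbOfFin hk i.rev ∈ s := s.orderEmbOfFin_mem hk _
    refine ⟨⟨fun i => s.orderEmbOfFin hk i.rev,
      fun i j hij => (s.orderEmbOfFin hk).strictMono (Fin.rev_lt_rev.2 hij),
      fun i => Nat.pos_of_ne_zero fun h => hs (Finset.prod_eq_zero (hmem i) ((congrArg f h).trans hf))⟩, ?_⟩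
    refine Finset.eq_of_subset_of_card_le (Finset.image_subset_iff.2 fun i _ => hmem i) ?_
    have hinj : Function.Injective fun i : Fin k => s.orderEmbOfFin hk i.rev :=
      (s.orderEmbOfFin hk).injective.comp Fin.rev_injective
    exact ((Finset.card_image_of_injective _ hinj).trans (by simp [hk])).ge

open scoped Matrix in
/-- If `A` is upper Hessenberg with subdiagonal entries `-1`, and `A v = c e₀` where the last
coordinate of `v` is `1`, then `det A = c`. -/
theorem Matrix.det_eq_of_hessenberg_mulVec {R : Type*} [CommRing R] {m : ℕ}
    (A : Matrix (Fin (m + 1)) (Fin (m + 1)) R)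
    (hsub : ∀ i j : Fin (m + 1), (j : ℕ) + 1 = i → A i j = -1)
    (hlow : ∀ i j : Fin (m + 1), (j : ℕ) + 1 < i → A i j = 0)
    (v : Fin (m + 1) → R) (hlast : v (Fin.last m) = 1) (c : R) (hv : A *ᵥ v = Pi.single 0 c) :
    A.det = c := by
  have hadj : A.adjugate (Fin.last m) 0 = 1 := by
    rw [adjugate_fin_succ_eq_det_submatrix, det_of_isUpperTriangular]
    · have (i : Fin m) : A i.succ i.castSucc = -1 := hsub _ _ (by simp)
      simp [this, ← mul_pow]
    · intro i j hij
      exact hlow _ _ (by simpa using hij)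
  have h := congrArg (fun w => (A.adjugate *ᵥ w) (Fin.last m)) hv
  simpa [mulVec_mulVec, adjugate_mul, smul_mulVec, hlast, hadj] using h

/-- The determinant of the upper Hessenberg matrix attached to a sequence `p` of power sums, when
`e` satisfies Newton's identities. -/
theorem Matrix.det_newton_hessenberg {K : Type*} [Field K] [CharZero K] (p e : ℕ → K)
    (he0 : e 0 = 1)
    (he : ∀ q : ℕ, ((q : K) + 1) * e (q + 1) =
      ∑ t ∈ Finset.range (q + 1), (-1) ^ t * p (t + 1) * e (q - t)) (m : ℕ) :
    Matrix.det (Matrix.of fun i j : Fin (m + 1) =>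
        if (i : ℕ) ≤ (j : ℕ) then
          -(p ((j : ℕ) - (i : ℕ) + 1) *
              ((m - (i : ℕ)).factorial : K) / ((m - (j : ℕ)).factorial : K))
        else if (j : ℕ) + 1 = (i : ℕ) then -1 else 0) =
      (-1) ^ (m + 1) * ((m + 1).factorial : K) * e (m + 1) := by
  let D : ℕ → K := fun q => (-1) ^ q * (q.factorial : K) * e q
  have hD (q : ℕ) : ∑ t ∈ Finset.range (q + 1),
      -(p (t + 1) * (q.factorial : K) / ((q - t).factorial : K)) * D (q - t) = D (q + 1) := by
    have h : D (q + 1) = (-1) ^ (q + 1) * (q.factorial : K) * (((q : K) + 1) * e (q + 1)) := by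
      simp only [D, Nat.factorial_succ]
      push_cast
      ring
    rw [h, he, Finset.mul_sum]
    refine Finset.sum_congr rfl fun t ht => ?_
    obtain ⟨d, rfl⟩ := Nat.exists_eq_add_of_le (Nat.lt_succ_iff.1 (Finset.mem_range.1 ht))
    have hd : (d.factorial : K) ≠ 0 := Nat.cast_ne_zero.2 d.factorial_ne_zero
    have hs : (-1 : K) ^ t * (-1) ^ t = 1 := by rw [← mul_pow]; simp
    simp only [D, Nat.add_sub_cancel_left]
    field_simp
    linear_combination (-1 : K) ^ d * p (t + 1) * ((t + d).factorial : K) * e d * hs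
  refine Matrix.det_eq_of_hessenberg_mulVec _ (fun i j h => ?_) (fun i j h => ?_)
    (fun j => D (m - j)) (by simp [D, he0]) _ (funext fun i => ?_)
  · rw [Matrix.of_apply, if_neg (by omega), if_pos h]
  · rw [Matrix.of_apply, if_neg (by omega), if_neg (by omega)]
  have hupper (r : ℕ) (hr : r ≤ m) : ∑ j ∈ Finset.Ico r (m + 1),
      (if r ≤ j then -(p (j - r + 1) * ((m - r).factorial : K) / ((m - j).factorial : K))
        else if j + 1 = r then -1 else 0) * D (m - j) = D (m + 1 - r) := by
    rw [Finset.sum_Ico_eq_sum_range, show m + 1 - r = m - r + 1 by omega, ← hD]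
    refine Finset.sum_congr rfl fun t _ => ?_
    rw [if_pos (by omega), Nat.add_sub_cancel_left, Nat.sub_add_eq]
  rw [Matrix.mulVec, dotProduct]
  simp only [Matrix.of_apply]
  rw [Fin.sum_univ_eq_sum_range (fun j => (if (i : ℕ) ≤ j then
      -(p (j - i + 1) * ((m - i).factorial : K) / ((m - j).factorial : K))
        else if j + 1 = i then -1 else 0) * D (m - j)) (m + 1)]
  rw [Finset.range_eq_Ico, ← Finset.sum_Ico_consecutive _ (Nat.zero_le i) i.2.le, hupper i i.is_le]
  refine Fin.cases ?_ (fun r => ?_) i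
  · simp [D]
  · rw [Fin.val_succ, ← Finset.range_eq_Ico, Finset.sum_range_succ, Finset.sum_eq_zero]
    · rw [if_neg (by omega), if_pos rfl, Pi.single_eq_of_ne (Fin.succ_ne_zero r),
        Nat.add_sub_add_right]
      ring
    · intro j hj
      have := Finset.mem_range.1 hj
      rw [if_neg (by omega), if_neg (by omega), zero_mul]

theorem mzv_replicate (n k : ℕ) (hn : n ≠ 0) :
    mzv (List.replicate k n) = esymmTsum (fun i => ((i : ℂ) ^ n)⁻¹) k := by
  rw [← tsum_strictAnti_prod_eq_esymmTsum (by simp [hn]), mzv]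
  simp only [List.get_eq_getElem, List.getElem_replicate]
  rw [List.length_replicate]

/-- for integers `n ≥ 2`, `k ≥ 1`, with
`β_{i,j} = −ζ(n(j−i+1))·(k−i)!/(k−j)!` for `1 ≤ i ≤ j ≤ k`, entries `-1` on the subdiagonal
and `0` below it, we have `ζ({n}^k) = ((−1)^k/k!)·det B`.
(Indices `i, j : Fin k` here correspond to the 1-based `i+1, j+1`.) -/
theorem mzv_replicate_det_formula (n k : ℕ) (hn : 2 ≤ n) (hk : 1 ≤ k) :
    mzv (List.replicate k n) = ((-1 : ℂ) ^ k / (k.factorial : ℂ)) *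
      Matrix.det (Matrix.of fun i j : Fin k =>
        if (i : ℕ) ≤ (j : ℕ) then
          -(riemannZeta ((n * ((j : ℕ) - (i : ℕ) + 1) : ℕ) : ℂ) *
              ((k - 1 - (i : ℕ)).factorial : ℂ) / ((k - 1 - (j : ℕ)).factorial : ℂ))
        else if (j : ℕ) + 1 = (i : ℕ) then -1 else 0) := by
  obtain ⟨m, rfl⟩ := Nat.exists_eq_add_of_le' hk
  have hf : Summable fun i : ℕ => ‖((i : ℂ) ^ n)⁻¹‖ := by
    simpa using Real.summable_nat_pow_inv.2 hn
  have he (q : ℕ) := succ_mul_esymmTsum hf q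
  have hz (j : ℕ) : ∑' i : ℕ, (((i : ℂ) ^ n)⁻¹) ^ (j + 1) =
      riemannZeta ((n * (j + 1) : ℕ) : ℂ) := by
    rw [zeta_nat_eq_tsum_of_gt_one (by nlinarith)]
    exact tsum_congr fun i => by rw [inv_pow, ← pow_mul, one_div]
  simp only [hz] at he
  have hdet := Matrix.det_newton_hessenberg (fun j => riemannZeta ((n * j : ℕ) : ℂ)) _
    (esymmTsum_zero _) he m
  rw [Nat.add_sub_cancel, hdet, mzv_replicate n (m + 1) (by omega)]
  have hfac : ((m + 1).factorial : ℂ) ≠ 0 := Nat.cast_ne_zero.2 (m + 1).factorial_ne_zero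
  have hs : (-1 : ℂ) ^ (m + 1) * (-1) ^ (m + 1) = 1 := by rw [← mul_pow]; simp
  generalize esymmTsum (fun i : ℕ => ((i : ℂ) ^ n)⁻¹) (m + 1) = e
  field_simp
  linear_combination -e * hs
end

section
/- Let k ≥ 1 be an integer and p a prime with p ≥ k+3. For an integer m ≥ 2, define D_p(1−m) ∈ ℂ as (1/k!) times the determinant of the k×k matrix whose (i,j) entry for 1 ≤ i ≤ j ≤ k is (1 − p^{−(1−m)(j−i+1)}) · ζ((1−m)(j−i+1)) · (k−i)!/(k−j)!, whose (i,j) entries are −1 when j = i−1 and 0 when j < i−1, where ζ is the analytically continued Riemann zeta function (whose values at non-positive integers are rational, so D_p(1−m) is rational). If a ≥ 1 and m₁, m₂ ≥ 2 are integers with m₁ ≡ m₂ ≡ 2 (mod p−1) and m₁ ≡ m₂ (mod p^a), and q₁, q₂ ∈ ℚ are the rationals with (q_i : ℂ) = D_p(1−m_i), then the p-adic norm satisfies |q₁ − q₂|_p ≤ p^{−(a+1)}; i.e. D_p(1−m₁) ≡ D_p(1−m₂) (mod p^{a+1}). -/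
/-- `D_p(1-m)`: the value `ζ_{𝒫_p}({1-m}^k)` of the analytically continued length-`k`
partition zeta function with parts prime to `p`, given as `(1/k!)` times the determinant of
the `k×k` matrix with `(i,j)` entry (for `i ≤ j`, `0`-based)
`(1 − p^{−(1−m)(j−i+1)})·ζ((1−m)(j−i+1))·(k−i)!/(k−j)!` (in 1-based indexing), entries `−1`
on the subdiagonal and `0` below it. -/
noncomputable def Dp (k p m : ℕ) : ℂ :=
  (1 / (k.factorial : ℂ)) *
    Matrix.det (Matrix.of fun i j : Fin k =>
      if (i : ℕ) ≤ (j : ℕ) then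
        (1 - (p : ℂ) ^ (((m : ℤ) - 1) * (((j : ℕ) : ℤ) - ((i : ℕ) : ℤ) + 1))) *
          riemannZeta ((((1 - (m : ℤ)) * (((j : ℕ) : ℤ) - ((i : ℕ) : ℤ) + 1) : ℤ) : ℂ)) *
          ((k - 1 - (i : ℕ)).factorial : ℂ) / ((k - 1 - (j : ℕ)).factorial : ℂ)
      else if (j : ℕ) + 1 = (i : ℕ) then -1 else 0)

open Filter Topology

/-- The sum of the `t`-th powers of the integers below `p ^ n` that are prime to `p`. -/
def coprimePowSum (p n t : ℕ) : ℕ :=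
  ∑ x ∈ (Finset.range (p ^ n)).filter p.Coprime, x ^ t

/-- The floor-weighted power sum `∑ ⌊c x / p ^ n⌋ x ^ s` over `x < p ^ n` prime to `p`. -/
def voronoiSum (p c n s : ℕ) : ℕ :=
  ∑ x ∈ (Finset.range (p ^ n)).filter p.Coprime, c * x / p ^ n * x ^ s

/-- `-(1 - p ^ s) ζ(-s)`, written with Bernoulli numbers. -/
def eulerBernoulli (p s : ℕ) : ℚ :=
  (1 - (p : ℚ) ^ s) * bernoulli' (s + 1) / (s + 1)

theorem coprimePowSum_mul_mod {p c n : ℕ} (hp : p.Prime) (hc : p.Coprime c) (t : ℕ) :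
    ∑ x ∈ (Finset.range (p ^ n)).filter p.Coprime, (c * x % p ^ n) ^ t = coprimePowSum p n t := by
  rcases Nat.eq_zero_or_pos n with rfl | hn
  · simp [coprimePowSum, Finset.filter_singleton, hp.ne_one]
  have hN : 0 < p ^ n := pow_pos hp.pos n
  have hmaps : Set.MapsTo (fun x ↦ c * x % p ^ n)
      ((Finset.range (p ^ n)).filter p.Coprime : Finset ℕ)
      ((Finset.range (p ^ n)).filter p.Coprime : Finset ℕ) := by
    intro x hx
    simp only [Finset.coe_filter, Finset.mem_range, Set.mem_ofPred_eq] at hx ⊢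
    refine ⟨Nat.mod_lt _ hN, ?_⟩
    rw [hp.coprime_iff_not_dvd, Nat.dvd_mod_iff (dvd_pow_self p hn.ne'),
      ← hp.coprime_iff_not_dvd]
    exact hc.mul_right hx.2
  have hinj : Set.InjOn (fun x ↦ c * x % p ^ n)
      ((Finset.range (p ^ n)).filter p.Coprime : Finset ℕ) := by
    intro x hx y hy hxy
    simp only [Finset.coe_filter, Finset.mem_range, Set.mem_ofPred_eq] at hx hy
    have h : x ≡ y [MOD p ^ n] :=
      Nat.ModEq.cancel_left_of_coprime (Nat.Coprime.pow_left n hc) hxy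
    exact h.eq_of_lt_of_lt hx.1 hy.1
  exact Finset.sum_nbij (fun x ↦ c * x % p ^ n) hmaps hinj
    (Finset.surjOn_of_injOn_of_card_le _ hmaps hinj le_rfl) fun _ _ ↦ rfl

theorem sq_dvd_coprimePowSum_sub_voronoiSum {p c : ℕ} (hp : p.Prime) (hc : p.Coprime c)
    (n s : ℕ) :
    (p : ℤ) ^ (2 * n) ∣ ((c : ℤ) ^ (s + 1) - 1) * coprimePowSum p n (s + 1) -
      (s + 1) * (p : ℤ) ^ n * (c ^ s * voronoiSum p c n s) := by
  have key : ∀ x : ℕ, (p : ℤ) ^ (2 * n) ∣ (c : ℤ) ^ (s + 1) * (x : ℤ) ^ (s + 1) -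
      ((c * x % p ^ n : ℕ) : ℤ) ^ (s + 1) -
      (s + 1) * (p : ℤ) ^ n * (c ^ s * ((c * x / p ^ n * x ^ s : ℕ) : ℤ)) := by
    intro x
    obtain ⟨k, hk⟩ := Polynomial.powAddExpansion ((c : ℤ) * x)
      (-((p : ℤ) ^ n * ((c * x / p ^ n : ℕ) : ℤ))) (s + 1)
    have hr : ((c * x % p ^ n : ℕ) : ℤ) =
        (c : ℤ) * x + -((p : ℤ) ^ n * ((c * x / p ^ n : ℕ) : ℤ)) := by
      have := Nat.mod_add_div (c * x) (p ^ n)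
      have h2 : ((c * x % p ^ n + p ^ n * (c * x / p ^ n) : ℕ) : ℤ) = ((c * x : ℕ) : ℤ) := by
        rw [this]
      rw [Nat.cast_add, Nat.cast_mul (p ^ n), Nat.cast_pow, Nat.cast_mul c] at h2
      linarith
    rw [hr, hk]
    refine ⟨-(k * ((c * x / p ^ n : ℕ) : ℤ) ^ 2), ?_⟩
    rw [Nat.add_sub_cancel, Nat.cast_mul (c * x / p ^ n)]
    push_cast
    ring
  have hS : (coprimePowSum p n (s + 1) : ℤ) =
      ∑ x ∈ (Finset.range (p ^ n)).filter p.Coprime, ((c * x % p ^ n : ℕ) : ℤ) ^ (s + 1) := by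
    rw [← coprimePowSum_mul_mod hp hc]
    push_cast
    rfl
  have hW : (voronoiSum p c n s : ℤ) = ∑ x ∈ (Finset.range (p ^ n)).filter p.Coprime,
      ((c * x / p ^ n * x ^ s : ℕ) : ℤ) := by
    rw [voronoiSum, Nat.cast_sum]
  have hS' : (coprimePowSum p n (s + 1) : ℤ) =
      ∑ x ∈ (Finset.range (p ^ n)).filter p.Coprime, (x : ℤ) ^ (s + 1) := by
    rw [coprimePowSum, Nat.cast_sum]
    simp only [Nat.cast_pow]
  have hsum := Finset.dvd_sum (s := (Finset.range (p ^ n)).filter p.Coprime) fun x _ ↦ key x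
  rw [Finset.sum_sub_distrib, Finset.sum_sub_distrib, ← hS, ← Finset.mul_sum, ← Finset.mul_sum,
    ← Finset.mul_sum, ← hW, ← hS'] at hsum
  rwa [sub_one_mul]

theorem sum_range_pow_eq_coprimePowSum_add {p : ℕ} (hp : p.Prime) (n t : ℕ) :
    ∑ x ∈ Finset.range (p ^ (n + 1)), x ^ t =
      coprimePowSum p (n + 1) t + p ^ t * ∑ x ∈ Finset.range (p ^ n), x ^ t := by
  rw [← Finset.sum_filter_add_sum_filter_not _ p.Coprime, coprimePowSum, Finset.mul_sum]
  congr 1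
  symm
  refine Finset.sum_nbij (p * ·) ?_ ?_ ?_ ?_
  · intro x hx
    simp only [Finset.mem_filter, Finset.mem_range, hp.coprime_iff_not_dvd, not_not] at hx ⊢
    exact ⟨by rw [pow_succ']; exact Nat.mul_lt_mul_of_pos_left hx hp.pos, dvd_mul_right _ _⟩
  · exact fun x _ y _ h ↦ Nat.eq_of_mul_eq_mul_left hp.pos h
  · intro y hy
    simp only [Finset.coe_filter, Set.mem_ofPred_eq, Finset.mem_range, hp.coprime_iff_not_dvd,
      not_not] at hy
    obtain ⟨hy, x, rfl⟩ := hy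
    refine ⟨x, ?_, rfl⟩
    rw [pow_succ'] at hy
    simpa using lt_of_mul_lt_mul_left hy (Nat.zero_le p)
  · intro x _
    rw [mul_pow]

section Padic

variable {p : ℕ} [hp : Fact p.Prime]

theorem Padic.tendsto_natCast_pow_atTop_zero :
    Tendsto (fun n : ℕ ↦ (p : ℚ_[p]) ^ n) atTop (𝓝 0) :=
  tendsto_pow_atTop_nhds_zero_of_norm_lt_one Padic.norm_p_lt_one

theorem Padic.natCast_prime_ne_zero : (p : ℚ_[p]) ≠ 0 :=
  Nat.cast_ne_zero.2 hp.out.ne_zero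

theorem tendsto_sum_range_pow_div (t : ℕ) :
    Tendsto (fun n : ℕ ↦ ((∑ x ∈ Finset.range (p ^ n), x ^ t : ℕ) : ℚ_[p]) / (p : ℚ_[p]) ^ n)
      atTop (𝓝 (bernoulli t : ℚ_[p])) := by
  have hform : ∀ n : ℕ,
      ((∑ x ∈ Finset.range (p ^ n), x ^ t : ℕ) : ℚ_[p]) / (p : ℚ_[p]) ^ n =
        ∑ i ∈ Finset.range (t + 1), (bernoulli i : ℚ_[p]) * ((t + 1).choose i : ℚ_[p]) *
          ((p : ℚ_[p]) ^ n) ^ (t - i) / (t + 1) := by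
    intro n
    have h := congrArg (Rat.cast : ℚ → ℚ_[p]) (sum_range_pow (p ^ n) t)
    push_cast at h ⊢
    rw [h, Finset.sum_div]
    refine Finset.sum_congr rfl fun i hi ↦ ?_
    have hi' : t + 1 - i = (t - i) + 1 := by
      have := Finset.mem_range.1 hi
      omega
    have hpn : (p : ℚ_[p]) ^ n ≠ 0 := pow_ne_zero _ Padic.natCast_prime_ne_zero
    rw [hi', pow_succ]
    field_simp
  simp_rw [hform]
  have hterm : ∀ i ∈ Finset.range (t + 1), Tendsto (fun n : ℕ ↦
      (bernoulli i : ℚ_[p]) * ((t + 1).choose i : ℚ_[p]) * ((p : ℚ_[p]) ^ n) ^ (t - i) / (t + 1))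
      atTop (𝓝 ((bernoulli i : ℚ_[p]) * ((t + 1).choose i : ℚ_[p]) * 0 ^ (t - i) / (t + 1))) :=
    fun i _ ↦ ((Padic.tendsto_natCast_pow_atTop_zero.pow _).const_mul _).div_const _
  convert tendsto_finsetSum _ hterm using 2
  rw [Finset.sum_range_succ, Finset.sum_eq_zero]
  · have : (t : ℚ_[p]) + 1 ≠ 0 := by exact_mod_cast t.succ_ne_zero
    simp only [Nat.choose_succ_self_right, Nat.sub_self, pow_zero]
    push_cast
    field_simp
    ring
  · intro i hi
    have := Finset.mem_range.1 hi
    rw [zero_pow (by omega)]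
    simp

theorem tendsto_coprimePowSum_div (s : ℕ) :
    Tendsto (fun n : ℕ ↦ (coprimePowSum p (n + 1) (s + 1) : ℚ_[p]) / (p : ℚ_[p]) ^ (n + 1))
      atTop (𝓝 ((1 - (p : ℚ_[p]) ^ s) * bernoulli (s + 1))) := by
  have h := ((tendsto_sum_range_pow_div (p := p) (s + 1)).comp (tendsto_add_atTop_nat 1)).sub
    ((tendsto_sum_range_pow_div (p := p) (s + 1)).const_mul ((p : ℚ_[p]) ^ s))
  convert h using 2 with n
  · simp only [Function.comp_apply]
    rw [sum_range_pow_eq_coprimePowSum_add hp.out]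
    have hp0 : (p : ℚ_[p]) ≠ 0 := Padic.natCast_prime_ne_zero
    push_cast
    field_simp
    ring
  · ring

theorem tendsto_voronoiSum {c s : ℕ} (hs : s ≠ 0) (hc : p.Coprime c) :
    Tendsto (fun n : ℕ ↦ (c : ℚ_[p]) ^ s * (voronoiSum p c (n + 1) s : ℚ_[p])) atTop
      (𝓝 (((c : ℚ_[p]) ^ (s + 1) - 1) * (eulerBernoulli p s : ℚ_[p]))) := by
  have hp0 : (p : ℚ_[p]) ≠ 0 := Padic.natCast_prime_ne_zero
  have hs0 : (s : ℚ_[p]) + 1 ≠ 0 := by exact_mod_cast s.succ_ne_zero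
  have hE : Tendsto (fun n : ℕ ↦ ((c : ℚ_[p]) ^ (s + 1) - 1) *
      ((coprimePowSum p (n + 1) (s + 1) : ℚ_[p]) / (p : ℚ_[p]) ^ (n + 1)) / (s + 1) -
      (c : ℚ_[p]) ^ s * (voronoiSum p c (n + 1) s : ℚ_[p])) atTop (𝓝 0) := by
    choose k hk using fun n ↦ sq_dvd_coprimePowSum_sub_voronoiSum hp.out hc (n + 1) s
    have hz : Tendsto (fun n : ℕ ↦ (p : ℚ_[p]) ^ (n + 1) * (k n : ℚ_[p]) / (s + 1))
        atTop (𝓝 0) := by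
      rw [← zero_div ((s : ℚ_[p]) + 1)]
      refine Tendsto.div_const ?_ _
      refine squeeze_zero_norm (fun n ↦ ?_) (tendsto_norm_zero.comp
        ((Padic.tendsto_natCast_pow_atTop_zero (p := p)).comp (tendsto_add_atTop_nat 1)))
      rw [norm_mul]
      exact mul_le_of_le_one_right (norm_nonneg _) (Padic.norm_int_le_one _)
    refine hz.congr fun n ↦ ?_
    have h := congrArg (Int.cast : ℤ → ℚ_[p]) (hk n)
    push_cast at h
    rw [mul_comm 2, pow_mul] at h
    have hpn : (p : ℚ_[p]) ^ (n + 1) ≠ 0 := pow_ne_zero _ hp0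
    field_simp
    linear_combination -h
  have hS := ((tendsto_coprimePowSum_div (p := p) s).const_mul
    ((c : ℚ_[p]) ^ (s + 1) - 1)).div_const ((s : ℚ_[p]) + 1)
  convert hS.sub hE using 2
  · ring
  · rw [eulerBernoulli, bernoulli_eq_bernoulli'_of_ne_one (by omega)]
    push_cast
    ring

theorem exists_coprime_norm_pow_sub_one_eq_one :
    ∃ c : ℕ, p.Coprime c ∧ ∀ t, ¬(p - 1 ∣ t) → ‖(c : ℚ_[p]) ^ t - 1‖ = 1 := by
  obtain ⟨g, hg⟩ := IsCyclic.exists_generator (α := (ZMod p)ˣ)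
  have hcast : (((g : ZMod p).val : ℕ) : ZMod p) = g := ZMod.natCast_zmod_val _
  refine ⟨(g : ZMod p).val, (ZMod.val_coe_unit_coprime g).symm, fun t ht ↦ ?_⟩
  have hint : ((((g : ZMod p).val : ℕ) : ℚ_[p]) ^ t - 1) =
      ((((g : ZMod p).val : ℤ) ^ t - 1 : ℤ) : ℚ_[p]) := by
    push_cast
    rfl
  rw [hint]
  refine le_antisymm (Padic.norm_int_le_one _) (not_lt.1 fun hlt ↦ ht ?_)
  rw [Padic.norm_intCast_lt_one_iff, ← ZMod.intCast_zmod_eq_zero_iff_dvd] at hlt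
  push_cast at hlt
  rw [hcast, sub_eq_zero] at hlt
  have : g ^ t = 1 := Units.ext (by simpa using hlt)
  rwa [← orderOf_dvd_iff_pow_eq_one, orderOf_eq_card_of_forall_mem_zpowers hg,
    Nat.card_eq_fintype_card, ZMod.card_units] at this

theorem norm_natCast_sub_le_of_modEq {b x y : ℕ} (h : x ≡ y [MOD p ^ b]) :
    ‖(x : ℚ_[p]) - y‖ ≤ (p : ℝ) ^ (-(b : ℤ)) := by
  have := (Padic.norm_int_le_pow_iff_dvd (p := p) ((x : ℤ) - y) b).2
    (by exact_mod_cast (Nat.modEq_iff_dvd.1 h.symm))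
  simpa using this

theorem Nat.Coprime.pow_modEq_pow_of_modEq {a c s₁ s₂ : ℕ} (hc : p.Coprime c)
    (h : s₁ ≡ s₂ [MOD p ^ a * (p - 1)]) : c ^ s₁ ≡ c ^ s₂ [MOD p ^ (a + 1)] := by
  wlog hle : s₁ ≤ s₂ generalizing s₁ s₂
  · exact (this h.symm (by omega)).symm
  obtain ⟨d, hd⟩ := (Nat.modEq_iff_dvd' hle).1 h
  obtain rfl : s₂ = s₁ + p ^ a * (p - 1) * d := by omega
  have hφ : c ^ (p ^ a * (p - 1)) ≡ 1 [MOD p ^ (a + 1)] := by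
    have := Nat.ModEq.pow_totient (Nat.Coprime.pow_right (a + 1) hc.symm)
    rwa [Nat.totient_prime_pow_succ hp.out] at this
  rw [pow_add c, pow_mul c (p ^ a * (p - 1)) d]
  simpa using ((hφ.pow d).mul_left (c ^ s₁)).symm

theorem voronoiSum_modEq {a c s₁ s₂ : ℕ} (n : ℕ) (h : s₁ ≡ s₂ [MOD p ^ a * (p - 1)]) :
    voronoiSum p c n s₁ ≡ voronoiSum p c n s₂ [MOD p ^ (a + 1)] := by
  unfold voronoiSum
  rw [← ZMod.natCast_eq_natCast_iff]
  push_cast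
  refine Finset.sum_congr rfl fun x hx ↦ ?_
  have := (ZMod.natCast_eq_natCast_iff _ _ _).2
    ((Finset.mem_filter.1 hx).2.pow_modEq_pow_of_modEq h)
  push_cast at this
  rw [this]

theorem norm_eulerBernoulli_le_one {s : ℕ} (hs : s ≠ 0) (hdvd : ¬(p - 1 ∣ s + 1)) :
    ‖(eulerBernoulli p s : ℚ_[p])‖ ≤ 1 := by
  obtain ⟨c, hc, hc1⟩ := exists_coprime_norm_pow_sub_one_eq_one (p := p)
  have h := le_of_tendsto (tendsto_voronoiSum hs hc).norm (Eventually.of_forall fun n ↦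
    (by exact_mod_cast Padic.norm_int_le_one (p := p) ((c ^ s * voronoiSum p c (n + 1) s : ℕ) : ℤ) :
      ‖(c : ℚ_[p]) ^ s * (voronoiSum p c (n + 1) s : ℚ_[p])‖ ≤ 1))
  rwa [norm_mul, hc1 _ hdvd, one_mul] at h

/-- Kummer's congruences. -/
theorem norm_eulerBernoulli_sub_le {a s₁ s₂ : ℕ} (hs₁ : s₁ ≠ 0) (hs₂ : s₂ ≠ 0)
    (hdvd : ¬(p - 1 ∣ s₁ + 1)) (h : s₁ ≡ s₂ [MOD p ^ a * (p - 1)]) :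
    ‖(eulerBernoulli p s₁ : ℚ_[p]) - eulerBernoulli p s₂‖ ≤
      (p : ℝ) ^ (-((a + 1 : ℕ) : ℤ)) := by
  obtain ⟨c, hc, hc1⟩ := exists_coprime_norm_pow_sub_one_eq_one (p := p)
  have hdvd₂ : ¬(p - 1 ∣ s₂ + 1) := by
    rwa [← ((h.of_mul_left _).add_right 1).dvd_iff dvd_rfl]
  have hlim := le_of_tendsto ((tendsto_voronoiSum hs₁ hc).sub (tendsto_voronoiSum hs₂ hc)).norm
    (Eventually.of_forall fun n ↦ (by
      exact_mod_cast norm_natCast_sub_le_of_modEq (p := p)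
        ((hc.pow_modEq_pow_of_modEq h).mul (voronoiSum_modEq (c := c) (n + 1) h)) :
      ‖(c : ℚ_[p]) ^ s₁ * (voronoiSum p c (n + 1) s₁ : ℚ_[p]) -
        (c : ℚ_[p]) ^ s₂ * (voronoiSum p c (n + 1) s₂ : ℚ_[p])‖ ≤
        (p : ℝ) ^ (-((a + 1 : ℕ) : ℤ))))
  have hpow : ‖(c : ℚ_[p]) ^ (s₂ + 1) - (c : ℚ_[p]) ^ (s₁ + 1)‖ ≤
      (p : ℝ) ^ (-((a + 1 : ℕ) : ℤ)) := by
    exact_mod_cast norm_natCast_sub_le_of_modEq (p := p)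
      (hc.pow_modEq_pow_of_modEq (h.symm.add_right 1))
  have hsplit : ((c : ℚ_[p]) ^ (s₁ + 1) - 1) *
      ((eulerBernoulli p s₁ : ℚ_[p]) - eulerBernoulli p s₂) =
      (((c : ℚ_[p]) ^ (s₁ + 1) - 1) * eulerBernoulli p s₁ -
        ((c : ℚ_[p]) ^ (s₂ + 1) - 1) * eulerBernoulli p s₂) +
      ((c : ℚ_[p]) ^ (s₂ + 1) - (c : ℚ_[p]) ^ (s₁ + 1)) * eulerBernoulli p s₂ := by
    ring
  rw [← one_mul ‖(eulerBernoulli p s₁ : ℚ_[p]) - _‖, ← hc1 _ hdvd, ← norm_mul, hsplit]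
  refine (Padic.nonarchimedean _ _).trans (max_le hlim ?_)
  rw [norm_mul]
  exact (mul_le_of_le_one_right (norm_nonneg _) (norm_eulerBernoulli_le_one hs₂ hdvd₂)).trans hpow

theorem Padic.norm_det_sub_det_le {ι : Type*} [Fintype ι] [DecidableEq ι]
    {A B : Matrix ι ι ℚ_[p]} {b : ℕ} (hA : ∀ i j, ‖A i j‖ ≤ 1) (hB : ∀ i j, ‖B i j‖ ≤ 1)
    (hAB : ∀ i j, ‖A i j - B i j‖ ≤ (p : ℝ) ^ (-(b : ℤ))) :
    ‖A.det - B.det‖ ≤ (p : ℝ) ^ (-(b : ℤ)) := by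
  let A' : Matrix ι ι ℤ_[p] := Matrix.of fun i j ↦ ⟨A i j, hA i j⟩
  let B' : Matrix ι ι ℤ_[p] := Matrix.of fun i j ↦ ⟨B i j, hB i j⟩
  have hAd : A.det = (A'.det : ℚ_[p]) := by
    change _ = PadicInt.Coe.ringHom A'.det
    rw [RingHom.map_det]
    rfl
  have hBd : B.det = (B'.det : ℚ_[p]) := by
    change _ = PadicInt.Coe.ringHom B'.det
    rw [RingHom.map_det]
    rfl
  have hmod : ∀ x y : ℤ_[p], PadicInt.toZModPow b x = PadicInt.toZModPow b y ↔
      ‖x - y‖ ≤ (p : ℝ) ^ (-(b : ℤ)) := fun x y ↦ by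
    rw [PadicInt.norm_le_pow_iff_mem_span_pow, ← PadicInt.ker_toZModPow, RingHom.mem_ker, map_sub,
      sub_eq_zero]
  have hdet : PadicInt.toZModPow b A'.det = PadicInt.toZModPow b B'.det := by
    rw [RingHom.map_det, RingHom.map_det]
    congr 1
    ext i j
    exact (hmod _ _).2 (hAB i j)
  rw [hAd, hBd]
  exact (hmod _ _).1 hdet

end Padic

/-- The rational matrix whose determinant is `k! • Dp k p m`. -/
def partitionZetaMatrix (k p m : ℕ) : Matrix (Fin k) (Fin k) ℚ :=
  Matrix.of fun i j ↦
    if (i : ℕ) ≤ (j : ℕ) then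
      -eulerBernoulli p ((m - 1) * ((j : ℕ) - (i : ℕ) + 1)) *
        (k - 1 - (i : ℕ)).factorial / (k - 1 - (j : ℕ)).factorial
    else if (j : ℕ) + 1 = (i : ℕ) then -1 else 0

theorem Dp_eq_ratCast (k p : ℕ) {m : ℕ} (hm : 1 ≤ m) :
    Dp k p m = (((1 / (k.factorial : ℚ)) * (partitionZetaMatrix k p m).det : ℚ) : ℂ) := by
  rw [Dp, Rat.cast_mul]
  congr 1
  · push_cast
    rfl
  · change _ = Rat.castHom ℂ _
    rw [RingHom.map_det]
    congr 1
    ext i j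
    simp only [partitionZetaMatrix, Matrix.of_apply, RingHom.mapMatrix_apply, Matrix.map_apply]
    split_ifs with hij hij'
    · obtain ⟨n, rfl⟩ : ∃ n, m = n + 1 := ⟨m - 1, by omega⟩
      obtain ⟨d, hd⟩ : ∃ d, (j : ℕ) = i + d := Nat.exists_eq_add_of_le hij
      have hexp : ((n + 1 : ℕ) : ℤ) - 1 = n := by push_cast; ring
      have hexp' : (((j : ℕ) : ℤ) - ((i : ℕ) : ℤ) + 1) = ((d + 1 : ℕ) : ℤ) := by
        rw [hd]; push_cast; ring
      have hneg : ((1 : ℤ) - ((n + 1 : ℕ) : ℤ)) * ((d + 1 : ℕ) : ℤ) =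
          -((n * (d + 1) : ℕ) : ℤ) := by push_cast; ring
      have hsub : (j : ℕ) - (i : ℕ) + 1 = d + 1 := by omega
      rw [hexp, hexp', hneg, hsub, Int.cast_neg, Int.cast_natCast, riemannZeta_neg_nat_eq_bernoulli',
        ← Nat.cast_mul, zpow_natCast, Nat.add_sub_cancel, eulerBernoulli]
      simp only [eq_ratCast]
      push_cast
      ring
    · simp
    · simp

theorem exponent_modEq {p a m₁ m₂ : ℕ} (d : ℕ) (hp : p.Prime) (hm₁ : 1 ≤ m₁) (hm₂ : 1 ≤ m₂)
    (h : m₁ ≡ m₂ [MOD p - 1]) (h' : m₁ ≡ m₂ [MOD p ^ a]) :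
    (m₁ - 1) * d ≡ (m₂ - 1) * d [MOD p ^ a * (p - 1)] := by
  have hcop : (p ^ a).Coprime (p - 1) :=
    Nat.Coprime.pow_left a ((Nat.coprime_self_sub_right hp.one_le).2 p.coprime_one_right)
  have hm : m₁ ≡ m₂ [MOD p ^ a * (p - 1)] :=
    (Nat.modEq_and_modEq_iff_modEq_mul hcop).1 ⟨h', h⟩
  refine Nat.ModEq.mul_right d (Nat.ModEq.add_right_cancel' 1 ?_)
  rwa [Nat.sub_add_cancel hm₁, Nat.sub_add_cancel hm₂]

theorem not_sub_one_dvd_exponent {p m d : ℕ} (hdp : d + 3 ≤ p) (hm : 1 ≤ m)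
    (h : m ≡ 2 [MOD p - 1]) : ¬(p - 1 ∣ (m - 1) * d + 1) := by
  have h1 : m - 1 ≡ 1 [MOD p - 1] := by
    refine Nat.ModEq.add_right_cancel' 1 ?_
    rwa [Nat.sub_add_cancel hm]
  have h2 : (m - 1) * d + 1 ≡ d + 1 [MOD p - 1] := by
    simpa using (h1.mul_right d).add_right 1
  rw [h2.dvd_iff dvd_rfl]
  exact fun hdvd ↦ absurd (Nat.le_of_dvd d.succ_pos hdvd) (by omega)

section Padic

variable {p : ℕ} [hp : Fact p.Prime]

theorem Padic.norm_factorial_eq_one {n : ℕ} (hn : n < p) : ‖(n.factorial : ℚ_[p])‖ = 1 :=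
  Padic.norm_natCast_eq_one_iff.2 (hp.out.coprime_factorial_of_lt hn)

theorem norm_partitionZetaMatrix_le_one {k m : ℕ} (hpk : k + 3 ≤ p) (hm : 2 ≤ m)
    (h : m ≡ 2 [MOD p - 1]) (i j : Fin k) :
    ‖(partitionZetaMatrix k p m i j : ℚ_[p])‖ ≤ 1 := by
  rw [partitionZetaMatrix, Matrix.of_apply]
  split_ifs
  · have hB := norm_eulerBernoulli_le_one (p := p)
      (s := (m - 1) * ((j : ℕ) - (i : ℕ) + 1)) (Nat.mul_ne_zero (by omega) (by omega))
      (not_sub_one_dvd_exponent (by omega) (by omega) h)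
    push_cast
    rw [norm_div, norm_mul, norm_neg, Padic.norm_factorial_eq_one (by omega),
      Padic.norm_factorial_eq_one (by omega)]
    simpa using hB
  · simp
  · simp

theorem norm_partitionZetaMatrix_sub_le {k a m₁ m₂ : ℕ} (hpk : k + 3 ≤ p)
    (hm₁ : 2 ≤ m₁) (hm₂ : 2 ≤ m₂) (h₁ : m₁ ≡ 2 [MOD p - 1]) (h₂ : m₂ ≡ 2 [MOD p - 1])
    (h₁₂ : m₁ ≡ m₂ [MOD p ^ a]) (i j : Fin k) :
    ‖(partitionZetaMatrix k p m₁ i j : ℚ_[p]) - partitionZetaMatrix k p m₂ i j‖ ≤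
      (p : ℝ) ^ (-((a + 1 : ℕ) : ℤ)) := by
  simp only [partitionZetaMatrix, Matrix.of_apply]
  split_ifs
  · have hB := norm_eulerBernoulli_sub_le (p := p) (a := a)
      (s₁ := (m₁ - 1) * ((j : ℕ) - (i : ℕ) + 1)) (s₂ := (m₂ - 1) * ((j : ℕ) - (i : ℕ) + 1))
      (Nat.mul_ne_zero (by omega) (by omega)) (Nat.mul_ne_zero (by omega) (by omega))
      (not_sub_one_dvd_exponent (by omega) (by omega) h₁)
      (exponent_modEq _ hp.out (by omega) (by omega) (h₁.trans h₂.symm) h₁₂)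
    push_cast
    rw [← sub_div, ← sub_mul, norm_div, norm_mul, Padic.norm_factorial_eq_one (by omega),
      Padic.norm_factorial_eq_one (by omega), neg_sub_neg, norm_sub_rev]
    simpa using hB
  · simp
    positivity
  · simp
    positivity

end Padic

/-- Kummer-type congruences for the `p`-adic interpolation of the length-`k`
partition zeta function: for a prime `p ≥ k + 3`, `a ≥ 1`, and `m₁, m₂ ≥ 2` with
`m₁ ≡ m₂ ≡ 2 (mod p−1)` and `m₁ ≡ m₂ (mod p^a)`, the rational values `D_p(1−m₁)`, `D_p(1−m₂)`
satisfy `D_p(1−m₁) ≡ D_p(1−m₂) (mod p^{a+1})`, i.e. `|q₁ − q₂|_p ≤ p^{−(a+1)}`. -/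
theorem Dp_kummer_congruence (k p : ℕ) (hk : 1 ≤ k) (hp : p.Prime) (hpk : k + 3 ≤ p)
    (a m₁ m₂ : ℕ) (ha : 1 ≤ a) (hm₁ : 2 ≤ m₁) (hm₂ : 2 ≤ m₂)
    (h₁ : m₁ ≡ 2 [MOD p - 1]) (h₂ : m₂ ≡ 2 [MOD p - 1])
    (h₁₂ : m₁ ≡ m₂ [MOD p ^ a])
    (q₁ q₂ : ℚ) (hq₁ : (q₁ : ℂ) = Dp k p m₁) (hq₂ : (q₂ : ℂ) = Dp k p m₂) :
    padicNorm p (q₁ - q₂) ≤ (p : ℚ) ^ (-((a : ℤ) + 1)) := by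
  have : Fact p.Prime := ⟨hp⟩
  have hq : ∀ {m : ℕ} {q : ℚ}, 2 ≤ m → (q : ℂ) = Dp k p m →
      q = 1 / (k.factorial : ℚ) * (partitionZetaMatrix k p m).det := fun hm hq ↦ by
    rw [Dp_eq_ratCast k p (by omega)] at hq
    exact_mod_cast hq
  have hmap : ∀ m : ℕ, (((partitionZetaMatrix k p m).det : ℚ) : ℚ_[p]) =
      ((Rat.castHom ℚ_[p]).mapMatrix (partitionZetaMatrix k p m)).det := fun m ↦
    RingHom.map_det (Rat.castHom ℚ_[p]) _
  have hdet := Padic.norm_det_sub_det_le (p := p)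
    (A := (Rat.castHom ℚ_[p]).mapMatrix (partitionZetaMatrix k p m₁))
    (B := (Rat.castHom ℚ_[p]).mapMatrix (partitionZetaMatrix k p m₂))
    (norm_partitionZetaMatrix_le_one hpk hm₁ h₁) (norm_partitionZetaMatrix_le_one hpk hm₂ h₂)
    (norm_partitionZetaMatrix_sub_le hpk hm₁ hm₂ h₁ h₂ h₁₂)
  have hnorm : ‖((q₁ - q₂ : ℚ) : ℚ_[p])‖ ≤ (p : ℝ) ^ (-((a + 1 : ℕ) : ℤ)) := by
    rw [hq hm₁ hq₁, hq hm₂ hq₂, ← mul_sub, Rat.cast_mul, Rat.cast_sub, hmap, hmap, norm_mul]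
    push_cast
    rw [norm_div, Padic.norm_factorial_eq_one (by omega)]
    simpa using hdet
  rw [Padic.eq_padicNorm] at hnorm
  rw [← Rat.cast_le (K := ℝ)]
  push_cast at hnorm ⊢
  exact hnorm
end

section
/- Let n ∈ ℕ and let α₁,…,α_n, β₁,…,β_n be complex numbers, none of which is a non-positive integer, satisfying Σ_{j=1}^{n} α_j = Σ_{j=1}^{n} β_j. Then the infinite product ∏_{k=0}^{∞} ∏_{j=1}^{n} (k+α_j)/(k+β_j) converges and equals ∏_{j=1}^{n} Γ(β_j)/Γ(α_j). -/
open Filter Asymptotics Topology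

/-- First-order expansions multiply, with a second-order error. -/
theorem isBigO_prod_sub_one_sub_sum_mul {κ ι : Type*} {l : Filter κ} {u : κ → ℂ}
    (hu : Tendsto u l (𝓝 0)) (s : Finset ι) (f : ι → κ → ℂ) (c : ι → ℂ)
    (hf : ∀ j ∈ s, (fun k => f j k - 1 - c j * u k) =O[l] fun k => u k ^ 2) :
    (fun k => ∏ j ∈ s, f j k - 1 - (∑ j ∈ s, c j) * u k) =O[l] fun k => u k ^ 2 := by
  classical
  induction s using Finset.induction_on with
  | empty => simpa using isBigO_zero (fun k => u k ^ 2) l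
  | insert a s ha ih =>
    have hs := ih fun j hj => hf j (Finset.mem_insert_of_mem hj)
    have hfa := hf a (Finset.mem_insert_self a s)
    have lin (d : ℂ) : (fun k => 1 + d * u k) =O[l] fun _ => (1 : ℂ) := by
      have : Tendsto (fun k => 1 + d * u k) l (𝓝 (1 + d * 0)) := (hu.const_mul d).const_add 1
      exact this.isBigO_one ℂ
    have hu2 : (fun k => u k ^ 2) =O[l] fun _ => (1 : ℂ) := (hu.pow 2).isBigO_one ℂ
    have hP : (fun k => ∏ j ∈ s, f j k) =O[l] fun _ => (1 : ℂ) :=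
      ((hs.trans hu2).add (lin (∑ j ∈ s, c j))).congr_left fun k => by ring
    have h1 := hfa.mul hP
    have h2 := (lin (c a)).mul hs
    have h3 := (isBigO_refl (fun k => u k ^ 2) l).const_mul_left (c a * ∑ j ∈ s, c j)
    simp only [mul_one, one_mul] at h1 h2
    refine ((h1.add h2).add h3).congr_left fun k => ?_
    rw [Finset.prod_insert ha, Finset.sum_insert ha]
    ring

theorem isBigO_add_div_add_sub_one_sub (a b : ℂ) :
    (fun k : ℕ => ((k : ℂ) + a) / ((k : ℂ) + b) - 1 - (a - b) * (k : ℂ)⁻¹) =O[atTop]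
      fun k : ℕ => (k : ℂ)⁻¹ ^ 2 := by
  have hu : Tendsto (fun k : ℕ => (k : ℂ)⁻¹) atTop (𝓝 0) := tendsto_inv_atTop_nhds_zero_nat
  have hb : Tendsto (fun k : ℕ => 1 + b * (k : ℂ)⁻¹) atTop (𝓝 1) := by
    simpa using (hu.const_mul b).const_add 1
  have hinv : (fun k : ℕ => -(a - b) * b * (1 + b * (k : ℂ)⁻¹)⁻¹) =O[atTop] fun _ => (1 : ℂ) :=
    ((hb.inv₀ one_ne_zero).const_mul _).isBigO_one ℂ
  have h := hinv.mul (isBigO_refl (fun k : ℕ => (k : ℂ)⁻¹ ^ 2) atTop)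
  simp only [one_mul] at h
  refine h.congr' ?_ EventuallyEq.rfl
  filter_upwards [hb.eventually_ne one_ne_zero, eventually_ne_atTop 0] with k hk hk0
  have hk0' : (k : ℂ) ≠ 0 := Nat.cast_ne_zero.mpr hk0
  have hkb : (k : ℂ) + b ≠ 0 := by
    intro h0
    apply hk
    field_simp
    simpa using h0
  have hkb' : 1 + b * (k : ℂ)⁻¹ = (k + b) / k := by field_simp
  rw [hkb']
  field_simp
  ring

theorem multipliable_prod_add_div_add {ι : Type*} [Fintype ι] (α β : ι → ℂ)
    (hsum : ∑ j, α j = ∑ j, β j) :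
    Multipliable fun k : ℕ => ∏ j, ((k : ℂ) + α j) / ((k : ℂ) + β j) := by
  have h := isBigO_prod_sub_one_sub_sum_mul
    (tendsto_inv_atTop_nhds_zero_nat : Tendsto (fun k : ℕ => (k : ℂ)⁻¹) atTop (𝓝 0))
    Finset.univ _ _ fun j _ => isBigO_add_div_add_sub_one_sub (α j) (β j)
  simp only [Finset.sum_sub_distrib, hsum, sub_self, zero_mul, sub_zero] at h
  have hs : Summable fun k : ℕ => ‖(k : ℂ)⁻¹ ^ 2‖ := by simp
  simpa using Complex.multipliable_one_add_of_summable
    (summable_of_isBigO_nat hs h.norm_right)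

theorem prod_range_add_div_add_eq_GammaSeq (a b : ℂ) {N : ℕ} (hN : N ≠ 0) :
    ∏ k ∈ Finset.range (N + 1), ((k : ℂ) + a) / ((k : ℂ) + b) =
      (N : ℂ) ^ (a - b) * (Complex.GammaSeq b N / Complex.GammaSeq a N) := by
  have hN' : (N : ℂ) ≠ 0 := Nat.cast_ne_zero.mpr hN
  have hfac : (N.factorial : ℂ) ≠ 0 := Nat.cast_ne_zero.mpr N.factorial_ne_zero
  have hpa : (N : ℂ) ^ a ≠ 0 := by simp [Complex.cpow_eq_zero_iff, hN]
  have hpb : (N : ℂ) ^ b ≠ 0 := by simp [Complex.cpow_eq_zero_iff, hN]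
  simp only [Finset.prod_div_distrib, Complex.GammaSeq, Complex.cpow_sub _ _ hN',
    add_comm _ a, add_comm _ b]
  field_simp

/-- (Chamberland–Straub) for `α₁,…,α_n, β₁,…,β_n ∈ ℂ`, none a non-positive
integer, with `Σ α_j = Σ β_j`, the product `∏_{k≥0} ∏_{j=1}^n (k+α_j)/(k+β_j)` converges and
equals `∏_{j=1}^n Γ(β_j)/Γ(α_j)`. -/
theorem tprod_ratio_eq_gamma_ratio (n : ℕ) (α β : Fin n → ℂ)
    (hα : ∀ j, ∀ t : ℕ, α j ≠ -(t : ℂ)) (hβ : ∀ j, ∀ t : ℕ, β j ≠ -(t : ℂ))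
    (hsum : ∑ j, α j = ∑ j, β j) :
    Multipliable (fun k : ℕ => ∏ j, ((k : ℂ) + α j) / ((k : ℂ) + β j)) ∧
    ∏' k : ℕ, ∏ j, ((k : ℂ) + α j) / ((k : ℂ) + β j) =
      ∏ j, Complex.Gamma (β j) / Complex.Gamma (α j) := by
  have hm := multipliable_prod_add_div_add α β hsum
  refine ⟨hm, tendsto_nhds_unique
    (hm.hasProd.tendsto_prod_nat.comp (tendsto_add_atTop_nat 1)) ?_⟩
  have hlim : Tendsto (fun N => ∏ j, Complex.GammaSeq (β j) N / Complex.GammaSeq (α j) N) atTop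
      (𝓝 (∏ j, Complex.Gamma (β j) / Complex.Gamma (α j))) :=
    tendsto_finsetProd _ fun j _ => (Complex.GammaSeq_tendsto_Gamma _).div
      (Complex.GammaSeq_tendsto_Gamma _) (Complex.Gamma_ne_zero (hα j))
  refine hlim.congr' ?_
  filter_upwards [eventually_ne_atTop 0] with N hN
  have hN' : (N : ℂ) ≠ 0 := Nat.cast_ne_zero.mpr hN
  have hpow : ∏ j, (N : ℂ) ^ (α j - β j) = 1 := by
    simp only [Complex.cpow_def_of_ne_zero hN']
    rw [← Complex.exp_sum, ← Finset.mul_sum, Finset.sum_sub_distrib, hsum, sub_self, mul_zero,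
      Complex.exp_zero]
  rw [Function.comp_apply, Finset.prod_comm,
    Finset.prod_congr rfl fun j _ => prod_range_add_div_add_eq_GammaSeq _ _ hN,
    Finset.prod_mul_distrib, hpow, one_mul]
end

section
/- For every integer k ≥ 1, ζ_𝒫({2}^k) = ((2^{2k−1} − 1)/2^{2k−2}) · ζ(2k); in particular ζ_𝒫({2}^k) is a rational multiple of π^{2k}. -/
open Filter Topology

/-- The multisets of cardinality `k` with entries in `{1, …, N}`. -/
def boundedMultisets : ℕ → ℕ → Finset (Multiset ℕ)
  | _, 0 => {0}
  | 0, _ + 1 => ∅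
  | N + 1, k + 1 => boundedMultisets N (k + 1) ∪
      (boundedMultisets (N + 1) k).image (Multiset.cons (N + 1))

theorem mem_boundedMultisets {N k : ℕ} {μ : Multiset ℕ} :
    μ ∈ boundedMultisets N k ↔ Multiset.card μ = k ∧ ∀ x ∈ μ, 0 < x ∧ x ≤ N := by
  induction N, k using boundedMultisets.induct generalizing μ with
  | case1 N =>
    simp only [boundedMultisets, Finset.mem_singleton, Multiset.card_eq_zero]
    constructor
    · rintro rfl
      simp
    · exact fun h => h.1
  | case2 k =>
    simp only [boundedMultisets, Finset.notMem_empty, false_iff, not_and]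
    intro h hx
    obtain ⟨a, ha⟩ := Multiset.card_pos_iff_exists_mem.1 (by omega : 0 < Multiset.card μ)
    have := hx a ha
    omega
  | case3 N k ih₁ ih₂ =>
    simp only [boundedMultisets, Finset.mem_union, Finset.mem_image, ih₁, ih₂]
    constructor
    · rintro (⟨h, hx⟩ | ⟨ν, ⟨h, hx⟩, rfl⟩)
      · exact ⟨h, fun x hxμ => ⟨(hx x hxμ).1, (hx x hxμ).2.trans N.le_succ⟩⟩
      · refine ⟨by simp [h], fun x hxμ => ?_⟩
        rcases Multiset.mem_cons.1 hxμ with rfl | hxν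
        · omega
        · exact hx x hxν
    · rintro ⟨h, hx⟩
      by_cases hN : N + 1 ∈ μ
      · obtain ⟨ν, rfl⟩ := Multiset.exists_cons_of_mem hN
        exact Or.inr ⟨ν, ⟨by simpa using h, fun x hxν => hx x (Multiset.mem_cons_of_mem hxν)⟩, rfl⟩
      · refine Or.inl ⟨h, fun x hxμ => ⟨(hx x hxμ).1, ?_⟩⟩
        have hne : x ≠ N + 1 := fun h => hN (h ▸ hxμ)
        have := (hx x hxμ).2
        omega

/-- The complete homogeneous symmetric polynomial of degree `k` evaluated at
`1, 1 / 2 ^ 2, …, 1 / N ^ 2`. -/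
noncomputable def completeSum (N k : ℕ) : ℝ :=
  ∑ μ ∈ boundedMultisets N k, ((μ.prod : ℝ) ^ 2)⁻¹

theorem completeSum_zero_right (N : ℕ) : completeSum N 0 = 1 := by
  cases N <;> simp [completeSum, boundedMultisets]

theorem completeSum_zero_succ (k : ℕ) : completeSum 0 (k + 1) = 0 := by
  simp [completeSum, boundedMultisets]

theorem completeSum_succ_succ (N k : ℕ) :
    completeSum (N + 1) (k + 1) =
      completeSum N (k + 1) + (((N : ℝ) + 1) ^ 2)⁻¹ * completeSum (N + 1) k := by
  have hd : Disjoint (boundedMultisets N (k + 1))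
      ((boundedMultisets (N + 1) k).image (Multiset.cons (N + 1))) := by
    rw [Finset.disjoint_left]
    intro μ hμ hμ'
    obtain ⟨ν, -, rfl⟩ := Finset.mem_image.1 hμ'
    have := ((mem_boundedMultisets.1 hμ).2 (N + 1) (Multiset.mem_cons_self _ _)).2
    omega
  rw [completeSum, boundedMultisets, Finset.sum_union hd,
    Finset.sum_image fun _ _ _ _ h => (Multiset.cons_inj_right _).1 h]
  simp only [completeSum, Finset.mul_sum, Multiset.prod_cons]
  push_cast
  simp only [mul_pow, mul_inv]

/-- The ratio `(N !) ^ 2 / ((N - j)! * (N + j)!)`, which vanishes for `N < j`. -/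
noncomputable def centralRatio (N j : ℕ) : ℝ :=
  ∏ i ∈ Finset.range j, ((N : ℝ) - i) / (N + i + 1)

theorem centralRatio_succ (N j : ℕ) :
    centralRatio N (j + 1) = centralRatio N j * (((N : ℝ) - j) / (N + j + 1)) :=
  Finset.prod_range_succ _ _

theorem centralRatio_eq_zero {N j : ℕ} (h : N < j) : centralRatio N j = 0 :=
  Finset.prod_eq_zero (Finset.mem_range.2 h) (by simp)

theorem abs_centralRatio_le_one (N j : ℕ) : |centralRatio N j| ≤ 1 := by
  rcases lt_or_ge N j with h | h
  · simp [centralRatio_eq_zero h]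
  · rw [centralRatio, Finset.abs_prod]
    refine Finset.prod_le_one (fun _ _ => abs_nonneg _) fun i hi => ?_
    have hi' : (i : ℝ) ≤ N := by
      exact_mod_cast (Finset.mem_range.1 hi).le.trans h
    have hpos : (0 : ℝ) < N + i + 1 := by positivity
    rw [abs_div, abs_of_nonneg (sub_nonneg.2 hi'), abs_of_pos hpos, div_le_one hpos]
    have : (0 : ℝ) ≤ i := Nat.cast_nonneg i
    linarith

theorem tendsto_centralRatio (j : ℕ) : Tendsto (fun N => centralRatio N j) atTop (𝓝 1) := by
  have h : ∀ i ∈ Finset.range j,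
      Tendsto (fun N : ℕ => ((N : ℝ) - i) / (N + i + 1)) atTop (𝓝 1) := by
    intro i _
    have h₁ : Tendsto (fun N : ℕ => 1 - (2 * (i : ℝ) + 1) / (N + (i + 1))) atTop (𝓝 (1 - 0)) :=
      tendsto_const_nhds.sub (tendsto_const_nhds.div_atTop
        (tendsto_atTop_add_const_right _ _ tendsto_natCast_atTop_atTop))
    rw [sub_zero] at h₁
    refine h₁.congr fun N => ?_
    have : (N : ℝ) + i + 1 ≠ 0 := by positivity
    rw [← add_assoc]
    field_simp
    ring
  simpa [centralRatio] using tendsto_finsetProd _ h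

theorem centralRatio_eq_succ_mul (N j : ℕ) :
    centralRatio N j = centralRatio (N + 1) j * (1 - (j : ℝ) ^ 2 / ((N : ℝ) + 1) ^ 2) := by
  induction j with
  | zero => simp [centralRatio]
  | succ j ih =>
    rw [centralRatio_succ, centralRatio_succ, ih]
    have h₁ : (N : ℝ) + 1 ≠ 0 := by positivity
    have h₂ : (N : ℝ) + j + 1 ≠ 0 := by positivity
    have h₃ : (N : ℝ) + 1 + j + 1 ≠ 0 := by positivity
    push_cast
    field_simp
    ring

theorem two_mul_sum_centralRatio (N M : ℕ) :
    2 * ∑ j ∈ Finset.range M, (-1) ^ j * centralRatio (N + 1) (j + 1) =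
      1 - (-1) ^ M * (centralRatio (N + 1) M * (((N : ℝ) + 1 - M) / (N + 1))) := by
  have h₁ : (N : ℝ) + 1 ≠ 0 := by positivity
  induction M with
  | zero => simp [centralRatio, h₁]
  | succ M ih =>
    have h₂ : (N : ℝ) + 1 + M + 1 ≠ 0 := by positivity
    rw [Finset.sum_range_succ, mul_add, ih, centralRatio_succ]
    push_cast
    field_simp
    ring

/-- Partial fraction expansion of the complete homogeneous symmetric polynomials at the
reciprocals of squares. -/
theorem completeSum_eq_sum (N k : ℕ) (h : N ≠ 0 ∨ k ≠ 0) :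
    completeSum N k = ∑ j ∈ Finset.range N,
      2 * (-1) ^ j * centralRatio N (j + 1) / ((j : ℝ) + 1) ^ (2 * k) := by
  induction N, k using boundedMultisets.induct with
  | case1 N =>
    obtain ⟨N, rfl⟩ := Nat.exists_eq_succ_of_ne_zero (by simpa using h)
    have := two_mul_sum_centralRatio N (N + 1)
    simp only [Finset.mul_sum, ← mul_assoc] at this
    simp [completeSum_zero_right, this]
  | case2 k => simp [completeSum_zero_succ]
  | case3 N k ih₁ ih₂ =>
    have hN : ∑ j ∈ Finset.range N,
        2 * (-1) ^ j * centralRatio N (j + 1) / ((j : ℝ) + 1) ^ (2 * (k + 1)) =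
        ∑ j ∈ Finset.range (N + 1),
          2 * (-1) ^ j * centralRatio N (j + 1) / ((j : ℝ) + 1) ^ (2 * (k + 1)) := by
      rw [Finset.sum_range_succ, centralRatio_eq_zero N.lt_succ_self]
      simp
    rw [completeSum_succ_succ, ih₁ (by simp), ih₂ (by simp), hN, Finset.mul_sum,
      ← Finset.sum_add_distrib]
    refine Finset.sum_congr rfl fun j _ => ?_
    have h₁ : (N : ℝ) + 1 ≠ 0 := by positivity
    have h₂ : (j : ℝ) + 1 ≠ 0 := by positivity
    rw [centralRatio_eq_succ_mul N]
    push_cast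
    rw [mul_add 2 k 1, pow_add]
    field_simp
    ring

theorem summable_one_div_succ_pow {k : ℕ} (hk : 1 ≤ k) :
    Summable fun j : ℕ => 1 / ((j : ℝ) + 1) ^ (2 * k) := by
  have := (summable_nat_add_iff 1).2
    (Real.summable_one_div_nat_pow.2 (by omega : 1 < 2 * k))
  simpa using this

theorem tendsto_completeSum {k : ℕ} (hk : 1 ≤ k) :
    Tendsto (fun N => completeSum N k) atTop
      (𝓝 (∑' j : ℕ, 2 * (-1) ^ j / ((j : ℝ) + 1) ^ (2 * k))) := by
  have h : ∀ N, completeSum N k =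
      ∑' j : ℕ, 2 * (-1) ^ j * centralRatio N (j + 1) / ((j : ℝ) + 1) ^ (2 * k) := by
    intro N
    rw [completeSum_eq_sum N k (Or.inr (by omega))]
    refine (tsum_eq_sum fun j hj => ?_).symm
    rw [centralRatio_eq_zero (by simpa [Nat.lt_succ_iff] using hj)]
    simp
  simp only [h]
  refine tendsto_tsum_of_dominated_convergence
    ((summable_one_div_succ_pow hk).mul_left 2) (fun j => ?_)
    (Eventually.of_forall fun N j => ?_)
  · simpa using ((tendsto_centralRatio (j + 1)).const_mul (2 * (-1) ^ j)).div_const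
      (((j : ℝ) + 1) ^ (2 * k))
  · have hp : (0 : ℝ) < ((j : ℝ) + 1) ^ (2 * k) := by positivity
    rw [Real.norm_eq_abs, abs_div, abs_mul, abs_mul, abs_pow, abs_of_pos hp]
    simp only [abs_neg, abs_one, one_pow, mul_one, Nat.abs_ofNat]
    rw [mul_one_div]
    gcongr
    linarith [abs_centralRatio_le_one N (j + 1)]

theorem tsum_neg_one_pow_mul {f : ℕ → ℝ} (hf : Summable f) :
    ∑' n, (-1) ^ n * f n = 2 * ∑' n, f (2 * n) - ∑' n, f n := by
  have he : Summable fun n => f (2 * n) :=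
    hf.comp_injective (mul_right_injective₀ two_ne_zero)
  have ho : Summable fun n => f (2 * n + 1) :=
    hf.comp_injective ((add_left_injective 1).comp (mul_right_injective₀ two_ne_zero))
  have h₁ : ∀ n, (-1) ^ (2 * n) * f (2 * n) = f (2 * n) := fun n => by simp [pow_mul]
  have h₂ : ∀ n, (-1) ^ (2 * n + 1) * f (2 * n + 1) = -f (2 * n + 1) := fun n => by
    simp [pow_succ, pow_mul]
  rw [← tsum_even_add_odd he ho, ← tsum_even_add_odd (f := fun n => (-1) ^ n * f n)
    (he.congr fun n => (h₁ n).symm) (ho.neg.congr fun n => (h₂ n).symm)]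
  simp only [h₁, h₂, tsum_neg]
  ring

theorem tsum_alternating_eq {k : ℕ} (hk : 1 ≤ k) :
    ∑' j : ℕ, 2 * (-1) ^ j / ((j : ℝ) + 1) ^ (2 * k) =
      (2 ^ (2 * k - 1) - 1) / 2 ^ (2 * k - 2) * ∑' n : ℕ, 1 / (n : ℝ) ^ (2 * k) := by
  have hs : Summable fun n : ℕ => 1 / (n : ℝ) ^ (2 * k) :=
    Real.summable_one_div_nat_pow.2 (by omega)
  have heven : ∑' n : ℕ, 1 / ((2 * n : ℕ) : ℝ) ^ (2 * k) =
      1 / 2 ^ (2 * k) * ∑' n : ℕ, 1 / (n : ℝ) ^ (2 * k) := by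
    rw [← tsum_mul_left]
    refine tsum_congr fun n => ?_
    rw [Nat.cast_mul, Nat.cast_ofNat, mul_pow, one_div_mul_one_div]
  have halt := tsum_neg_one_pow_mul hs
  have hsa : Summable fun n : ℕ => (-1) ^ n * (1 / (n : ℝ) ^ (2 * k)) :=
    Summable.of_norm (hs.congr fun n => by simp)
  have hshift : ∑' j : ℕ, 2 * (-1) ^ j / ((j : ℝ) + 1) ^ (2 * k) =
      -2 * ∑' n : ℕ, (-1) ^ n * (1 / (n : ℝ) ^ (2 * k)) := by
    have h0 : 2 * k ≠ 0 := by omega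
    rw [hsa.tsum_eq_zero_add, Nat.cast_zero, zero_pow h0, div_zero, mul_zero, zero_add,
      ← tsum_mul_left]
    refine tsum_congr fun j => ?_
    rw [Nat.cast_succ, pow_succ]
    ring
  rw [hshift, halt, heven]
  generalize ∑' n : ℕ, 1 / (n : ℝ) ^ (2 * k) = Z
  obtain ⟨m, rfl⟩ := Nat.exists_eq_add_of_le' hk
  rw [show 2 * (m + 1) - 1 = 2 * m + 1 by omega, show 2 * (m + 1) - 2 = 2 * m by omega,
    show 2 * (m + 1) = 2 * m + 2 by ring, pow_add, pow_succ]
  field_simp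
  ring

theorem hasSum_inv_prod_sq {k : ℕ} {L : ℝ}
    (hL : Tendsto (fun N => completeSum N k) atTop (𝓝 L)) :
    HasSum (fun μ : {μ : Multiset ℕ // Multiset.card μ = k ∧ ∀ x ∈ μ, 0 < x} =>
      ((μ.1.prod : ℝ) ^ 2)⁻¹) L := by
  let S : ℕ → Finset {μ : Multiset ℕ // Multiset.card μ = k ∧ ∀ x ∈ μ, 0 < x} := fun N =>
    (boundedMultisets N k).subtype _
  have hmem : ∀ N μ, μ ∈ S N ↔ ∀ x ∈ μ.1, x ≤ N := fun N μ => by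
    simp only [S, Finset.mem_subtype, mem_boundedMultisets]
    exact ⟨fun h x hx => (h.2 x hx).2, fun h => ⟨μ.2.1, fun x hx => ⟨μ.2.2 x hx, h x hx⟩⟩⟩
  have hsum : ∀ N, ∑ μ ∈ S N, ((μ.1.prod : ℝ) ^ 2)⁻¹ = completeSum N k := fun N =>
    Finset.sum_subtype_of_mem (fun μ : Multiset ℕ => ((μ.prod : ℝ) ^ 2)⁻¹) fun μ hμ => by
      have := mem_boundedMultisets.1 hμ
      exact ⟨this.1, fun x hx => (this.2 x hx).1⟩
  have hmono : Monotone S := fun N M h μ hμ =>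
    (hmem M μ).2 fun x hx => ((hmem N μ).1 hμ x hx).trans h
  have hS : Tendsto S atTop atTop := tendsto_atTop_finset_of_monotone hmono fun μ =>
    ⟨μ.1.sum, (hmem _ μ).2 fun x hx => Multiset.single_le_sum (fun _ _ => Nat.zero_le _) x hx⟩
  have hnn : ∀ μ : {μ : Multiset ℕ // Multiset.card μ = k ∧ ∀ x ∈ μ, 0 < x},
      0 ≤ ((μ.1.prod : ℝ) ^ 2)⁻¹ := fun μ => by positivity
  have hle : ∀ N, completeSum N k ≤ L := by
    refine Monotone.ge_of_tendsto (fun N M h => ?_) hL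
    simp only [← hsum]
    exact Finset.sum_le_sum_of_subset_of_nonneg (hmono h) fun μ _ _ => hnn μ
  have hsummable : Summable fun μ : {μ : Multiset ℕ // Multiset.card μ = k ∧ ∀ x ∈ μ, 0 < x} =>
      ((μ.1.prod : ℝ) ^ 2)⁻¹ := by
    refine summable_of_sum_le hnn (c := L) fun s => ?_
    obtain ⟨N, hN⟩ := (hS.eventually_ge_atTop s).exists
    calc _ ≤ ∑ μ ∈ S N, ((μ.1.prod : ℝ) ^ 2)⁻¹ :=
          Finset.sum_le_sum_of_subset_of_nonneg hN fun μ _ _ => hnn μ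
      _ ≤ L := (hsum N).trans_le (hle N)
  have hlim := hsummable.hasSum.comp hS
  rw [tendsto_nhds_unique hL (hlim.congr hsum)]
  exact hsummable.hasSum

theorem partitionZeta_two_eq_ofReal {k : ℕ} (hk : 1 ≤ k) :
    partitionZeta 2 k =
      (((2 ^ (2 * k - 1) - 1) / 2 ^ (2 * k - 2) * ∑' n : ℕ, 1 / (n : ℝ) ^ (2 * k) : ℝ) : ℂ) := by
  rw [← tsum_alternating_eq hk, ← (hasSum_inv_prod_sq (tendsto_completeSum hk)).tsum_eq,
    Complex.ofReal_tsum, partitionZeta]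
  exact tsum_congr fun μ => by
    rw [Complex.ofReal_inv, Complex.ofReal_pow, Complex.ofReal_natCast]

/-- for every integer `k ≥ 1`,
`ζ_𝒫({2}^k) = ((2^{2k−1} − 1)/2^{2k−2})·ζ(2k)`; in particular `ζ_𝒫({2}^k)` is a rational
multiple of `π^{2k}`. -/
theorem partitionZeta_two_pow (k : ℕ) (hk : 1 ≤ k) :
    partitionZeta 2 k =
      (((2 : ℂ) ^ (2 * k - 1) - 1) / (2 : ℂ) ^ (2 * k - 2)) * riemannZeta ((2 * k : ℕ) : ℂ) ∧
    ∃ q : ℚ, partitionZeta 2 k = (q : ℂ) * (Real.pi : ℂ) ^ (2 * k) := by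
  rw [partitionZeta_two_eq_ofReal hk]
  have hz : riemannZeta ((2 * k : ℕ) : ℂ) = ((∑' n : ℕ, 1 / (n : ℝ) ^ (2 * k) : ℝ) : ℂ) := by
    rw [zeta_nat_eq_tsum_of_gt_one (by omega)]
    push_cast
    rfl
  refine ⟨by rw [hz]; push_cast; rfl, ?_⟩
  refine ⟨(2 ^ (2 * k - 1) - 1) / 2 ^ (2 * k - 2) *
    ((-1) ^ (k + 1) * 2 ^ (2 * k - 1) * bernoulli (2 * k) / (2 * k).factorial), ?_⟩
  rw [(hasSum_zeta_nat (by omega : k ≠ 0)).tsum_eq]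
  push_cast
  ring
end
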